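/- There exist an absolute constant C>0 and n₀ such that the following holds for all n ≥ n₀. Let (d_w)_{w∈W} be a sequence of nonnegative integers with even sum on a set W of n vertices; define β_w by d_w = (n−1)/2 + β_w√(n−1)/2, and suppose |β_w| ≤ log n for each w∈W. Then (d_w)_{w∈W} is a graphic sequence. Moreover, letting G be a uniformly random graph on W with degree sequence (d_w)_{w∈W}, for any fixed v∈W, any S⊆W with h:=|S| satisfying min(h, n−h) ≥ n/(log n)^{1/8}, and any integer t∈[0,d_v], we have P(deg_S(v)=t) = (1+θ)·[C(h−𝟙_S(v), t)·C(n−h−𝟙_{W∖S}(v), d_v−t)/C(n−1, d_v)]·exp(Λ₁ − Λ₃)·E_T[exp(−Λ_T)] for some θ with |θ| ≤ C n^{−1/6}, where T = T₁∪T₂ is a random set chosen by picking T₁ uniformly among the t-element subsets of S∖{v} and, independently, T₂ uniformly among the (d_v−t)-element subsets of (W∖S)∖{v}, and where Λ₁ = (1/(2n²))(Σ_{i∈W}β_i)(Σ_{i∈W}β_i − 2nβ_v), Λ₃ = (1/2)Σ_{i∈W∖{v}} β_i²/(n−1), and Λ_T = Σ_{i∈W∖{v}} (−1)^{𝟙_T(i)}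 β_i/√(n−1). -/

import Mathlib

open Finset

open scoped Classical

/-- The number of neighbours of `v` (in the graph `G`) lying in the set `S`. -/
noncomputable def degIn {n : ℕ} (G : SimpleGraph (Fin n)) (S : Finset (Fin n)) (v : Fin n) : ℕ :=
  (S.filter fun w => G.Adj v w).card

/-- The set of simple graphs on `Fin n` with degree sequence `d`. -/
noncomputable def degSeqGraphs (n : ℕ) (d : Fin n → ℕ) : Finset (SimpleGraph (Fin n)) :=
  univ.filter fun G => ∀ w, degIn G Finset.univ w = d w

/-- For a uniformly random graph with degree sequence `d`, the probability that the number of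
neighbours of `v` in `S` equals `t`. -/
noncomputable def degProb (n : ℕ) (d : Fin n → ℕ) (S : Finset (Fin n)) (v : Fin n)
    (t : ℕ) : ℝ :=
  (((degSeqGraphs n d).filter fun G => degIn G S v = t).card : ℝ) /
    ((degSeqGraphs n d).card : ℝ)

/-- `β_w`, defined by `d_w = (n-1)/2 + β_w √(n-1) / 2`. -/
noncomputable def beta (n : ℕ) (d : Fin n → ℕ) (w : Fin n) : ℝ :=
  (2 * (d w : ℝ) - ((n : ℝ) - 1)) / Real.sqrt ((n : ℝ) - 1)

noncomputable def Lam1 (n : ℕ) (d : Fin n → ℕ) (v : Fin n) : ℝ :=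
  (1 / (2 * (n : ℝ) ^ 2)) * (∑ i, beta n d i) * ((∑ i, beta n d i) - 2 * (n : ℝ) * beta n d v)

noncomputable def Lam3 (n : ℕ) (d : Fin n → ℕ) (v : Fin n) : ℝ :=
  (1 / 2) * ∑ i ∈ Finset.univ.erase v, (beta n d i) ^ 2 / ((n : ℝ) - 1)

/-- `Λ_T = ∑_{i ∈ W \ {v}} (-1)^{𝟙_T(i)} β_i / √(n-1)`. -/
noncomputable def LamT (n : ℕ) (d : Fin n → ℕ) (v : Fin n) (T : Finset (Fin n)) : ℝ :=
  ∑ i ∈ Finset.univ.erase v,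
    (if i ∈ T then -(beta n d i) else beta n d i) / Real.sqrt ((n : ℝ) - 1)

/-- `E_T[exp(-Λ_T)]`, where `T = T₁ ∪ T₂` with `T₁` uniform among `t`-element subsets of
`S \ {v}` and, independently, `T₂` uniform among `(d_v - t)`-element subsets of
`(W \ S) \ {v}`. -/
noncomputable def expLamT (n : ℕ) (d : Fin n → ℕ) (v : Fin n) (S : Finset (Fin n))
    (t : ℕ) : ℝ :=
  (∑ T₁ ∈ Finset.powersetCard t (S.erase v),
      ∑ T₂ ∈ Finset.powersetCard (d v - t) (Sᶜ.erase v),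
        Real.exp (-(LamT n d v (T₁ ∪ T₂)))) /
    (((Finset.powersetCard t (S.erase v)).card : ℝ) *
      ((Finset.powersetCard (d v - t) (Sᶜ.erase v)).card : ℝ))

namespace SignedGraph

/-- The graph obtained by changing the status of the pair `i j`. -/
def toggle {V : Type} (i j : V) (G : SimpleGraph V) : SimpleGraph V :=
  symmDiff G (SimpleGraph.edge i j)

lemma toggle_toggle {V : Type} (i j : V) (G : SimpleGraph V) : toggle i j (toggle i j G) = G :=
  symmDiff_symmDiff_cancel_right _ _

section Basic

variable {V : Type} [DecidableEq V]

/-- The signed adjacency matrix: `1` on edges, `-1` on non-edges, `0` on the diagonal. -/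
noncomputable def sgn (G : SimpleGraph V) (a b : V) : ℝ :=
  if a = b then 0 else if G.Adj a b then 1 else -1

@[simp] lemma sgn_self (G : SimpleGraph V) (a : V) : sgn G a a = 0 := by simp [sgn]

lemma sgn_comm (G : SimpleGraph V) (a b : V) : sgn G a b = sgn G b a := by
  simp [sgn, eq_comm, G.adj_comm]

lemma sgn_eq_or (G : SimpleGraph V) {a b : V} (h : a ≠ b) : sgn G a b = 1 ∨ sgn G a b = -1 := by
  by_cases h' : G.Adj a b <;> simp [sgn, h, h']

lemma abs_sgn_le (G : SimpleGraph V) (a b : V) : |sgn G a b| ≤ 1 := by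
  by_cases h : a = b
  · simp [h]
  · rcases sgn_eq_or G h with h | h <;> simp [h]

lemma sgn_toggle (i j : V) (G : SimpleGraph V) (a b : V) :
    sgn (toggle i j G) a b =
      if a = i ∧ b = j ∨ a = j ∧ b = i then -sgn G a b else sgn G a b := by
  by_cases hab : a = b
  · simp [hab]
  · have : (toggle i j G).Adj a b ↔ Xor (G.Adj a b) (a = i ∧ b = j ∨ a = j ∧ b = i) := by
      simp [toggle, symmDiff, Xor, SimpleGraph.edge_adj, hab]
    simp only [sgn, hab, if_false, this]
    by_cases h1 : G.Adj a b <;> by_cases h2 : a = i ∧ b = j ∨ a = j ∧ b = i <;>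
      simp [h1, h2, Xor]

lemma sgn_toggle_same (i j : V) (G : SimpleGraph V) :
    sgn (toggle i j G) i j = -sgn G i j := by simp [sgn_toggle]

lemma sgn_toggle_of_ne {i j : V} (G : SimpleGraph V) {a b : V}
    (h : ¬(a = i ∧ b = j ∨ a = j ∧ b = i)) : sgn (toggle i j G) a b = sgn G a b := by
  rw [sgn_toggle, if_neg h]

lemma sgn_trichotomy (G : SimpleGraph V) (a k : V) :
    sgn G a k = 0 ∨ sgn G a k = 1 ∨ sgn G a k = -1 := by
  by_cases h : a = k
  · simp [h]
  · exact Or.inr (sgn_eq_or G h)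

lemma one_add_mul_sgn_bounds (G : SimpleGraph V) {s : ℝ} (hs : |s| ≤ 1) (a b : V) :
    0 ≤ 1 + s * sgn G a b ∧ 1 + s * sgn G a b ≤ 2 := by
  have : |s * sgn G a b| ≤ 1 := by
    rw [abs_mul]
    exact mul_le_one₀ hs (abs_nonneg _) (abs_sgn_le _ _ _)
  constructor <;> linarith [(abs_le.1 this).1, (abs_le.1 this).2]

lemma one_sub_mul_sgn_bounds (G : SimpleGraph V) {s : ℝ} (hs : |s| ≤ 1) (a b : V) :
    0 ≤ 1 - s * sgn G a b ∧ 1 - s * sgn G a b ≤ 2 := by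
  have := one_add_mul_sgn_bounds G (s := -s) (by rwa [abs_neg]) a b
  constructor <;> linarith [this.1, this.2]

lemma switch_term_bounds (G : SimpleGraph V) {s : ℝ} (hs : |s| ≤ 1) (i j k l : V) :
    0 ≤ (1 - s * sgn G i k) * ((1 + s * sgn G k l) * (1 - s * sgn G j l)) ∧
      (1 - s * sgn G i k) * ((1 + s * sgn G k l) * (1 - s * sgn G j l)) ≤ 8 := by
  obtain ⟨a1, a2⟩ := one_sub_mul_sgn_bounds G hs i k
  obtain ⟨b1, b2⟩ := one_add_mul_sgn_bounds G hs k l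
  obtain ⟨c1, c2⟩ := one_sub_mul_sgn_bounds G hs j l
  have h1 := mul_nonneg b1 c1
  have h2 := mul_le_mul b2 c2 c1 (by norm_num)
  refine ⟨mul_nonneg a1 h1, ?_⟩
  have h3 := mul_le_mul a2 h2 h1 (by norm_num)
  linarith

end Basic

variable {V : Type} [Fintype V] [DecidableEq V]

lemma sum_comp_toggle (i j : V) (f : SimpleGraph V → ℝ) :
    ∑ G, f (toggle i j G) = ∑ G, f G :=
  Equiv.sum_comp ⟨toggle i j, toggle i j, toggle_toggle i j, toggle_toggle i j⟩ f

lemma sum_sgn_toggle {i j : V} (hij : i ≠ j) (G : SimpleGraph V) (a : V) :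
    ∑ b, sgn (toggle i j G) a b =
      ∑ b, sgn G a b - 2 * sgn G i j * ((if a = i then 1 else 0) + (if a = j then 1 else 0)) := by
  have : ∀ b, sgn (toggle i j G) a b = sgn G a b - 2 * sgn G i j *
      ((if a = i then if b = j then 1 else 0 else 0) +
        (if a = j then if b = i then 1 else 0 else 0)) := by
    intro b
    rw [sgn_toggle]
    by_cases h1 : a = i
    · subst h1
      by_cases h2 : b = j
      · subst h2; simp [hij]; ring
      · simp [h2, hij]
    · by_cases h3 : a = j
      · subst h3
        by_cases h2 : b = i
        · subst h2; simp [hij, hij.symm, sgn_comm G a b]; ring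
        · simp [h2, hij.symm]
      · simp [h1, h3]
  simp_rw [this]
  rw [Finset.sum_sub_distrib, ← Finset.mul_sum, Finset.sum_add_distrib]
  by_cases h1 : a = i <;> by_cases h3 : a = j <;> simp [h1, h3]

/-- The graphs on `V` with prescribed (integer) degrees. -/
noncomputable def realizations (d : V → ℤ) : Finset (SimpleGraph V) :=
  univ.filter fun G => ∀ a, ∑ b, sgn G a b = 2 * (d a : ℝ) - ((Fintype.card V : ℝ) - 1)

lemma mem_realizations {d : V → ℤ} {G : SimpleGraph V} :
    G ∈ realizations d ↔ ∀ a, ∑ b, sgn G a b = 2 * (d a : ℝ) - ((Fintype.card V : ℝ) - 1) := by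
  simp [realizations]

lemma sum_sgn_eq_card (G : SimpleGraph V) (a : V) :
    ∑ b, sgn G a b =
      2 * ((univ.filter fun b => G.Adj a b).card : ℝ) - ((Fintype.card V : ℝ) - 1) := by
  have : ∀ b, sgn G a b = 2 * (if G.Adj a b then 1 else 0) - (1 - if b = a then 1 else 0) := by
    intro b
    by_cases h : b = a
    · subst h; simp
    · by_cases h' : G.Adj a b <;> simp [sgn, h, h', Ne.symm h] ; norm_num
  simp_rw [this]
  rw [Finset.sum_sub_distrib, ← Finset.mul_sum, Finset.sum_sub_distrib]
  simp

lemma mem_realizations_iff_card {d : V → ℤ} {G : SimpleGraph V} :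
    G ∈ realizations d ↔ ∀ a, ((univ.filter fun b => G.Adj a b).card : ℤ) = d a := by
  rw [mem_realizations]
  refine forall_congr' fun a => ?_
  rw [sum_sgn_eq_card]
  constructor
  · intro h
    have : ((univ.filter fun b => G.Adj a b).card : ℝ) = (d a : ℝ) := by linarith
    exact_mod_cast this
  · intro h
    rw [← h]; simp

lemma toggle_mem_realizations {i j : V} (hij : i ≠ j) {d d' : V → ℤ} {G : SimpleGraph V} {s : ℤ}
    (hs : sgn G i j = s) (hd : d' = d - s • (Pi.single i 1 + Pi.single j 1)) :
    toggle i j G ∈ realizations d' ↔ G ∈ realizations d := by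
  subst hd
  rw [mem_realizations, mem_realizations]
  refine forall_congr' fun a => ?_
  rw [sum_sgn_toggle hij, hs]
  simp only [Pi.sub_apply, Pi.smul_apply, Pi.add_apply, Pi.single_apply, smul_eq_mul]
  push_cast
  constructor <;> intro h <;> linarith

/-- Transfer of a weighted count along a bijection of graphs. -/
lemma sum_realizations_transfer {τ : SimpleGraph V → SimpleGraph V}
    (hτ : ∀ f : SimpleGraph V → ℝ, ∑ G, f (τ G) = ∑ G, f G) {d d' : V → ℤ}
    {f g : SimpleGraph V → ℝ} (hfg : ∀ G, f G = g (τ G))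
    (hmem : ∀ G, f G ≠ 0 → (τ G ∈ realizations d' ↔ G ∈ realizations d)) :
    ∑ G ∈ realizations d, f G = ∑ G ∈ realizations d', g G := by
  have key : ∀ (e : V → ℤ) (h : SimpleGraph V → ℝ),
      ∑ G ∈ realizations e, h G = ∑ G, if G ∈ realizations e then h G else 0 := by
    intro e h
    rw [← Finset.sum_filter]
    simp
  rw [key, key, ← hτ (fun G => if G ∈ realizations d' then g G else 0)]
  refine Finset.sum_congr rfl fun G _ => ?_
  by_cases h0 : f G = 0
  · simp [← hfg, h0]
  · simp [← hfg, hmem G h0]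

/-- Adding an edge: graphs without the edge `i j` correspond to graphs with it. -/
lemma sum_add_edge {i j : V} (hij : i ≠ j) {d d' : V → ℤ}
    (hd : d' = d + (Pi.single i 1 + Pi.single j 1)) :
    ∑ G ∈ realizations d, (1 - sgn G i j) = ∑ G ∈ realizations d', (1 + sgn G i j) := by
  refine sum_realizations_transfer (sum_comp_toggle i j) (fun G => ?_) (fun G hG => ?_)
  · rw [sgn_toggle_same]; ring
  · refine toggle_mem_realizations hij (s := -1) ?_ (by rw [hd]; module)
    rcases sgn_eq_or G hij with h | h
    · simp [h] at hG
    · simp [h]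

/-- Moving an edge from `m i` to `m j`. -/
lemma sum_move_edge {i j m : V} (hij : i ≠ j) (hmi : m ≠ i) (hmj : m ≠ j) {d d' : V → ℤ}
    (hd : d' = d - Pi.single i 1 + Pi.single j 1) {Φ : SimpleGraph V → ℝ}
    (hΦ : ∀ G, Φ (toggle m j (toggle m i G)) = Φ G) :
    ∑ G ∈ realizations d, (1 + sgn G i m) * (1 - sgn G j m) * Φ G =
      ∑ G ∈ realizations d', (1 - sgn G i m) * (1 + sgn G j m) * Φ G := by
  have h1 : ∀ G : SimpleGraph V, sgn (toggle m i G) m j = sgn G m j := fun G =>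
    sgn_toggle_of_ne _ (by grind)
  have h2 : ∀ G : SimpleGraph V, sgn (toggle m j (toggle m i G)) m i = -sgn G m i := fun G => by
    rw [sgn_toggle_of_ne _ (by grind), sgn_toggle_same]
  refine sum_realizations_transfer (τ := fun G => toggle m j (toggle m i G))
    (fun f => by
      rw [sum_comp_toggle m i (fun G => f (toggle m j G)), sum_comp_toggle m j])
    (fun G => ?_) (fun G hG => ?_)
  · rw [hΦ, sgn_comm _ i m, sgn_comm _ j m, sgn_comm _ i m, sgn_comm _ j m, h2,
      sgn_toggle_same, h1]
    ring
  · have h3 : sgn G m i = 1 := by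
      rcases sgn_eq_or G hmi with h | h
      · exact h
      · simp [sgn_comm G i m, h] at hG
    have h4 : sgn G m j = -1 := by
      rcases sgn_eq_or G hmj with h | h
      · simp [sgn_comm G j m, h] at hG
      · exact h
    rw [toggle_mem_realizations hmj (s := -1) (d := d - (Pi.single m 1 + Pi.single i 1))
      (by rw [h1, h4]; simp) (by rw [hd]; module),
      toggle_mem_realizations hmi (s := 1) (d := d) (by rw [h3]; simp) (by simp)]

/-- The four-cycle switching replacing the edges `p q`, `r t` by `p r`, `q t`. -/
lemma sum_switch {p q r t : V} (hpq : p ≠ q) (hpr : p ≠ r) (hpt : p ≠ t) (hqr : q ≠ r)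
    (hqt : q ≠ t) (hrt : r ≠ t) (d : V → ℤ) {Φ Ψ : SimpleGraph V → ℝ}
    (hΦ : ∀ G, sgn G p q = 1 → sgn G p r = -1 → sgn G r t = 1 → sgn G q t = -1 →
      Φ G = Ψ (toggle q t (toggle r t (toggle p r (toggle p q G))))) :
    ∑ G ∈ realizations d,
        (1 + sgn G p q) * (1 - sgn G p r) * ((1 + sgn G r t) * (1 - sgn G q t)) * Φ G =
      ∑ G ∈ realizations d,
        (1 - sgn G p q) * (1 + sgn G p r) * ((1 - sgn G r t) * (1 + sgn G q t)) * Ψ G := by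
  have e1 : ∀ G : SimpleGraph V,
      sgn (toggle q t (toggle r t (toggle p r (toggle p q G)))) p q = -sgn G p q := fun G => by
    rw [sgn_toggle_of_ne _ (by grind), sgn_toggle_of_ne _ (by grind),
      sgn_toggle_of_ne _ (by grind), sgn_toggle_same]
  have e2' : ∀ G : SimpleGraph V, sgn (toggle p q G) p r = sgn G p r := fun G =>
    sgn_toggle_of_ne _ (by grind)
  have e2 : ∀ G : SimpleGraph V,
      sgn (toggle q t (toggle r t (toggle p r (toggle p q G)))) p r = -sgn G p r := fun G => by
    rw [sgn_toggle_of_ne _ (by grind), sgn_toggle_of_ne _ (by grind), sgn_toggle_same, e2']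
  have e3' : ∀ G : SimpleGraph V, sgn (toggle p r (toggle p q G)) r t = sgn G r t := fun G => by
    rw [sgn_toggle_of_ne _ (by grind), sgn_toggle_of_ne _ (by grind)]
  have e3 : ∀ G : SimpleGraph V,
      sgn (toggle q t (toggle r t (toggle p r (toggle p q G)))) r t = -sgn G r t := fun G => by
    rw [sgn_toggle_of_ne _ (by grind), sgn_toggle_same, e3']
  have e4' : ∀ G : SimpleGraph V,
      sgn (toggle r t (toggle p r (toggle p q G))) q t = sgn G q t := fun G => by
    rw [sgn_toggle_of_ne _ (by grind), sgn_toggle_of_ne _ (by grind),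
      sgn_toggle_of_ne _ (by grind)]
  have e4 : ∀ G : SimpleGraph V,
      sgn (toggle q t (toggle r t (toggle p r (toggle p q G)))) q t = -sgn G q t := fun G => by
    rw [sgn_toggle_same, e4']
  have signs : ∀ G : SimpleGraph V,
      (1 + sgn G p q) * (1 - sgn G p r) * ((1 + sgn G r t) * (1 - sgn G q t)) ≠ 0 →
      sgn G p q = 1 ∧ sgn G p r = -1 ∧ sgn G r t = 1 ∧ sgn G q t = -1 := by
    intro G hG
    rcases sgn_eq_or G hpq with h1 | h1 <;> rcases sgn_eq_or G hpr with h2 | h2 <;>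
      rcases sgn_eq_or G hrt with h3 | h3 <;> rcases sgn_eq_or G hqt with h4 | h4 <;>
      simp [h1, h2, h3, h4] at hG ⊢
  refine sum_realizations_transfer
    (τ := fun G => toggle q t (toggle r t (toggle p r (toggle p q G))))
    (fun f => by
      rw [sum_comp_toggle p q (fun G => f (toggle q t (toggle r t (toggle p r G)))),
        sum_comp_toggle p r (fun G => f (toggle q t (toggle r t G))),
        sum_comp_toggle r t (fun G => f (toggle q t G)), sum_comp_toggle q t])
    (fun G => ?_) (fun G hG => ?_)
  · rw [e1, e2, e3, e4]
    by_cases h0 : (1 + sgn G p q) * (1 - sgn G p r) * ((1 + sgn G r t) * (1 - sgn G q t)) = 0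
    · rw [h0, zero_mul]
      have : (1 - -sgn G p q) * (1 + -sgn G p r) * ((1 - -sgn G r t) * (1 + -sgn G q t)) = 0 := by
        rw [← h0]; ring
      rw [this, zero_mul]
    · obtain ⟨h1, h2, h3, h4⟩ := signs G h0
      rw [← hΦ G h1 h2 h3 h4]
      ring
  · obtain ⟨h1, h2, h3, h4⟩ := signs G (left_ne_zero_of_mul hG)
    rw [toggle_mem_realizations hqt (s := -1)
        (d := d - Pi.single p 1 - Pi.single q 1 + Pi.single p 1 + Pi.single r 1 -
          Pi.single r 1 - Pi.single t 1) (by rw [e4', h4]; simp) (by module),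
      toggle_mem_realizations hrt (s := 1)
        (d := d - Pi.single p 1 - Pi.single q 1 + Pi.single p 1 + Pi.single r 1)
        (by rw [e3', h3]; simp) (by module),
      toggle_mem_realizations hpr (s := -1)
        (d := d - Pi.single p 1 - Pi.single q 1)
        (by rw [e2', h2]; simp) (by module),
      toggle_mem_realizations hpq (s := 1) (by rw [h1]; simp) (by module)]

end SignedGraph

namespace SignedGraph

variable {V : Type} [Fintype V] [DecidableEq V]

lemma sum_exp_sgn_mul {i j : V} (hij : i ≠ j) (c : ℝ) (F : SimpleGraph V → ℝ)
    (hF0 : ∀ G, 0 ≤ F G) (hF : ∀ G, F (toggle i j G) = F G) :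
    ∑ G, Real.exp (c * sgn G i j) * F G ≤ Real.exp (c ^ 2 / 2) * ∑ G, F G := by
  have h1 : ∑ G, Real.exp (c * sgn G i j) * F G = ∑ G, Real.exp (-(c * sgn G i j)) * F G := by
    rw [← sum_comp_toggle i j]
    refine Finset.sum_congr rfl fun G _ => ?_
    rw [sgn_toggle_same, hF, mul_neg]
  have h2 : ∑ G, Real.exp (c * sgn G i j) * F G = ∑ G, Real.cosh c * F G := by
    have : ∑ G, Real.exp (c * sgn G i j) * F G =
        (∑ G, Real.exp (c * sgn G i j) * F G + ∑ G, Real.exp (-(c * sgn G i j)) * F G) / 2 := by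
      rw [← h1]; ring
    rw [this, ← Finset.sum_add_distrib, Finset.sum_div]
    refine Finset.sum_congr rfl fun G _ => ?_
    rcases sgn_eq_or G hij with h | h <;> rw [h, Real.cosh_eq] <;> ring_nf
  rw [h2, ← Finset.mul_sum]
  exact mul_le_mul_of_nonneg_right (Real.cosh_le_exp_half_sq c)
    (Finset.sum_nonneg fun G _ => hF0 G)

lemma sum_exp_sgn_finset_le (c : V × V → ℝ) (E : Finset (V × V))
    (hE : ∀ p ∈ E, p.1 ≠ p.2 ∧ (p.2, p.1) ∉ E) :
    ∑ G : SimpleGraph V, Real.exp (∑ p ∈ E, c p * sgn G p.1 p.2) ≤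
      Fintype.card (SimpleGraph V) * Real.exp (∑ p ∈ E, c p ^ 2 / 2) := by
  induction E using Finset.induction_on with
  | empty => simp
  | insert p E hp ih =>
    have hE' : ∀ q ∈ E, q.1 ≠ q.2 ∧ (q.2, q.1) ∉ E := fun q hq =>
      ⟨(hE q (mem_insert_of_mem hq)).1,
        fun h => (hE q (mem_insert_of_mem hq)).2 (mem_insert_of_mem h)⟩
    have hpne := (hE p (mem_insert_self _ _)).1
    simp_rw [Finset.sum_insert hp, Real.exp_add]
    calc _ ≤ Real.exp (c p ^ 2 / 2) * ∑ G : SimpleGraph V,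
          Real.exp (∑ q ∈ E, c q * sgn G q.1 q.2) := by
          refine sum_exp_sgn_mul hpne _ _ (fun G => (Real.exp_pos _).le) (fun G => ?_)
          congr 1
          refine Finset.sum_congr rfl fun q hq => ?_
          rw [sgn_toggle_of_ne]
          rintro (⟨h1, h2⟩ | ⟨h1, h2⟩)
          · exact hp (by rwa [← Prod.mk.eta (p := p), ← h1, ← h2])
          · refine (hE p (mem_insert_self _ _)).2 (mem_insert_of_mem ?_)
            rwa [← h1, ← h2]
      _ ≤ _ := by
          rw [mul_left_comm]
          exact mul_le_mul_of_nonneg_left (ih hE') (Real.exp_pos _).le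

/-- A sub-Gaussian bound for linear statistics of a uniformly random graph. -/
lemma sum_exp_sgn_le (c : V → V → ℝ) :
    ∑ G : SimpleGraph V, Real.exp (∑ a, ∑ b, c a b * sgn G a b) ≤
      Fintype.card (SimpleGraph V) * Real.exp (∑ a, ∑ b, c a b ^ 2) := by
  set e := Fintype.equivFin V
  set E : Finset (V × V) := univ.filter fun p => e p.1 < e p.2
  have split : ∀ f : V → V → ℝ, (∀ a, f a a = 0) →
      ∑ a, ∑ b, f a b = ∑ p ∈ E, (f p.1 p.2 + f p.2 p.1) := by
    intro f hf
    rw [Finset.sum_add_distrib]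
    have h1 : ∑ p ∈ E, f p.2 p.1 = ∑ p ∈ univ.filter (fun p : V × V => e p.2 < e p.1), f p.1 p.2 :=
      Finset.sum_nbij' Prod.swap Prod.swap (by simp [E]) (by simp [E]) (by simp) (by simp)
        (by simp)
    rw [h1, ← Fintype.sum_prod_type' f]
    have h2 : ∀ p : V × V, f p.1 p.2 = (if e p.1 < e p.2 then f p.1 p.2 else 0) +
        (if e p.2 < e p.1 then f p.1 p.2 else 0) := by
      rintro ⟨a, b⟩
      rcases lt_trichotomy (e a) (e b) with h | h | h
      · simp [h, h.asymm]
      · simp [e.injective h, hf]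
      · simp [h, h.asymm]
    rw [Finset.sum_congr rfl fun p _ => h2 p, Finset.sum_add_distrib, ← Finset.sum_filter,
      ← Finset.sum_filter]
  have h1 : ∀ G : SimpleGraph V, ∑ a, ∑ b, c a b * sgn G a b =
      ∑ p ∈ E, (c p.1 p.2 + c p.2 p.1) * sgn G p.1 p.2 := by
    intro G
    rw [split _ (by simp)]
    refine Finset.sum_congr rfl fun p _ => ?_
    rw [sgn_comm G p.2 p.1]; ring
  simp_rw [h1]
  refine (sum_exp_sgn_finset_le (fun p => c p.1 p.2 + c p.2 p.1) E ?_).trans ?_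
  · intro p hp
    have hp' : e p.1 < e p.2 := by simpa [E] using hp
    refine ⟨fun h => by simp [h] at hp', ?_⟩
    simp only [E, mem_filter, mem_univ, true_and]
    exact hp'.asymm
  · refine mul_le_mul_of_nonneg_left (Real.exp_le_exp.2 ?_) (by positivity)
    calc ∑ p ∈ E, (c p.1 p.2 + c p.2 p.1) ^ 2 / 2
        ≤ ∑ p ∈ E, ((if p.1 = p.2 then 0 else c p.1 p.2 ^ 2) +
          (if p.2 = p.1 then 0 else c p.2 p.1 ^ 2)) := by
          refine Finset.sum_le_sum fun p hp => ?_
          have : p.1 ≠ p.2 := by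
            rintro h
            simp [E, h] at hp
          rw [if_neg this, if_neg this.symm]
          nlinarith [sq_nonneg (c p.1 p.2 - c p.2 p.1)]
      _ = ∑ a, ∑ b, (if a = b then 0 else c a b ^ 2) :=
          (split (fun a b => if a = b then 0 else c a b ^ 2) (by simp)).symm
      _ ≤ _ := by
          refine Finset.sum_le_sum fun a _ => Finset.sum_le_sum fun b _ => ?_
          split_ifs
          · positivity
          · exact le_rfl

/-- Chernoff bound for linear statistics of a uniformly random graph. -/
lemma card_filter_linear_ge_le (c : V → V → ℝ) (x : ℝ) :
    (((univ : Finset (SimpleGraph V)).filter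
        fun G => x ≤ ∑ a, ∑ b, c a b * sgn G a b).card : ℝ) ≤
      Fintype.card (SimpleGraph V) * Real.exp (∑ a, ∑ b, c a b ^ 2 - x) := by
  rw [Real.exp_sub, mul_div_assoc', le_div_iff₀ (Real.exp_pos x)]
  refine le_trans ?_ (sum_exp_sgn_le c)
  rw [← nsmul_eq_mul, ← Finset.sum_const]
  refine (Finset.sum_le_sum fun G hG => Real.exp_le_exp.2 (Finset.mem_filter.1 hG).2).trans ?_
  exact Finset.sum_le_sum_of_subset_of_nonneg (Finset.filter_subset _ _)
    fun G _ _ => (Real.exp_pos _).le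

/-- The graphs for which some vertex set sees an exceptionally irregular distribution of degrees. -/
noncomputable def irregular (V : Type) [Fintype V] [DecidableEq V] (K : ℝ) :
    Finset (SimpleGraph V) :=
  univ.filter fun G => ∃ X : Finset V, K * Fintype.card V < ∑ m, (∑ k ∈ X, sgn G m k) ^ 2

lemma exists_int_sum_sgn (G : SimpleGraph V) (X : Finset V) (m : V) :
    ∃ z : ℤ, ∑ k ∈ X, sgn G m k = z ∧ |z| ≤ Fintype.card V := by
  have h : ∀ k, ∃ z : ℤ, sgn G m k = z := by
    intro k
    by_cases h : m = k
    · exact ⟨0, by simp [h]⟩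
    · rcases sgn_eq_or G h with h | h
      · exact ⟨1, by simp [h]⟩
      · exact ⟨-1, by simp [h]⟩
  choose z hz using h
  have h1 : ∑ k ∈ X, sgn G m k = ((∑ k ∈ X, z k : ℤ) : ℝ) := by
    push_cast
    exact Finset.sum_congr rfl fun k _ => hz k
  refine ⟨∑ k ∈ X, z k, h1, ?_⟩
  have h2 : |∑ k ∈ X, sgn G m k| ≤ Fintype.card V := by
    refine (Finset.abs_sum_le_sum_abs _ _).trans ?_
    refine (Finset.sum_le_sum fun k _ => abs_sgn_le G m k).trans ?_
    simpa using Finset.card_le_univ X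
  rw [h1] at h2
  exact_mod_cast h2

lemma card_irregular_le [Nonempty V] (K : ℝ) :
    ((irregular V K).card : ℝ) ≤ Fintype.card (SimpleGraph V) *
      (2 ^ Fintype.card V * (2 * Fintype.card V + 1) ^ Fintype.card V * Real.exp (-K / 4)) := by
  set n := Fintype.card V with hn
  have hn0 : (0 : ℝ) < n := by rw [hn]; exact_mod_cast Fintype.card_pos
  set Y : Finset (V → ℤ) := Fintype.piFinset fun _ => Finset.Icc (-(n : ℤ)) n with hY
  set c : Finset V → (V → ℤ) → V → V → ℝ :=
    fun X y a b => if b ∈ X then (y a : ℝ) / (2 * n) else 0 with hc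
  set I := ((univ : Finset (Finset V)) ×ˢ Y).filter fun p => K * n < ∑ m, ((p.2 m : ℝ)) ^ 2
    with hI
  have hsub : irregular V K ⊆ I.biUnion fun p => univ.filter fun G =>
      (∑ m, ((p.2 m : ℝ)) ^ 2) / (2 * n) ≤ ∑ a, ∑ b, c p.1 p.2 a b * sgn G a b := by
    intro G hG
    obtain ⟨X, hX⟩ := (Finset.mem_filter.1 hG).2
    choose y hy hyn using exists_int_sum_sgn G X
    have hlin : ∀ a, ∑ b, c X y a b * sgn G a b = (y a : ℝ) ^ 2 / (2 * n) := by
      intro a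
      simp only [hc, ite_mul, zero_mul]
      rw [← Finset.sum_filter, Finset.filter_mem_eq_inter, Finset.univ_inter, ← Finset.mul_sum, hy]
      ring
    refine Finset.mem_biUnion.2 ⟨(X, y), ?_, ?_⟩
    · rw [hI, Finset.mem_filter]
      refine ⟨?_, ?_⟩
      · simp only [Finset.mem_product, Finset.mem_univ, true_and, hY, Fintype.mem_piFinset,
          Finset.mem_Icc]
        exact fun a => abs_le.1 (hyn a)
      · simpa [hy] using hX
    · simp only [Finset.mem_filter, Finset.mem_univ, true_and]
      rw [Finset.sum_congr rfl fun a _ => hlin a, Finset.sum_div]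
  have hcardI : (I.card : ℝ) ≤ 2 ^ n * (2 * n + 1) ^ n := by
    have h1 : I.card ≤ 2 ^ n * (2 * n + 1) ^ n := by
      refine (Finset.card_filter_le _ _).trans ?_
      rw [Finset.card_product, Finset.card_univ, Fintype.card_finset, hY, Fintype.card_piFinset]
      simp only [Int.card_Icc, Finset.prod_const, Finset.card_univ]
      rw [← hn]
      refine Nat.mul_le_mul_left _ (Nat.pow_le_pow_left ?_ _)
      omega
    exact_mod_cast h1
  calc ((irregular V K).card : ℝ) ≤ ∑ p ∈ I, Fintype.card (SimpleGraph V) * Real.exp (-K / 4) := by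
        refine (Nat.cast_le.2 ((Finset.card_le_card hsub).trans Finset.card_biUnion_le)).trans ?_
        push_cast
        refine Finset.sum_le_sum fun p hp => (card_filter_linear_ge_le _ _).trans ?_
        refine mul_le_mul_of_nonneg_left (Real.exp_le_exp.2 ?_) (by positivity)
        have hQ := (Finset.mem_filter.1 hp).2
        set Q := ∑ m, ((p.2 m : ℝ)) ^ 2
        have h1 : ∑ a, ∑ b, c p.1 p.2 a b ^ 2 ≤ ∑ a, ∑ b : V, ((p.2 a : ℝ) / (2 * n)) ^ 2 := by
          refine Finset.sum_le_sum fun a _ => Finset.sum_le_sum fun b _ => ?_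
          simp only [hc]
          split_ifs
          · exact le_rfl
          · simp only [ne_eq, OfNat.ofNat_ne_zero, not_false_eq_true, zero_pow]
            positivity
        have h2 : ∑ a, ∑ b : V, ((p.2 a : ℝ) / (2 * n)) ^ 2 = Q / (4 * n) := by
          simp only [Finset.sum_const, Finset.card_univ, nsmul_eq_mul, ← hn, Q]
          rw [Finset.sum_div]
          refine Finset.sum_congr rfl fun a _ => ?_
          field_simp
          ring
        rw [h2] at h1
        have h3 : Q / (2 * n) = 2 * (Q / (4 * n)) := by field_simp; ring
        have h4 : K / 4 ≤ Q / (4 * n) := by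
          rw [div_le_div_iff₀ (by norm_num) (by positivity)]
          nlinarith
        rw [h3]
        linarith
    _ = I.card * (Fintype.card (SimpleGraph V) * Real.exp (-K / 4)) := by
        rw [Finset.sum_const, nsmul_eq_mul]
    _ ≤ (2 ^ n * (2 * n + 1) ^ n) * (Fintype.card (SimpleGraph V) * Real.exp (-K / 4)) :=
        mul_le_mul_of_nonneg_right hcardI (by positivity)
    _ = _ := by ring

/-- Most graphs have all degrees close to half the number of vertices. -/
lemma card_filter_degree_gt_le [Nonempty V] {w : ℝ} (hw : 0 ≤ w) :
    (((univ : Finset (SimpleGraph V)).filter fun G => ∃ a, w < |∑ b, sgn G a b|).card : ℝ) ≤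
      Fintype.card (SimpleGraph V) *
        (2 * Fintype.card V * Real.exp (-(w ^ 2 / (4 * Fintype.card V)))) := by
  set n := Fintype.card V with hn
  have hn0 : (0 : ℝ) < n := by rw [hn]; exact_mod_cast Fintype.card_pos
  set c : V → ℝ → V → V → ℝ := fun a s x _ => if x = a then s * (w / (2 * n)) else 0 with hc
  have hlin : ∀ (G : SimpleGraph V) a s, ∑ x, ∑ b, c a s x b * sgn G x b =
      s * (w / (2 * n)) * ∑ b, sgn G a b := by
    intro G a s
    rw [Finset.sum_eq_single a]
    · simp [hc, Finset.mul_sum]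
    · intro x _ hx
      simp [hc, hx]
    · simp
  have hsq : ∀ a s, s ^ 2 = 1 → ∑ x, ∑ b, c a s x b ^ 2 = w ^ 2 / (4 * n) := by
    intro a s hs
    rw [Finset.sum_eq_single a]
    · simp only [hc, if_true, Finset.sum_const, Finset.card_univ, nsmul_eq_mul, ← hn, mul_pow, hs]
      field_simp
      ring
    · intro x _ hx
      simp [hc, hx]
    · simp
  have hsub : ((univ : Finset (SimpleGraph V)).filter fun G => ∃ a, w < |∑ b, sgn G a b|) ⊆
      (univ ×ˢ {1, -1} : Finset (V × ℝ)).biUnion fun p => univ.filter fun G =>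
        w ^ 2 / (2 * n) ≤ ∑ x, ∑ b, c p.1 p.2 x b * sgn G x b := by
    intro G hG
    obtain ⟨a, ha⟩ := (Finset.mem_filter.1 hG).2
    have key : ∀ s : ℝ, w ≤ s * ∑ b, sgn G a b →
        w ^ 2 / (2 * n) ≤ s * (w / (2 * n)) * ∑ b, sgn G a b := by
      intro s hs
      have h1 : s * (w / (2 * n)) * ∑ b, sgn G a b = (w / (2 * n)) * (s * ∑ b, sgn G a b) := by
        ring
      rw [h1, pow_two, mul_div_right_comm w w]
      exact mul_le_mul_of_nonneg_left hs (by positivity)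
    rcases lt_abs.1 ha with h | h
    · refine Finset.mem_biUnion.2 ⟨(a, 1), by simp, ?_⟩
      simp only [Finset.mem_filter, Finset.mem_univ, true_and, hlin]
      exact key 1 (by linarith)
    · refine Finset.mem_biUnion.2 ⟨(a, -1), by simp, ?_⟩
      simp only [Finset.mem_filter, Finset.mem_univ, true_and, hlin]
      exact key (-1) (by linarith)
  refine (Nat.cast_le.2 ((Finset.card_le_card hsub).trans Finset.card_biUnion_le)).trans ?_
  push_cast
  calc _ ≤ ∑ p ∈ (univ ×ˢ {1, -1} : Finset (V × ℝ)),
        Fintype.card (SimpleGraph V) * Real.exp (-(w ^ 2 / (4 * n))) := by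
        refine Finset.sum_le_sum fun p hp => (card_filter_linear_ge_le _ _).trans ?_
        have hp2 : p.2 ^ 2 = 1 := by
          have : p.2 = 1 ∨ p.2 = -1 := by simpa using hp
          rcases this with h | h <;> simp [h]
        rw [hsq _ _ hp2]
        have : w ^ 2 / (2 * n) = 2 * (w ^ 2 / (4 * n)) := by field_simp; ring
        rw [this]
        exact le_of_eq (by congr 2; ring)
    _ ≤ _ := by
        rw [Finset.sum_const, nsmul_eq_mul, Finset.card_product, Finset.card_univ, ← hn]
        have : ({1, -1} : Finset ℝ).card = 2 := by
          rw [Finset.card_pair]; norm_num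
        rw [this]
        push_cast
        exact le_of_eq (by ring)

end SignedGraph

namespace SignedGraph

variable {V : Type} [Fintype V] [DecidableEq V]

lemma mul_pow_le_pow {ℓ : ℝ} (hℓ : 10 ^ 6 ≤ ℓ) {c : ℝ} (hc : c ≤ 10 ^ 6) {a b : ℕ} (hab : a < b) :
    c * ℓ ^ a ≤ ℓ ^ b := by
  have h0 : (1 : ℝ) ≤ ℓ := by linarith
  have hp : 0 < ℓ ^ a := by positivity
  calc c * ℓ ^ a ≤ ℓ * ℓ ^ a := mul_le_mul_of_nonneg_right (by linarith) hp.le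
    _ = ℓ ^ (a + 1) := by ring
    _ ≤ ℓ ^ b := pow_le_pow_right₀ h0 hab

section Regular

variable {K : ℝ} {G : SimpleGraph V}

lemma sum_sq_le_of_regular (hG : G ∉ irregular V K) {z : V → ℝ}
    (hz : ∀ k, z k = 0 ∨ z k = 1 ∨ z k = -1) :
    ∑ m, (∑ k, sgn G m k * z k) ^ 2 ≤ 4 * K * Fintype.card V := by
  have hG' : ∀ X : Finset V, ∑ m, (∑ k ∈ X, sgn G m k) ^ 2 ≤ K * Fintype.card V := by
    intro X
    by_contra h
    exact hG (by simp only [irregular, mem_filter, mem_univ, true_and]; exact ⟨X, not_le.1 h⟩)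
  have hsplit : ∀ m, ∑ k, sgn G m k * z k =
      ∑ k ∈ univ.filter (fun k => z k = 1), sgn G m k -
        ∑ k ∈ univ.filter (fun k => z k = -1), sgn G m k := by
    intro m
    rw [Finset.sum_filter, Finset.sum_filter, ← Finset.sum_sub_distrib]
    refine Finset.sum_congr rfl fun k _ => ?_
    rcases hz k with h | h | h <;> rw [h] <;> norm_num
  calc ∑ m, (∑ k, sgn G m k * z k) ^ 2
      ≤ ∑ m, (2 * (∑ k ∈ univ.filter (fun k => z k = 1), sgn G m k) ^ 2 +
          2 * (∑ k ∈ univ.filter (fun k => z k = -1), sgn G m k) ^ 2) := by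
        refine Finset.sum_le_sum fun m _ => ?_
        rw [hsplit]
        nlinarith [sq_nonneg (∑ k ∈ univ.filter (fun k => z k = 1), sgn G m k +
          ∑ k ∈ univ.filter (fun k => z k = -1), sgn G m k)]
    _ ≤ _ := by
        rw [Finset.sum_add_distrib, ← Finset.mul_sum, ← Finset.mul_sum]
        linarith [hG' (univ.filter fun k => z k = 1), hG' (univ.filter fun k => z k = -1)]

lemma abs_bilin_le_of_regular {ρ : ℝ} (hρ : 0 ≤ ρ) (hG : G ∉ irregular V (ρ ^ 2)) {w z : V → ℝ}
    (hw : ∀ k, |w k| ≤ 1) (hz : ∀ k, z k = 0 ∨ z k = 1 ∨ z k = -1) :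
    |∑ m, w m * ∑ k, sgn G m k * z k| ≤ 2 * ρ * Fintype.card V := by
  refine abs_le_of_sq_le_sq ?_ (by positivity)
  refine (Finset.sum_mul_sq_le_sq_mul_sq univ w fun m => ∑ k, sgn G m k * z k).trans ?_
  have h1 : ∑ m, w m ^ 2 ≤ Fintype.card V := by
    calc ∑ m, w m ^ 2 ≤ ∑ m : V, (1 : ℝ) :=
          Finset.sum_le_sum fun m _ => (sq_le_one_iff_abs_le_one _).2 (hw m)
      _ = _ := by simp
  have h2 := sum_sq_le_of_regular hG hz
  calc _ ≤ (Fintype.card V : ℝ) * (4 * ρ ^ 2 * Fintype.card V) :=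
        mul_le_mul h1 h2 (Finset.sum_nonneg fun _ _ => sq_nonneg _) (by positivity)
    _ = _ := by ring

end Regular

/-- A degree sequence near the middle with many realizations. -/
structure Rich (ℓ : ℝ) (d : V → ℤ) : Prop where
  large : 10 ^ 6 ≤ ℓ
  card : (Fintype.card V : ℝ) = ℓ ^ 20
  window : ∀ a, |2 * (d a : ℝ) - ((Fintype.card V : ℝ) - 1)| ≤ 4 * ℓ ^ 11
  count : Fintype.card (SimpleGraph V) * Real.exp (-ℓ ^ 24) ≤ ((realizations d).card : ℝ)

lemma irregular_small {ℓ : ℝ} (hℓ : 10 ^ 6 ≤ ℓ) (hn : (Fintype.card V : ℝ) = ℓ ^ 20) :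
    ((irregular V ((3 * ℓ ^ 12) ^ 2)).card : ℝ) * ℓ ^ 200 ≤
      Fintype.card (SimpleGraph V) * Real.exp (-ℓ ^ 24) := by
  have h0 : (0 : ℝ) < ℓ := by linarith
  have hV : Nonempty V := by
    rw [← Fintype.card_pos_iff]
    have : (0 : ℝ) < Fintype.card V := by rw [hn]; positivity
    exact_mod_cast this
  have hlog : Real.log ℓ ≤ ℓ := by linarith [Real.log_le_sub_one_of_pos h0]
  refine (mul_le_mul_of_nonneg_right (card_irregular_le _) (by positivity)).trans ?_
  rw [mul_assoc]
  refine mul_le_mul_of_nonneg_left ?_ (by positivity)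
  have h1 : (2 : ℝ) ^ Fintype.card V * (2 * Fintype.card V + 1) ^ Fintype.card V ≤
      Real.exp (ℓ ^ 20 * (40 * ℓ)) := by
    rw [← mul_pow, hn]
    have h2 : 2 * (2 * ℓ ^ 20 + 1) ≤ ℓ ^ 40 := by
      have := mul_pow_le_pow hℓ (c := 6) (by norm_num) (show 20 < 40 by norm_num)
      have h3 : (1 : ℝ) ≤ ℓ ^ 20 := one_le_pow₀ (by linarith)
      linarith
    have h3 : ℓ ^ 40 ≤ Real.exp (40 * ℓ) := by
      rw [← Real.exp_log h0, ← Real.exp_nat_mul, Real.exp_log h0, Real.exp_le_exp]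
      push_cast
      linarith
    calc (2 * (2 * ℓ ^ 20 + 1)) ^ Fintype.card V ≤ Real.exp (40 * ℓ) ^ Fintype.card V :=
          pow_le_pow_left₀ (by positivity) (h2.trans h3) _
      _ = Real.exp (ℓ ^ 20 * (40 * ℓ)) := by rw [← Real.exp_nat_mul, hn]
  have h4 : ℓ ^ 200 ≤ Real.exp (200 * ℓ) := by
    rw [← Real.exp_log h0, ← Real.exp_nat_mul, Real.exp_log h0, Real.exp_le_exp]
    push_cast
    linarith
  calc _ ≤ Real.exp (ℓ ^ 20 * (40 * ℓ)) * Real.exp (-(3 * ℓ ^ 12) ^ 2 / 4) *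
        Real.exp (200 * ℓ) := by gcongr
    _ ≤ _ := by
        rw [← Real.exp_add, ← Real.exp_add, Real.exp_le_exp]
        have h5 := mul_pow_le_pow hℓ (c := 40) (by norm_num) (show 21 < 24 by norm_num)
        have h6 := mul_pow_le_pow hℓ (c := 40) (by norm_num) (show 21 < 22 by norm_num)
        have h7 := mul_pow_le_pow hℓ (c := 200) (by norm_num) (show 1 < 22 by norm_num)
        have h8 := mul_pow_le_pow hℓ (c := 200) (by norm_num) (show 22 < 24 by norm_num)
        nlinarith

namespace Rich

variable {ℓ : ℝ} {d : V → ℤ}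

lemma pos (h : Rich ℓ d) : 0 < ℓ := by linarith [h.large]

lemma one_le (h : Rich ℓ d) : 1 ≤ ℓ := by linarith [h.large]

lemma irregular_mul_le (h : Rich ℓ d) :
    ((irregular V ((3 * ℓ ^ 12) ^ 2)).card : ℝ) * ℓ ^ 200 ≤ (realizations d).card :=
  (irregular_small h.large h.card).trans h.count

lemma card_pos (h : Rich ℓ d) : 0 < ((realizations d).card : ℝ) :=
  lt_of_lt_of_le (by positivity) h.count

/-- Averages are controlled by the behaviour on regular graphs. -/
lemma sum_abs_le (h : Rich ℓ d) {f : SimpleGraph V → ℝ} {A : ℝ} (hA : 0 ≤ A)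
    (hreg : ∀ G ∈ realizations d, G ∉ irregular V ((3 * ℓ ^ 12) ^ 2) → |f G| ≤ A)
    (hall : ∀ G ∈ realizations d, |f G| ≤ ℓ ^ 200) :
    ∑ G ∈ realizations d, |f G| ≤ (A + 1) * (realizations d).card := by
  calc ∑ G ∈ realizations d, |f G|
      ≤ ∑ G ∈ realizations d,
          (A + if G ∈ irregular V ((3 * ℓ ^ 12) ^ 2) then ℓ ^ 200 else 0) := by
        refine Finset.sum_le_sum fun G hG => ?_
        split_ifs with h1
        · linarith [hall G hG]
        · linarith [hreg G hG h1]
    _ = A * (realizations d).card +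
          ((realizations d ∩ irregular V ((3 * ℓ ^ 12) ^ 2)).card : ℝ) * ℓ ^ 200 := by
        rw [Finset.sum_add_distrib, ← Finset.sum_filter, Finset.filter_mem_eq_inter]
        simp [mul_comm]
    _ ≤ A * (realizations d).card +
          ((irregular V ((3 * ℓ ^ 12) ^ 2)).card : ℝ) * ℓ ^ 200 := by
        have := h.pos
        gcongr
        exact Finset.inter_subset_right
    _ ≤ _ := by linarith [h.irregular_mul_le]

lemma abs_bilin_le (h : Rich ℓ d) {G : SimpleGraph V}
    (hG : G ∉ irregular V ((3 * ℓ ^ 12) ^ 2)) {w z : V → ℝ}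
    (hw : ∀ k, |w k| ≤ 1) (hz : ∀ k, z k = 0 ∨ z k = 1 ∨ z k = -1) :
    |∑ m, w m * ∑ k, sgn G m k * z k| ≤ 6 * ℓ ^ 32 := by
  have := h.pos
  refine (abs_bilin_le_of_regular (by positivity) hG hw hz).trans (le_of_eq ?_)
  rw [h.card]; ring

lemma abs_degree_le (h : Rich ℓ d) {G : SimpleGraph V} (hG : G ∈ realizations d) (a : V) :
    |∑ b, sgn G a b| ≤ 4 * ℓ ^ 11 := by
  rw [mem_realizations.1 hG]; exact h.window a

end Rich

/-- The pairs `(k, l)` available for switching the pair `i j`. -/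
noncomputable def switchPairs (i j : V) : Finset (V × V) :=
  univ.filter fun p => p.1 ≠ p.2 ∧ p.1 ≠ i ∧ p.1 ≠ j ∧ p.2 ≠ i ∧ p.2 ≠ j

lemma card_compl_switchPairs_le (i j : V) :
    (univ \ switchPairs i j).card ≤ 5 * Fintype.card V := by
  have hsub : univ \ switchPairs i j ⊆
      (univ.image fun k : V => (k, k)) ∪ ({i} ×ˢ univ ∪ {j} ×ˢ univ) ∪
        (univ ×ˢ {i} ∪ univ ×ˢ {j}) := by
    rintro ⟨k, l⟩ h
    simp only [switchPairs, mem_sdiff, mem_univ, mem_filter, true_and] at h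
    simp only [mem_union, mem_image, mem_univ, true_and, mem_product, mem_singleton, and_true,
      Prod.mk.injEq]
    by_contra h'
    push Not at h'
    grind
  refine (Finset.card_le_card hsub).trans ?_
  refine (Finset.card_union_le _ _).trans ?_
  have h1 := Finset.card_union_le (univ.image fun k : V => (k, k)) ({i} ×ˢ univ ∪ {j} ×ˢ univ)
  have h2 := Finset.card_union_le ({i} ×ˢ univ : Finset (V × V)) ({j} ×ˢ univ)
  have h3 := Finset.card_union_le (univ ×ˢ {i} : Finset (V × V)) (univ ×ˢ {j})
  have h4 := Finset.card_image_le (s := univ) (f := fun k : V => (k, k))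
  simp only [Finset.card_product, Finset.card_singleton, Finset.card_univ] at h1 h2 h3 h4
  omega

/-- The number of ways of switching an edge `i j` away (for `s = 1`) or in (for `s = -1`). -/
noncomputable def switchCount (s : ℝ) (G : SimpleGraph V) (i j : V) : ℝ :=
  ∑ p ∈ switchPairs i j, (1 - s * sgn G i p.1) * ((1 + s * sgn G p.1 p.2) * (1 - s * sgn G j p.2))

lemma sum_switchCount (i j : V) (hij : i ≠ j) (d : V → ℤ) :
    ∑ G ∈ realizations d, (1 + sgn G i j) * switchCount 1 G i j =
      ∑ G ∈ realizations d, (1 - sgn G i j) * switchCount (-1) G i j := by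
  simp only [switchCount, Finset.mul_sum]
  rw [Finset.sum_comm, Finset.sum_comm (s := realizations d)]
  refine Finset.sum_congr rfl fun p hp => ?_
  obtain ⟨h1, h2, h3, h4, h5⟩ := (Finset.mem_filter.1 hp).2
  have := sum_switch hij h2.symm h4.symm h3.symm h5.symm h1 d (Φ := fun _ => 1) (Ψ := fun _ => 1)
    (fun _ _ _ _ _ => rfl)
  simp only [mul_one] at this
  convert this using 2 <;> ring

lemma abs_switchCount_sub_le_sq {s : ℝ} (hs : |s| ≤ 1) (G : SimpleGraph V) (i j : V) :
    |switchCount s G i j - Fintype.card V ^ 2| ≤ 8 * (Fintype.card V : ℝ) ^ 2 := by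
  have h0 : 0 ≤ switchCount s G i j :=
    Finset.sum_nonneg fun p _ => (switch_term_bounds G hs i j p.1 p.2).1
  have h1 : switchCount s G i j ≤ 8 * (Fintype.card V : ℝ) ^ 2 := by
    refine (Finset.sum_le_sum fun p _ => (switch_term_bounds G hs i j p.1 p.2).2).trans ?_
    rw [Finset.sum_const, nsmul_eq_mul]
    have : ((switchPairs i j).card : ℝ) ≤ (Fintype.card V : ℝ) ^ 2 := by
      have := Finset.card_le_univ (switchPairs i j)
      rw [Fintype.card_prod, ← pow_two] at this
      exact_mod_cast this
    linarith
  rw [abs_le]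
  constructor <;> nlinarith [sq_nonneg (Fintype.card V : ℝ)]

lemma abs_switchCount_sub_le {ℓ : ℝ} {d : V → ℤ} (h : Rich ℓ d) {s : ℝ} (hs : s ^ 2 = 1)
    {G : SimpleGraph V} (hG : G ∈ realizations d)
    (hreg : G ∉ irregular V ((3 * ℓ ^ 12) ^ 2)) (i j : V) :
    |switchCount s G i j - Fintype.card V ^ 2| ≤ 25 * ℓ ^ 32 := by
  have hs1 : |s| ≤ 1 := (sq_le_one_iff_abs_le_one _).1 hs.le
  have hℓ := h.pos
  set n : ℝ := (Fintype.card V : ℝ) with hn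
  set F : V → V → ℝ := fun k l =>
    (1 - s * sgn G i k) * ((1 + s * sgn G k l) * (1 - s * sgn G j l)) with hF
  have hfull : ∑ p : V × V, F p.1 p.2 = switchCount s G i j +
      ∑ p ∈ univ \ switchPairs i j, F p.1 p.2 := by
    rw [add_comm]
    exact (Finset.sum_sdiff (Finset.subset_univ (switchPairs i j))).symm
  have hrest0 : 0 ≤ ∑ p ∈ univ \ switchPairs i j, F p.1 p.2 :=
    Finset.sum_nonneg fun p _ => (switch_term_bounds G hs1 i j p.1 p.2).1
  have hrest1 : ∑ p ∈ univ \ switchPairs i j, F p.1 p.2 ≤ 40 * n := by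
    refine (Finset.sum_le_sum fun p _ => (switch_term_bounds G hs1 i j p.1 p.2).2).trans ?_
    rw [Finset.sum_const, nsmul_eq_mul]
    have : (((univ \ switchPairs i j).card : ℕ) : ℝ) ≤ 5 * n := by
      rw [hn]
      exact_mod_cast card_compl_switchPairs_le i j
    linarith
  set ri := ∑ k, sgn G i k with hri
  set rj := ∑ k, sgn G j k with hrj
  have hexp : ∑ p : V × V, F p.1 p.2 = (n - s * ri) * (n - s * rj) +
      s * (∑ m, 1 * ∑ k, sgn G m k * 1) - ∑ m, sgn G i m * ∑ k, sgn G m k * 1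
        - ∑ m, 1 * ∑ k, sgn G m k * sgn G j k +
          s * ∑ m, sgn G i m * ∑ k, sgn G m k * sgn G j k := by
    have e1 : (n - s * ri) = ∑ k, (1 - s * sgn G i k) := by
      rw [Finset.sum_sub_distrib, ← Finset.mul_sum]; simp [hn, hri]
    have e2 : (n - s * rj) = ∑ k, (1 - s * sgn G j k) := by
      rw [Finset.sum_sub_distrib, ← Finset.mul_sum]; simp [hn, hrj]
    rw [e1, e2, Fintype.sum_prod_type, Finset.sum_mul_sum]
    simp only [Finset.mul_sum]
    simp only [← Finset.sum_sub_distrib, ← Finset.sum_add_distrib]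
    refine Finset.sum_congr rfl fun k _ => Finset.sum_congr rfl fun l _ => ?_
    simp only [hF]
    have hs3 : s * s = 1 := by rw [← pow_two, hs]
    linear_combination (-(sgn G i k * sgn G k l) - sgn G k l * sgn G j l +
      s * sgn G i k * sgn G k l * sgn G j l) * hs3
  have hone : ∀ k : V, |(1 : ℝ)| ≤ 1 := by simp
  have hone' : ∀ k : V, (1 : ℝ) = 0 ∨ (1 : ℝ) = 1 ∨ (1 : ℝ) = -1 := by simp
  have b1 := h.abs_bilin_le hreg hone hone'
  have b2 := h.abs_bilin_le hreg (fun k => abs_sgn_le G i k) hone'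
  have b3 := h.abs_bilin_le hreg hone (fun k => sgn_trichotomy G j k)
  have b4 := h.abs_bilin_le hreg (fun k => abs_sgn_le G i k) (fun k => sgn_trichotomy G j k)
  have b1' : |s * (∑ m : V, 1 * ∑ k, sgn G m k * 1)| ≤ 6 * ℓ ^ 32 := by
    rw [abs_mul]
    exact (mul_le_of_le_one_left (abs_nonneg _) hs1).trans b1
  have b4' : |s * ∑ m, sgn G i m * ∑ k, sgn G m k * sgn G j k| ≤ 6 * ℓ ^ 32 := by
    rw [abs_mul]
    exact (mul_le_of_le_one_left (abs_nonneg _) hs1).trans b4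
  have hr : ∀ a, |s * ∑ b, sgn G a b| ≤ 4 * ℓ ^ 11 := fun a => by
    rw [abs_mul]
    exact (mul_le_of_le_one_left (abs_nonneg _) hs1).trans (h.abs_degree_le hG a)
  have hri' := hr i
  have hrj' := hr j
  have hprod : |(n - s * ri) * (n - s * rj) - n ^ 2| ≤ 8 * ℓ ^ 31 + 16 * ℓ ^ 22 := by
    have e : (n - s * ri) * (n - s * rj) - n ^ 2 =
      -(n * (s * ri)) - n * (s * rj) + (s * ri) * (s * rj) := by ring
    rw [e, show (n : ℝ) = ℓ ^ 20 from h.card]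
    have c1 : |ℓ ^ 20 * (s * ri)| ≤ ℓ ^ 20 * (4 * ℓ ^ 11) := by
      rw [abs_mul, abs_of_pos (by positivity : (0 : ℝ) < ℓ ^ 20)]
      gcongr
    have c2 : |ℓ ^ 20 * (s * rj)| ≤ ℓ ^ 20 * (4 * ℓ ^ 11) := by
      rw [abs_mul, abs_of_pos (by positivity : (0 : ℝ) < ℓ ^ 20)]
      gcongr
    have c3 : |(s * ri) * (s * rj)| ≤ (4 * ℓ ^ 11) * (4 * ℓ ^ 11) := by
      rw [abs_mul]
      gcongr
    ring_nf at c1 c2 c3 ⊢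
    rw [abs_le] at *
    constructor <;> linarith [c1.1, c1.2, c2.1, c2.2, c3.1, c3.2]
  have p1 := mul_pow_le_pow h.large (c := 16) (by norm_num) (show 22 < 31 by norm_num)
  have p2 := mul_pow_le_pow h.large (c := 40) (by norm_num) (show 20 < 31 by norm_num)
  have p3 := mul_pow_le_pow h.large (c := 11) (by norm_num) (show 31 < 32 by norm_num)
  have hn' : n = ℓ ^ 20 := h.card
  rw [hexp] at hfull
  rw [hn'] at hrest1
  have e : switchCount s G i j - n ^ 2 = ((n - s * ri) * (n - s * rj) - n ^ 2) +
      s * (∑ m : V, 1 * ∑ k, sgn G m k * 1) - ∑ m, sgn G i m * ∑ k, sgn G m k * 1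
        - ∑ m : V, 1 * ∑ k, sgn G m k * sgn G j k +
          s * ∑ m, sgn G i m * ∑ k, sgn G m k * sgn G j k -
          ∑ p ∈ univ \ switchPairs i j, F p.1 p.2 := by linarith
  rw [e]
  rw [abs_le] at *
  constructor <;> linarith [hprod.1, hprod.2, b1'.1, b1'.2, b2.1, b2.2, b3.1, b3.2, b4'.1, b4'.2]

/-- In a rich degree sequence, every edge has probability close to one half. -/
lemma Rich.abs_sum_sgn_le {ℓ : ℝ} {d : V → ℤ} (h : Rich ℓ d) {i j : V} (hij : i ≠ j) :
    |∑ G ∈ realizations d, sgn G i j| * ℓ ^ 8 ≤ 60 * (realizations d).card := by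
  have hℓ := h.pos
  have hn : (Fintype.card V : ℝ) = ℓ ^ 20 := h.card
  have key : ∀ s : ℝ, s ^ 2 = 1 → |∑ G ∈ realizations d,
      (1 + s * sgn G i j) * (switchCount s G i j - Fintype.card V ^ 2)| ≤
        (50 * ℓ ^ 32 + 1) * (realizations d).card := by
    intro s hs
    have hs1 : |s| ≤ 1 := (sq_le_one_iff_abs_le_one _).1 hs.le
    have hf : ∀ G : SimpleGraph V, |1 + s * sgn G i j| ≤ 2 := fun G => by
      obtain ⟨h1, h2⟩ := one_add_mul_sgn_bounds G hs1 i j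
      rwa [abs_of_nonneg h1]
    refine (Finset.abs_sum_le_sum_abs _ _).trans (h.sum_abs_le (by positivity) ?_ ?_)
    · intro G hG hreg
      rw [abs_mul]
      calc _ ≤ 2 * (25 * ℓ ^ 32) := mul_le_mul (hf G) (abs_switchCount_sub_le h hs hG hreg i j)
            (abs_nonneg _) (by norm_num)
        _ = _ := by ring
    · intro G hG
      rw [abs_mul]
      calc _ ≤ 2 * (8 * (Fintype.card V : ℝ) ^ 2) :=
            mul_le_mul (hf G) (abs_switchCount_sub_le_sq hs1 G i j) (abs_nonneg _) (by norm_num)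
        _ = 16 * ℓ ^ 40 := by rw [hn]; ring
        _ ≤ _ := mul_pow_le_pow h.large (by norm_num) (by norm_num)
  have k1 := key 1 (by norm_num)
  have k2 := key (-1) (by norm_num)
  have hsw := sum_switchCount i j hij d
  have e : 2 * ℓ ^ 40 * ∑ G ∈ realizations d, sgn G i j =
      ∑ G ∈ realizations d, (1 + (-1) * sgn G i j) *
          (switchCount (-1) G i j - Fintype.card V ^ 2) -
        ∑ G ∈ realizations d, (1 + 1 * sgn G i j) *
          (switchCount 1 G i j - Fintype.card V ^ 2) := by
    have e1 : ∀ G : SimpleGraph V, (1 + (-1) * sgn G i j) *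
          (switchCount (-1) G i j - Fintype.card V ^ 2) =
          (1 - sgn G i j) * switchCount (-1) G i j - (ℓ ^ 40 - ℓ ^ 40 * sgn G i j) := by
      intro G; rw [hn]; ring
    have e2 : ∀ G : SimpleGraph V, (1 + 1 * sgn G i j) *
          (switchCount 1 G i j - Fintype.card V ^ 2) =
          (1 + sgn G i j) * switchCount 1 G i j - (ℓ ^ 40 + ℓ ^ 40 * sgn G i j) := by
      intro G; rw [hn]; ring
    simp_rw [e1, e2]
    rw [Finset.sum_sub_distrib, Finset.sum_sub_distrib, Finset.sum_sub_distrib,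
      Finset.sum_add_distrib, hsw, ← Finset.mul_sum]
    ring
  have hN := h.card_pos
  have h32 : (1 : ℝ) ≤ ℓ ^ 32 := one_le_pow₀ h.one_le
  have hfin : ℓ ^ 32 * (2 * (|∑ G ∈ realizations d, sgn G i j| * ℓ ^ 8)) ≤
      ℓ ^ 32 * (102 * (realizations d).card) := by
    calc ℓ ^ 32 * (2 * (|∑ G ∈ realizations d, sgn G i j| * ℓ ^ 8))
        = |2 * ℓ ^ 40 * ∑ G ∈ realizations d, sgn G i j| := by
          rw [abs_mul, abs_of_pos (by positivity : (0 : ℝ) < 2 * ℓ ^ 40)]; ring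
      _ ≤ (50 * ℓ ^ 32 + 1) * (realizations d).card +
          (50 * ℓ ^ 32 + 1) * (realizations d).card := by
          rw [e]; exact (abs_sub _ _).trans (add_le_add k2 k1)
      _ ≤ _ := by nlinarith
  have := le_of_mul_le_mul_left hfin (by positivity)
  linarith

end SignedGraph

namespace SignedGraph

variable {V : Type} [Fintype V] [DecidableEq V]

lemma Rich.card_step {ℓ : ℝ} {x x' : V → ℤ} (hx : Rich ℓ x)
    (hx4 : 4 * (Fintype.card (SimpleGraph V) * Real.exp (-ℓ ^ 24)) ≤ ((realizations x).card : ℝ))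
    (hw : ∀ a, |2 * (x' a : ℝ) - ((Fintype.card V : ℝ) - 1)| ≤ 4 * ℓ ^ 11)
    {i j : V} (hij : i ≠ j) {s : ℤ} (hs : s = 1 ∨ s = -1)
    (hd : x' = x + s • (Pi.single i 1 + Pi.single j 1)) :
    Real.exp (-(240 / ℓ ^ 8)) * (realizations x).card ≤ (realizations x').card := by
  have hℓ := hx.pos
  have hident : ∑ G ∈ realizations x, (1 - s * sgn G i j) =
      ∑ G ∈ realizations x', (1 + s * sgn G i j) := by
    rcases hs with rfl | rfl
    · simpa using sum_add_edge hij (d := x) (d' := x') (by rw [hd]; simp)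
    · have := sum_add_edge hij (d := x') (d' := x) (by rw [hd]; module)
      simpa [sub_eq_add_neg] using this.symm
  have hs1 : |(s : ℝ)| ≤ 1 := by rcases hs with rfl | rfl <;> simp
  rw [Finset.sum_sub_distrib, Finset.sum_add_distrib, ← Finset.mul_sum, ← Finset.mul_sum] at hident
  simp only [Finset.sum_const, nsmul_eq_mul, mul_one] at hident
  set N : ℝ := ((realizations x).card : ℝ) with hN
  set N' : ℝ := ((realizations x').card : ℝ) with hN'
  set δ := 1 / ℓ ^ 8 with hδ
  have hδ0 : 0 < δ := by positivity
  have hδ1 : δ ≤ 1 / 240 := by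
    rw [hδ]
    have := mul_pow_le_pow hx.large (c := 240) (by norm_num) (show 0 < 8 by norm_num)
    exact one_div_le_one_div_of_le (by norm_num) (by simpa using this)
  have hN0 : 0 < N := hx.card_pos
  have edge : ∀ {y : V → ℤ}, Rich ℓ y → |s * ∑ G ∈ realizations y, sgn G i j| ≤
      60 * δ * (realizations y).card := by
    intro y hy
    rw [abs_mul]
    refine (mul_le_of_le_one_left (abs_nonneg _) hs1).trans ?_
    have := hy.abs_sum_sgn_le hij
    rw [hδ, mul_one_div, div_mul_eq_mul_div, le_div_iff₀ (by positivity)]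
    exact this
  have e1 := abs_le.1 (edge hx)
  have triv : |s * ∑ G ∈ realizations x', sgn G i j| ≤ N' := by
    rw [abs_mul]
    refine (mul_le_of_le_one_left (abs_nonneg _) hs1).trans ?_
    refine (Finset.abs_sum_le_sum_abs _ _).trans ?_
    refine (Finset.sum_le_sum fun G _ => abs_sgn_le G i j).trans ?_
    simp [hN']
  have hN'4 : N ≤ 4 * N' := by
    have h1 := (abs_le.1 triv).2
    nlinarith [e1.1, e1.2]
  have hx' : Rich ℓ x' := ⟨hx.large, hx.card, hw, by linarith⟩
  have e2 := abs_le.1 (edge hx')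
  have hfin : N * (1 - 60 * δ) ≤ N' * (1 + 60 * δ) := by nlinarith [e1.1, e1.2, e2.1, e2.2]
  have hexp : Real.exp (-(240 / ℓ ^ 8)) ≤ 1 / (1 + 240 * δ) := by
    rw [Real.exp_neg, ← one_div]
    refine one_div_le_one_div_of_le (by positivity) ?_
    have := Real.add_one_le_exp (240 / ℓ ^ 8)
    rw [hδ]
    linarith [show 240 / ℓ ^ 8 = 240 * (1 / ℓ ^ 8) by ring]
  refine (mul_le_mul_of_nonneg_right hexp hN0.le).trans ?_
  rw [one_div_mul_eq_div, div_le_iff₀ (by positivity)]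
  have h5 : N * (1 + 60 * δ) ≤ N * ((1 - 60 * δ) * (1 + 240 * δ)) :=
    mul_le_mul_of_nonneg_left (by nlinarith) hN0.le
  have h6 : N * (1 - 60 * δ) * (1 + 240 * δ) ≤ N' * (1 + 60 * δ) * (1 + 240 * δ) :=
    mul_le_mul_of_nonneg_right hfin (by positivity)
  have h7 : N * (1 + 60 * δ) ≤ (N' * (1 + 240 * δ)) * (1 + 60 * δ) := by linarith
  exact le_of_mul_le_mul_right h7 (by positivity)

/-- The sequence `x` stays within `c` of the middle and has at least `M` realizations. -/
structure Within (c M : ℝ) (x : V → ℤ) : Prop where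
  window : ∀ a, |2 * (x a : ℝ) - ((Fintype.card V : ℝ) - 1)| ≤ c
  count : M ≤ ((realizations x).card : ℝ)

lemma Within.step {ℓ c M : ℝ} (hℓ : 10 ^ 6 ≤ ℓ) (hn : (Fintype.card V : ℝ) = ℓ ^ 20)
    {x : V → ℤ} (hx : Within c M x)
    (hM : 4 * (Fintype.card (SimpleGraph V) * Real.exp (-ℓ ^ 24)) ≤ M)
    (hc : c + 2 ≤ 4 * ℓ ^ 11) {i j : V} (hij : i ≠ j) {s : ℤ} (hs : s = 1 ∨ s = -1) :
    Within (c + 2) (Real.exp (-(240 / ℓ ^ 8)) * M)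
      (x + s • (Pi.single i 1 + Pi.single j 1)) := by
  have hw : ∀ a, |2 * (((x + s • (Pi.single i 1 + Pi.single j 1) : V → ℤ) a : ℤ) : ℝ) -
      ((Fintype.card V : ℝ) - 1)| ≤ c + 2 := by
    intro a
    have h1 : |(s : ℝ) * ((if a = i then 1 else 0) + (if a = j then 1 else 0))| ≤ 1 := by
      have : |(s : ℝ)| = 1 := by rcases hs with rfl | rfl <;> simp
      rw [abs_mul, this, one_mul]
      by_cases h : a = i
      · subst h; simp [hij]
      · by_cases h' : a = j
        · subst h'; simp [h]
        · simp [h, h']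
    have h2 := hx.window a
    simp only [Pi.add_apply, Pi.smul_apply, Pi.single_apply, smul_eq_mul]
    push_cast
    rw [abs_le] at *
    constructor <;> linarith [h1.1, h1.2, h2.1, h2.2]
  refine ⟨hw, ?_⟩
  have h0 : 0 ≤ (Fintype.card (SimpleGraph V) : ℝ) * Real.exp (-ℓ ^ 24) := by positivity
  have hrich : Rich ℓ x := ⟨hℓ, hn, fun a => (hx.window a).trans (by linarith),
    by linarith [hx.count]⟩
  exact (mul_le_mul_of_nonneg_left hx.count (Real.exp_pos _).le).trans
    (hrich.card_step (hM.trans hx.count) (fun a => (hw a).trans hc) hij hs rfl)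

lemma Within.mono {c c' M M' : ℝ} {x : V → ℤ} (hx : Within c M x) (hc : c ≤ c') (hM : M' ≤ M) :
    Within c' M' x :=
  ⟨fun a => (hx.window a).trans hc, hM.trans hx.count⟩

lemma exists_notMem_of_card_lt (s : Finset V) (h : s.card < Fintype.card V) : ∃ a, a ∉ s := by
  by_contra h'
  push Not at h'
  rw [← Finset.card_univ, Finset.eq_univ_iff_forall.2 h'] at h
  exact lt_irrefl _ h

/-- Changing one or two degrees by a total of two units costs little. -/
lemma Within.double_step {ℓ c M : ℝ} (hℓ : 10 ^ 6 ≤ ℓ) (hn : (Fintype.card V : ℝ) = ℓ ^ 20)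
    {x : V → ℤ} (hx : Within c M x)
    (hM : 4 * (Fintype.card (SimpleGraph V) * Real.exp (-ℓ ^ 24)) ≤
      Real.exp (-(720 / ℓ ^ 8)) * M)
    (hc : c + 6 ≤ 4 * ℓ ^ 11) {a b : V} {s t : ℤ} (hs : s = 1 ∨ s = -1) (ht : t = 1 ∨ t = -1)
    (hst : a = b → s = t) :
    Within (c + 6) (Real.exp (-(720 / ℓ ^ 8)) * M) (x + Pi.single a s + Pi.single b t) := by
  have hℓ0 : 0 < ℓ := by linarith
  have hpos : 0 < Real.exp (-(240 / ℓ ^ 8)) := Real.exp_pos _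
  have hle : Real.exp (-(240 / ℓ ^ 8)) ≤ 1 := by
    rw [Real.exp_le_one_iff]
    have : 0 ≤ 240 / ℓ ^ 8 := by positivity
    linarith
  have hcube : Real.exp (-(720 / ℓ ^ 8)) =
      Real.exp (-(240 / ℓ ^ 8)) * (Real.exp (-(240 / ℓ ^ 8)) * Real.exp (-(240 / ℓ ^ 8))) := by
    rw [← Real.exp_add, ← Real.exp_add]; ring_nf
  have hV : 3 < Fintype.card V := by
    have h1 := mul_pow_le_pow hℓ (c := 4) (by norm_num) (show 0 < 20 by norm_num)
    have h2 : (4 : ℝ) ≤ Fintype.card V := by rw [hn]; simpa using h1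
    have : 4 ≤ Fintype.card V := by exact_mod_cast h2
    omega
  set η := Real.exp (-(240 / ℓ ^ 8)) with hη
  set B : ℝ := 4 * (Fintype.card (SimpleGraph V) * Real.exp (-ℓ ^ 24)) with hB
  have hB0 : 0 ≤ B := by positivity
  rw [hcube] at hM ⊢
  have hM0 : 0 ≤ M := by
    by_contra hneg
    push Not at hneg
    have := mul_neg_of_pos_of_neg (mul_pos hpos (mul_pos hpos hpos)) hneg
    linarith
  have m1 : η * M ≤ M := mul_le_of_le_one_left hM0 hle
  have m2 : η * (η * M) ≤ η * M := mul_le_of_le_one_left (mul_nonneg hpos.le hM0) hle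
  have m3 : η * (η * (η * M)) ≤ η * (η * M) :=
    mul_le_of_le_one_left (mul_nonneg hpos.le (mul_nonneg hpos.le hM0)) hle
  have hM' : B ≤ η * (η * (η * M)) := by linarith
  have hsm : ∀ (u v : V) (r : ℤ), r • (Pi.single u 1 + Pi.single v 1 : V → ℤ) =
      Pi.single u r + Pi.single v r := by
    intro u v r
    ext w
    simp [Pi.single_apply, mul_add]
  have goal_eq : η * (η * η) * M = η * (η * (η * M)) := by ring
  rw [goal_eq]
  by_cases hab : a = b
  · subst hab
    obtain rfl : s = t := hst rfl
    obtain ⟨k, hk⟩ := exists_notMem_of_card_lt {a} (by simp; omega)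
    obtain ⟨l, hl⟩ := exists_notMem_of_card_lt {a, k}
      (lt_of_le_of_lt (Finset.card_le_two) (by omega))
    simp only [mem_singleton, mem_insert, not_or] at hk hl
    have s1 := hx.step hℓ hn (by linarith) (by linarith) (Ne.symm hk) hs
    have s2 := s1.step hℓ hn (by linarith) (by linarith) (Ne.symm hl.1) hs
    have s3 := s2.step hℓ hn (by linarith) (by linarith) (Ne.symm hl.2) (s := -s)
      (by rcases hs with rfl | rfl <;> simp)
    have e : x + Pi.single a s + Pi.single a s = x + s • (Pi.single a 1 + Pi.single k 1) +
        s • (Pi.single a 1 + Pi.single l 1) + (-s) • (Pi.single k 1 + Pi.single l 1) := by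
      rw [hsm, hsm, hsm, Pi.single_neg, Pi.single_neg]; module
    rw [e]
    exact s3.mono (by linarith) le_rfl
  · by_cases hst' : s = t
    · subst hst'
      have s1 := hx.step hℓ hn (by linarith) (by linarith) hab hs
      rw [hsm, ← add_assoc] at s1
      exact s1.mono (by linarith) (by linarith)
    · obtain ⟨k, hk⟩ := exists_notMem_of_card_lt {a, b}
        (lt_of_le_of_lt (Finset.card_le_two) (by omega))
      simp only [mem_singleton, mem_insert, not_or] at hk
      have hts : t = -s := by rcases hs with rfl | rfl <;> rcases ht with rfl | rfl <;> simp_all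
      have s1 := hx.step hℓ hn (by linarith) (by linarith) (Ne.symm hk.1) hs
      have s2 := s1.step hℓ hn (by linarith) (by linarith) (Ne.symm hk.2) ht
      have e : x + Pi.single a s + Pi.single b t = x + s • (Pi.single a 1 + Pi.single k 1) +
          t • (Pi.single b 1 + Pi.single k 1) := by
        rw [hsm, hsm, hts, Pi.single_neg, Pi.single_neg]; module
      rw [e]
      exact s2.mono (by linarith) (by linarith)

lemma even_sum_abs {ι : Type} (s : Finset ι) (z : ι → ℤ) (h : Even (∑ a ∈ s, z a)) :
    Even (∑ a ∈ s, |z a|) := by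
  have h1 : Even (∑ a ∈ s, (|z a| - z a)) := Finset.even_sum _ fun a _ => by
    rcases abs_cases (z a) with ⟨h, _⟩ | ⟨h, _⟩ <;> rw [h]
    · simp
    · exact ⟨-z a, by ring⟩
  have h2 : ∑ a ∈ s, |z a| = ∑ a ∈ s, (|z a| - z a) + ∑ a ∈ s, z a := by
    rw [← Finset.sum_add_distrib]; simp
  rw [h2]
  exact h1.add h

/-- Moving one coordinate of an integer vector towards zero. -/
lemma exists_shrink (z : V → ℤ) (hz : 0 < ∑ a, |z a|) :
    ∃ a, ∃ s : ℤ, (s = 1 ∨ s = -1) ∧ 0 < s * z a ∧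
      ∑ b, |(z - Pi.single a s : V → ℤ) b| = ∑ b, |z b| - 1 := by
  obtain ⟨a, -, ha⟩ := Finset.exists_ne_zero_of_sum_ne_zero hz.ne'
  have ha' : z a ≠ 0 := by simpa using ha
  have key : ∀ s : ℤ, (s = 1 ∨ s = -1) → 0 < s * z a →
      ∑ b, |(z - Pi.single a s : V → ℤ) b| = ∑ b, |z b| - 1 := by
    intro s hs hpos
    rw [← Finset.add_sum_erase _ _ (Finset.mem_univ a),
      ← Finset.add_sum_erase _ (fun b => |z b|) (Finset.mem_univ a)]
    have h1 : ∑ b ∈ univ.erase a, |(z - Pi.single a s : V → ℤ) b| = ∑ b ∈ univ.erase a, |z b| :=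
      Finset.sum_congr rfl fun b hb => by
        simp [Finset.ne_of_mem_erase hb]
    have h2 : |(z - Pi.single a s : V → ℤ) a| = |z a| - 1 := by
      simp only [Pi.sub_apply, Pi.single_eq_same]
      rcases hs with rfl | rfl
      · rw [abs_of_nonneg (by omega), abs_of_pos (by omega)]
      · rw [abs_of_nonpos (by omega), abs_of_neg (by omega)]; ring
    rw [h1, h2]; ring
  rcases lt_or_gt_of_ne ha' with h | h
  · exact ⟨a, -1, Or.inr rfl, by omega, key _ (Or.inr rfl) (by omega)⟩
  · exact ⟨a, 1, Or.inl rfl, by omega, key _ (Or.inl rfl) (by omega)⟩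

lemma within_of_path {ℓ M : ℝ} (hℓ : 10 ^ 6 ≤ ℓ) (hn : (Fintype.card V : ℝ) = ℓ ^ 20)
    {x₀ : V → ℤ} (hx₀ : Within (3 * ℓ ^ 11) M x₀) (k : ℕ) :
    ∀ x : V → ℤ, (∀ a, |2 * (x a : ℝ) - ((Fintype.card V : ℝ) - 1)| ≤ 3 * ℓ ^ 11) →
      ∑ a, |x a - x₀ a| = 2 * k →
      4 * (Fintype.card (SimpleGraph V) * Real.exp (-ℓ ^ 24)) ≤
        Real.exp (-(720 / ℓ ^ 8)) ^ k * M →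
      Within (3 * ℓ ^ 11) (Real.exp (-(720 / ℓ ^ 8)) ^ k * M) x := by
  have hℓ0 : 0 < ℓ := by linarith
  induction k with
  | zero =>
    intro x _ hdist _
    have : x = x₀ := by
      ext a
      have h1 := (Finset.sum_eq_zero_iff_of_nonneg (fun a _ => abs_nonneg (x a - x₀ a))).1
        (by simpa using hdist) a (mem_univ a)
      have := abs_eq_zero.1 h1
      omega
    subst this
    simpa using hx₀
  | succ k ih =>
    intro x hw hdist hB
    have hle : Real.exp (-(720 / ℓ ^ 8)) ≤ 1 := by
      rw [Real.exp_le_one_iff]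
      have : 0 ≤ 720 / ℓ ^ 8 := by positivity
      linarith
    have hpos := Real.exp_pos (-(720 / ℓ ^ 8))
    rw [pow_succ' (Real.exp _), mul_assoc (Real.exp _)] at hB ⊢
    obtain ⟨a, s, hs, hsa, hda⟩ := exists_shrink (fun a => x a - x₀ a) (by rw [hdist]; positivity)
    obtain ⟨b, t, ht, htb, hdb⟩ := exists_shrink ((fun a => x a - x₀ a) - Pi.single a s)
      (by rw [hda, hdist]; push_cast; omega)
    set x' : V → ℤ := x - Pi.single a s - Pi.single b t with hx'
    have hst : a = b → s = t := by
      rintro rfl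
      simp only [Pi.sub_apply, Pi.single_eq_same] at htb
      rcases hs with rfl | rfl <;> rcases ht with rfl | rfl <;> first | rfl | omega
    have hdist' : ∑ c, |x' c - x₀ c| = 2 * k := by
      have : ∀ c, x' c - x₀ c =
          (((fun a => x a - x₀ a) - Pi.single a s) - Pi.single b t : V → ℤ) c := by
        intro c; simp [hx']; ring
      simp_rw [this]
      rw [hdb, hda, hdist]
      push_cast
      ring
    have hbetween : ∀ c, (x₀ c ≤ x' c ∧ x' c ≤ x c) ∨ (x c ≤ x' c ∧ x' c ≤ x₀ c) := by
      intro c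
      simp only [hx', Pi.sub_apply, Pi.single_apply] at htb ⊢
      by_cases hca : c = a
      · subst hca
        by_cases hcb : c = b
        · subst hcb
          simp only [if_true] at htb ⊢
          rcases hs with rfl | rfl <;> rcases ht with rfl | rfl <;> omega
        · simp only [if_true, if_neg hcb] at htb ⊢
          rcases hs with rfl | rfl <;> omega
      · by_cases hcb : c = b
        · subst hcb
          simp only [if_neg hca, if_true] at htb ⊢
          rcases ht with rfl | rfl <;> omega
        · simp only [if_neg hca, if_neg hcb]
          omega
    have hw' : ∀ c, |2 * (x' c : ℝ) - ((Fintype.card V : ℝ) - 1)| ≤ 3 * ℓ ^ 11 := by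
      intro c
      have h1 := abs_le.1 (hw c)
      have h2 := abs_le.1 (hx₀.window c)
      rw [abs_le]
      rcases hbetween c with ⟨h3, h4⟩ | ⟨h3, h4⟩
      · have h3' : (x₀ c : ℝ) ≤ x' c := by exact_mod_cast h3
        have h4' : (x' c : ℝ) ≤ x c := by exact_mod_cast h4
        constructor <;> linarith [h1.1, h1.2, h2.1, h2.2]
      · have h3' : (x c : ℝ) ≤ x' c := by exact_mod_cast h3
        have h4' : (x' c : ℝ) ≤ x₀ c := by exact_mod_cast h4
        constructor <;> linarith [h1.1, h1.2, h2.1, h2.2]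
    have hB0 : 0 ≤ 4 * ((Fintype.card (SimpleGraph V) : ℝ) * Real.exp (-ℓ ^ 24)) := by positivity
    have hkM : 0 ≤ Real.exp (-(720 / ℓ ^ 8)) ^ k * M :=
      nonneg_of_mul_nonneg_right (hB0.trans hB) hpos
    have hih := ih x' hw' hdist' (hB.trans (mul_le_of_le_one_left hkM hle))
    have h6 := mul_pow_le_pow hℓ (c := 6) (by norm_num) (show 0 < 11 by norm_num)
    have := hih.double_step hℓ hn hB (by linarith) hs ht hst
    have hxx : x' + Pi.single a s + Pi.single b t = x := by rw [hx']; abel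
    rw [hxx] at this
    exact ⟨hw, this.count⟩

/-- Some nearly regular degree sequence has many realizations. -/
lemma exists_within {ℓ : ℝ} (hℓ : 10 ^ 6 ≤ ℓ) (hn : (Fintype.card V : ℝ) = ℓ ^ 20) :
    ∃ x : V → ℤ, Even (∑ a, x a) ∧ Within (3 * ℓ ^ 11)
      (Fintype.card (SimpleGraph V) * Real.exp (-(ℓ ^ 22))) x := by
  have hℓ0 : 0 < ℓ := by linarith
  have hlog : Real.log ℓ ≤ ℓ := by linarith [Real.log_le_sub_one_of_pos hℓ0]
  have hV : Nonempty V := by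
    rw [← Fintype.card_pos_iff]
    have : (0 : ℝ) < Fintype.card V := by rw [hn]; positivity
    exact_mod_cast this
  set n := Fintype.card V with hnn
  set Ω : ℝ := (Fintype.card (SimpleGraph V) : ℝ) with hΩ
  have hΩ0 : 0 < Ω := by
    rw [hΩ]; exact_mod_cast Fintype.card_pos
  set S := (univ : Finset (SimpleGraph V)).filter fun G => ¬ ∃ a, ℓ ^ 11 < |∑ b, sgn G a b| with hS
  have hpow : ∀ k : ℕ, ℓ ^ k ≤ Real.exp (k * ℓ) := by
    intro k
    rw [← Real.exp_log hℓ0, ← Real.exp_nat_mul, Real.exp_log hℓ0, Real.exp_le_exp]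
    exact mul_le_mul_of_nonneg_left hlog (by positivity)
  have hScard : Ω / 2 ≤ S.card := by
    have h1 := card_filter_degree_gt_le (V := V) (w := ℓ ^ 11) (by positivity)
    have h2 : (((univ : Finset (SimpleGraph V)).filter
        fun G => ∃ a, ℓ ^ 11 < |∑ b, sgn G a b|).card : ℝ) + S.card = Ω := by
      rw [hS, hΩ]
      exact_mod_cast Finset.card_filter_add_card_filter_not
        (s := (univ : Finset (SimpleGraph V))) (fun G => ∃ a, ℓ ^ (11 : ℕ) < |∑ b, sgn G a b|)
    have h3 : 2 * (n : ℝ) * Real.exp (-((ℓ ^ 11) ^ 2 / (4 * n))) ≤ 1 / 2 := by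
      rw [hn]
      have e : (ℓ ^ 11) ^ 2 / (4 * ℓ ^ 20) = ℓ ^ 2 / 4 := by field_simp
      rw [e]
      have h4 := hpow 20
      have h5 := hpow 1
      calc 2 * ℓ ^ 20 * Real.exp (-(ℓ ^ 2 / 4)) = ((4 * ℓ ^ 20) * Real.exp (-(ℓ ^ 2 / 4))) / 2 := by
            ring
        _ ≤ (Real.exp ((1 : ℕ) * ℓ) * Real.exp ((20 : ℕ) * ℓ) * Real.exp (-(ℓ ^ 2 / 4))) / 2 := by
            gcongr
            linarith
        _ ≤ 1 / 2 := by
            rw [← Real.exp_add, ← Real.exp_add]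
            have : Real.exp ((1 : ℕ) * ℓ + (20 : ℕ) * ℓ + -(ℓ ^ 2 / 4)) ≤ 1 := by
              rw [Real.exp_le_one_iff]
              push_cast
              nlinarith
            linarith
    have h4 := mul_le_mul_of_nonneg_left h3 hΩ0.le
    linarith
  set f : SimpleGraph V → V → ℤ := fun G a => ((univ.filter fun b => G.Adj a b).card : ℤ) with hf
  set T : Finset (V → ℤ) := Fintype.piFinset fun _ => Finset.Ico (0 : ℤ) n with hT
  have hTcard : T.card = n ^ n := by
    rw [hT, Fintype.card_piFinset]
    simp [hnn]
  have hmaps : ∀ G ∈ S, f G ∈ T := by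
    intro G _
    rw [hT, Fintype.mem_piFinset]
    intro a
    rw [Finset.mem_Ico]
    refine ⟨by positivity, ?_⟩
    have : (univ.filter fun b => G.Adj a b).card < n :=
      Finset.card_lt_univ_of_notMem (x := a) (by simp)
    simp only [hf]
    exact_mod_cast this
  have hnn0 : 0 < n := Fintype.card_pos
  have hTne : T.Nonempty := by
    rw [← Finset.card_pos, hTcard]
    positivity
  obtain ⟨x, -, hx⟩ := Finset.exists_le_card_fiber_of_nsmul_le_card_of_maps_to hmaps hTne
    (b := Ω / 2 / (n : ℝ) ^ n) (by
      rw [hTcard, nsmul_eq_mul]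
      push_cast
      rw [mul_div_cancel₀ _ (by positivity)]
      exact hScard)
  have hb : 0 < Ω / 2 / (n : ℝ) ^ n := by positivity
  obtain ⟨G, hG⟩ : (S.filter fun G => f G = x).Nonempty := by
    rw [← Finset.card_pos]
    exact_mod_cast hb.trans_le hx
  rw [Finset.mem_filter] at hG
  have hGx : G ∈ realizations x := mem_realizations_iff_card.2 fun a => congrFun hG.2 a
  refine ⟨x, ?_, ?_, ?_⟩
  · rw [← hG.2]
    have := G.sum_degrees_eq_twice_card_edges
    refine ⟨G.edgeFinset.card, ?_⟩
    rw [← two_mul]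
    have h2 : ∀ a, ((univ.filter fun b => G.Adj a b).card) = G.degree a := by
      intro a
      rw [← SimpleGraph.card_neighborFinset_eq_degree]
      congr 1
      ext b
      simp
    simp only [hf, h2]
    exact_mod_cast this
  · intro a
    rw [← hnn, ← mem_realizations.1 hGx a]
    have h1 := (Finset.mem_filter.1 hG.1).2
    push Not at h1
    have : 0 < ℓ ^ 11 := by positivity
    linarith [h1 a]
  · have hsub : (S.filter fun G => f G = x) ⊆ realizations x := by
      intro G hG
      exact mem_realizations_iff_card.2 fun a => congrFun (Finset.mem_filter.1 hG).2 a
    refine le_trans ?_ (hx.trans (Nat.cast_le.2 (Finset.card_le_card hsub)))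
    rw [div_div, div_eq_mul_inv]
    refine mul_le_mul_of_nonneg_left ?_ hΩ0.le
    rw [Real.exp_neg]
    refine inv_anti₀ (by positivity) ?_
    have h1 : (n : ℝ) ^ n ≤ Real.exp (ℓ ^ 20 * (20 * ℓ)) := by
      calc (n : ℝ) ^ n ≤ Real.exp ((20 : ℕ) * ℓ) ^ n := by
            refine pow_le_pow_left₀ (by positivity) ?_ _
            rw [hn]; exact hpow 20
        _ = _ := by rw [← Real.exp_nat_mul, hn]; push_cast; ring_nf
    have h2 : (2 : ℝ) ≤ Real.exp ((1 : ℕ) * ℓ) := by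
      refine le_trans ?_ (hpow 1)
      linarith
    calc 2 * (n : ℝ) ^ n ≤ Real.exp ((1 : ℕ) * ℓ) * Real.exp (ℓ ^ 20 * (20 * ℓ)) := by gcongr
      _ ≤ _ := by
        rw [← Real.exp_add, Real.exp_le_exp]
        have h3 := mul_pow_le_pow hℓ (c := 2) (by norm_num) (show 1 < 22 by norm_num)
        have h4 := mul_pow_le_pow hℓ (c := 40) (by norm_num) (show 21 < 22 by norm_num)
        push_cast
        nlinarith

/-- Every degree sequence of even sum near the middle has many realizations. -/
lemma rich_of_window {ℓ : ℝ} (hℓ : 10 ^ 6 ≤ ℓ) (hn : (Fintype.card V : ℝ) = ℓ ^ 20)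
    {x : V → ℤ} (heven : Even (∑ a, x a))
    (hw : ∀ a, |2 * (x a : ℝ) - ((Fintype.card V : ℝ) - 1)| ≤ 3 * ℓ ^ 11) : Rich ℓ x := by
  have hℓ0 : 0 < ℓ := by linarith
  obtain ⟨x₀, heven₀, hx₀⟩ := exists_within hℓ hn
  have hev : Even (∑ a, |x a - x₀ a|) := by
    refine even_sum_abs univ (fun a => x a - x₀ a) ?_
    rw [Finset.sum_sub_distrib]
    exact heven.sub heven₀
  obtain ⟨k, hk⟩ : ∃ k : ℕ, ∑ a, |x a - x₀ a| = 2 * k := by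
    obtain ⟨r, hr⟩ := hev
    have h0 : 0 ≤ ∑ a, |x a - x₀ a| := Finset.sum_nonneg fun a _ => abs_nonneg _
    exact ⟨r.toNat, by omega⟩
  have hkle : (k : ℝ) ≤ 2 * ℓ ^ 31 := by
    have h1 : (2 * k : ℝ) ≤ ∑ a : V, 3 * ℓ ^ 11 := by
      have h2 : (2 * k : ℝ) = ∑ a, |(x a : ℝ) - x₀ a| := by
        have : ((∑ a, |x a - x₀ a| : ℤ) : ℝ) = ((2 * k : ℤ) : ℝ) := by rw [hk]
        push_cast at this
        exact this.symm
      rw [h2]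
      refine Finset.sum_le_sum fun a _ => ?_
      have h3 := abs_le.1 (hw a)
      have h4 := abs_le.1 (hx₀.window a)
      rw [abs_le]
      constructor <;> linarith [h3.1, h3.2, h4.1, h4.2]
    rw [Finset.sum_const, Finset.card_univ, nsmul_eq_mul, hn] at h1
    have h5 : ℓ ^ 20 * (3 * ℓ ^ 11) = 3 * ℓ ^ 31 := by ring
    have h6 : 0 < ℓ ^ 31 := by positivity
    linarith
  have hB : 4 * (Fintype.card (SimpleGraph V) * Real.exp (-ℓ ^ 24)) ≤
      Real.exp (-(720 / ℓ ^ 8)) ^ k * (Fintype.card (SimpleGraph V) * Real.exp (-(ℓ ^ 22))) := by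
    rw [mul_left_comm, mul_left_comm (Real.exp (-(720 / ℓ ^ 8)) ^ k)]
    refine mul_le_mul_of_nonneg_left ?_ (by positivity)
    have h4 : (4 : ℝ) ≤ Real.exp ℓ := by linarith [Real.add_one_le_exp ℓ]
    refine (mul_le_mul_of_nonneg_right h4 (Real.exp_pos _).le).trans ?_
    rw [← Real.exp_nat_mul, ← Real.exp_add, ← Real.exp_add, Real.exp_le_exp]
    have h7 : (k : ℝ) * (720 / ℓ ^ 8) ≤ 1440 * ℓ ^ 23 := by
      calc (k : ℝ) * (720 / ℓ ^ 8) ≤ (2 * ℓ ^ 31) * (720 / ℓ ^ 8) := by gcongr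
        _ = 1440 * ℓ ^ 23 := by field_simp; ring
    have h8 := mul_pow_le_pow hℓ (c := 3000) (by norm_num) (show 23 < 24 by norm_num)
    have h9 := mul_pow_le_pow hℓ (c := 1) (by norm_num) (show 22 < 23 by norm_num)
    have h10 := mul_pow_le_pow hℓ (c := 1) (by norm_num) (show 1 < 23 by norm_num)
    simp only [pow_one] at h10
    linarith
  have hfin := within_of_path hℓ hn hx₀ k x hw hk hB
  have h0 : 0 ≤ (Fintype.card (SimpleGraph V) : ℝ) * Real.exp (-ℓ ^ 24) := by positivity
  have h11 : 0 < ℓ ^ 11 := by positivity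
  exact ⟨hℓ, hn, fun a => (hw a).trans (by linarith), 
    (le_mul_of_one_le_left h0 (by norm_num)).trans (hB.trans hfin.count)⟩

end SignedGraph

namespace SignedGraph

section Basic

variable {V : Type} [DecidableEq V]

/-- The weight of a triple, for the forward (`e = 1`) and backward (`e = -1`) switching. -/
noncomputable def tripleTerm (e : ℝ) (G : SimpleGraph V) (i j k l m : V) : ℝ :=
  ((1 + e * sgn G i k) * (1 + sgn G j k) * ((1 - e * sgn G i l) * (1 - sgn G j l))) *
    ((1 - e * sgn G m k) * (1 + e * sgn G m l))

lemma tripleTerm_bounds {e : ℝ} (he : |e| ≤ 1) (G : SimpleGraph V) (i j k l m : V) :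
    0 ≤ tripleTerm e G i j k l m ∧ tripleTerm e G i j k l m ≤ 64 := by
  have mul4 : ∀ {a b A B : ℝ}, 0 ≤ a ∧ a ≤ A → 0 ≤ b ∧ b ≤ B → 0 ≤ a * b ∧ a * b ≤ A * B := by
    intro a b A B ha hb
    exact ⟨mul_nonneg ha.1 hb.1, mul_le_mul ha.2 hb.2 hb.1 (ha.1.trans ha.2)⟩
  have h1 : (|(1 : ℝ)| ≤ 1) := by simp
  have p2 := one_add_mul_sgn_bounds G h1 j k
  have p4 := one_sub_mul_sgn_bounds G h1 j l
  rw [one_mul] at p2 p4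
  have := mul4 (mul4 (mul4 (one_add_mul_sgn_bounds G he i k) p2)
    (mul4 (one_sub_mul_sgn_bounds G he i l) p4))
    (mul4 (one_sub_mul_sgn_bounds G he m k) (one_add_mul_sgn_bounds G he m l))
  norm_num at this
  exact this

end Basic

variable {V : Type} [Fintype V] [DecidableEq V]

/-- The signed codegree of two vertices. -/
noncomputable def cod (i j : V) (G : SimpleGraph V) : ℝ := ∑ k, sgn G i k * sgn G j k

lemma abs_cod_le (i j : V) (G : SimpleGraph V) : |cod i j G| ≤ Fintype.card V := by
  refine (Finset.abs_sum_le_sum_abs _ _).trans ?_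
  calc ∑ k, |sgn G i k * sgn G j k| ≤ ∑ k : V, (1 : ℝ) := by
        refine Finset.sum_le_sum fun k _ => ?_
        rw [abs_mul]
        exact mul_le_one₀ (abs_sgn_le _ _ _) (abs_nonneg _) (abs_sgn_le _ _ _)
    _ = _ := by simp

lemma cod_toggle_of_ne {i j a b : V} (G : SimpleGraph V) (hai : a ≠ i) (haj : a ≠ j)
    (hbi : b ≠ i) (hbj : b ≠ j) : cod i j (toggle a b G) = cod i j G := by
  refine Finset.sum_congr rfl fun k _ => ?_
  rw [sgn_toggle_of_ne _ (by grind), sgn_toggle_of_ne _ (by grind)]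

lemma cod_toggle_left {i j a : V} (G : SimpleGraph V) (hij : i ≠ j) (hai : a ≠ i) (haj : a ≠ j) :
    cod i j (toggle i a G) = cod i j G - 2 * (sgn G i a * sgn G j a) := by
  unfold cod
  rw [← Finset.add_sum_erase _ _ (mem_univ a),
    ← Finset.add_sum_erase _ (fun k => sgn G i k * sgn G j k) (mem_univ a), sgn_toggle_same,
    sgn_toggle_of_ne G (show ¬(j = i ∧ a = a ∨ j = a ∧ a = i) by grind)]
  have : ∑ k ∈ univ.erase a, sgn (toggle i a G) i k * sgn (toggle i a G) j k =
      ∑ k ∈ univ.erase a, sgn G i k * sgn G j k := by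
    refine Finset.sum_congr rfl fun k hk => ?_
    have hka := Finset.ne_of_mem_erase hk
    rw [sgn_toggle_of_ne _ (by grind), sgn_toggle_of_ne _ (by grind)]
  rw [this]; ring

/-- The triples available for switching the codegree of `i j`. -/
noncomputable def switchTriples (i j : V) : Finset (V × V × V) :=
  univ.filter fun p => (p.1 ≠ p.2.1 ∧ p.1 ≠ p.2.2 ∧ p.2.1 ≠ p.2.2) ∧
    (p.1 ≠ i ∧ p.1 ≠ j ∧ p.2.1 ≠ i ∧ p.2.1 ≠ j ∧ p.2.2 ≠ i ∧ p.2.2 ≠ j)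

lemma card_compl_switchTriples_le (i j : V) :
    ((univ \ switchTriples i j).card : ℝ) ≤ 9 * (Fintype.card V : ℝ) ^ 2 := by
  obtain ⟨δ, hδ⟩ : ∃ δ : V → V → ℝ, ∀ a b, δ a b = if a = b then 1 else 0 :=
    ⟨_, fun _ _ => rfl⟩
  have h1 : ((univ \ switchTriples i j).card : ℝ) =
      ∑ p : V × V × V, if p ∈ univ \ switchTriples i j then (1 : ℝ) else 0 := by
    rw [Finset.sum_ite_mem, Finset.univ_inter, Finset.sum_const, nsmul_eq_mul, mul_one]
  have h2 : ∀ p : V × V × V, (if p ∈ univ \ switchTriples i j then (1 : ℝ) else 0) ≤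
      δ p.1 p.2.1 + δ p.1 p.2.2 + δ p.2.1 p.2.2 + δ p.1 i + δ p.1 j + δ p.2.1 i + δ p.2.1 j +
        δ p.2.2 i + δ p.2.2 j := by
    intro p
    have hn : ∀ a b, 0 ≤ δ a b := by
      intro a b; rw [hδ]; split_ifs <;> norm_num
    have a1 := hn p.1 p.2.1
    have a2 := hn p.1 p.2.2
    have a3 := hn p.2.1 p.2.2
    have a4 := hn p.1 i
    have a5 := hn p.1 j
    have a6 := hn p.2.1 i
    have a7 := hn p.2.1 j
    have a8 := hn p.2.2 i
    have a9 := hn p.2.2 j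
    by_cases hp : p ∈ univ \ switchTriples i j
    · rw [if_pos hp]
      simp only [switchTriples, mem_sdiff, mem_univ, mem_filter, true_and] at hp
      by_cases b1 : p.1 = p.2.1
      · linarith [(hδ p.1 p.2.1).trans (if_pos b1)]
      by_cases b2 : p.1 = p.2.2
      · linarith [(hδ p.1 p.2.2).trans (if_pos b2)]
      by_cases b3 : p.2.1 = p.2.2
      · linarith [(hδ p.2.1 p.2.2).trans (if_pos b3)]
      by_cases b4 : p.1 = i
      · linarith [(hδ p.1 i).trans (if_pos b4)]
      by_cases b5 : p.1 = j
      · linarith [(hδ p.1 j).trans (if_pos b5)]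
      by_cases b6 : p.2.1 = i
      · linarith [(hδ p.2.1 i).trans (if_pos b6)]
      by_cases b7 : p.2.1 = j
      · linarith [(hδ p.2.1 j).trans (if_pos b7)]
      by_cases b8 : p.2.2 = i
      · linarith [(hδ p.2.2 i).trans (if_pos b8)]
      by_cases b9 : p.2.2 = j
      · linarith [(hδ p.2.2 j).trans (if_pos b9)]
      exact absurd ⟨⟨b1, b2, b3⟩, b4, b5, b6, b7, b8, b9⟩ hp
    · rw [if_neg hp]; linarith
  rw [h1]
  refine (Finset.sum_le_sum fun p _ => h2 p).trans (le_of_eq ?_)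
  have hr : ∀ a, ∑ x, δ x a = 1 := fun a => by simp [hδ]
  have hl : ∀ a, ∑ x, δ a x = 1 := fun a => by simp [hδ]
  simp only [Finset.sum_add_distrib, Fintype.sum_prod_type, Finset.sum_const, Finset.card_univ,
    Fintype.card_prod, Nat.cast_mul, nsmul_eq_mul, ← Finset.mul_sum, hr, hl]
  ring

/-- The weighted number of codegree switchings. -/
noncomputable def tripleCount (e : ℝ) (i j : V) (G : SimpleGraph V) : ℝ :=
  ∑ p ∈ switchTriples i j, tripleTerm e G i j p.1 p.2.1 p.2.2

lemma tripleCount_bounds {e : ℝ} (he : |e| ≤ 1) (i j : V) (G : SimpleGraph V) :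
    0 ≤ tripleCount e i j G ∧ tripleCount e i j G ≤ 64 * (Fintype.card V : ℝ) ^ 3 := by
  refine ⟨Finset.sum_nonneg fun p _ => (tripleTerm_bounds he G i j _ _ _).1, ?_⟩
  refine (Finset.sum_le_sum fun p _ => (tripleTerm_bounds he G i j _ _ _).2).trans ?_
  rw [Finset.sum_const, nsmul_eq_mul]
  have : ((switchTriples i j).card : ℝ) ≤ (Fintype.card V : ℝ) ^ 3 := by
    have := Finset.card_le_univ (switchTriples i j)
    rw [Fintype.card_prod, Fintype.card_prod] at this
    have h2 : ((switchTriples i j).card : ℝ) ≤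
      (Fintype.card V : ℝ) * ((Fintype.card V : ℝ) * Fintype.card V) := by exact_mod_cast this
    linarith [show (Fintype.card V : ℝ) ^ 3 =
      (Fintype.card V : ℝ) * ((Fintype.card V : ℝ) * Fintype.card V) by ring]
  linarith

lemma sum_tripleCount {i j : V} (hij : i ≠ j) (d : V → ℤ) (w : ℝ → ℝ) :
    ∑ G ∈ realizations d, w (cod i j G) * tripleCount 1 i j G =
      ∑ G ∈ realizations d, w (cod i j G + 4) * tripleCount (-1) i j G := by
  simp only [tripleCount, Finset.mul_sum]
  rw [Finset.sum_comm, Finset.sum_comm (s := realizations d)]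
  refine Finset.sum_congr rfl fun p hp => ?_
  obtain ⟨k, l, m⟩ := p
  obtain ⟨⟨h1, h2, h3⟩, h4, h5, h6, h7, h8, h9⟩ := (Finset.mem_filter.1 hp).2
  simp only at h1 h2 h3 h4 h5 h6 h7 h8 h9 ⊢
  have := sum_switch h4.symm h6.symm h8.symm h1 h2 h3 d
    (Φ := fun G => w (cod i j G) * ((1 + sgn G j k) * (1 - sgn G j l)))
    (Ψ := fun G => w (cod i j G + 4) * ((1 + sgn G j k) * (1 - sgn G j l))) ?_
  · convert this using 2
    · rename_i G _
      simp only [tripleTerm]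
      rw [sgn_comm G k m, sgn_comm G l m]
      ring
    · rename_i G _
      simp only [tripleTerm]
      rw [sgn_comm G k m, sgn_comm G l m]
      ring
  · intro G hik hil hlm hkm
    have e1 : ∀ a, a ≠ i → sgn (toggle k m (toggle l m (toggle i l (toggle i k G)))) j a =
        sgn G j a := by
      intro a ha
      rw [sgn_toggle_of_ne _ (by grind), sgn_toggle_of_ne _ (by grind),
        sgn_toggle_of_ne _ (by grind), sgn_toggle_of_ne _ (by grind)]
    have e2 : cod i j (toggle k m (toggle l m (toggle i l (toggle i k G)))) =
        cod i j G - 2 * (sgn G i k * sgn G j k) - 2 * (sgn G i l * sgn G j l) := by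
      rw [cod_toggle_of_ne _ h4 h5 h8 h9, cod_toggle_of_ne _ h6 h7 h8 h9,
        cod_toggle_left _ hij h6 h7, cod_toggle_left _ hij h4 h5,
        sgn_toggle_of_ne _ (by grind), sgn_toggle_of_ne _ (by grind)]
    rw [e1 k h4, e1 l h6, e2, hik, hil]
    rcases sgn_eq_or G (Ne.symm h5) with hjk | hjk
    · rcases sgn_eq_or G (Ne.symm h7) with hjl | hjl
      · simp [hjl]
      · rw [hjk, hjl]; ring_nf
    · simp [hjk]

lemma Rich.sum_sq_le {ℓ : ℝ} {d : V → ℤ} (h : Rich ℓ d) {G : SimpleGraph V}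
    (hG : G ∉ irregular V ((3 * ℓ ^ 12) ^ 2)) {z : V → ℝ}
    (hz : ∀ k, z k = 0 ∨ z k = 1 ∨ z k = -1) :
    ∑ m, (∑ k, sgn G m k * z k) ^ 2 ≤ 36 * ℓ ^ 44 := by
  refine (sum_sq_le_of_regular hG hz).trans (le_of_eq ?_)
  rw [h.card]; ring

lemma Rich.sum_sq_product_le {ℓ : ℝ} {d : V → ℤ} (h : Rich ℓ d) {G : SimpleGraph V}
    (hG : G ∉ irregular V ((3 * ℓ ^ 12) ^ 2)) {x y : V → ℝ}
    (hx : ∀ k, x k = 0 ∨ x k = 1 ∨ x k = -1) (hy : ∀ k, y k = 0 ∨ y k = 1 ∨ y k = -1) :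
    ∑ m, (∑ k, sgn G m k * ((1 + x k) * (1 + y k))) ^ 2 ≤ 576 * ℓ ^ 44 := by
  have b1 := h.sum_sq_le hG (z := fun _ => 1) (by simp)
  have b2 := h.sum_sq_le hG hx
  have b3 := h.sum_sq_le hG hy
  have b4 := h.sum_sq_le hG (z := fun k => x k * y k) (fun k => by
    rcases hx k with h1 | h1 | h1 <;> rcases hy k with h2 | h2 | h2 <;> simp [h1, h2])
  have hexp : ∀ m, ∑ k, sgn G m k * ((1 + x k) * (1 + y k)) = ∑ k, sgn G m k * 1 +
      ∑ k, sgn G m k * x k + ∑ k, sgn G m k * y k + ∑ k, sgn G m k * (x k * y k) := by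
    intro m
    simp only [← Finset.sum_add_distrib]
    exact Finset.sum_congr rfl fun k _ => by ring
  have hfour : ∀ a b c d : ℝ, (a + b + c + d) ^ 2 ≤ 4 * (a ^ 2 + b ^ 2 + c ^ 2 + d ^ 2) := by
    intro a b c d
    nlinarith [sq_nonneg (a - b), sq_nonneg (a - c), sq_nonneg (a - d), sq_nonneg (b - c),
      sq_nonneg (b - d), sq_nonneg (c - d)]
  calc _ ≤ ∑ m, 4 * ((∑ k, sgn G m k * 1) ^ 2 + (∑ k, sgn G m k * x k) ^ 2 +
        (∑ k, sgn G m k * y k) ^ 2 + (∑ k, sgn G m k * (x k * y k)) ^ 2) := by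
        refine Finset.sum_le_sum fun m _ => ?_
        rw [hexp]
        exact hfour _ _ _ _
    _ ≤ _ := by
        rw [← Finset.mul_sum, Finset.sum_add_distrib, Finset.sum_add_distrib,
          Finset.sum_add_distrib]
        linarith

/-- The weighted degree sum along the neighbourhood signs of a vertex. -/
noncomputable def degreeCorr (j : V) (G : SimpleGraph V) : ℝ := ∑ k, sgn G j k * ∑ m, sgn G k m

lemma Rich.abs_tripleCount_sub_le {ℓ : ℝ} {d : V → ℤ} (h : Rich ℓ d) {e : ℝ}
    (he : e = 1 ∨ e = -1) {G : SimpleGraph V} (hG : G ∈ realizations d)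
    (hreg : G ∉ irregular V ((3 * ℓ ^ 12) ^ 2)) (i j : V) :
    |tripleCount e i j G - (ℓ ^ 60 + ℓ ^ 20 * cod i j G ^ 2 - 2 * ℓ ^ 20 * degreeCorr i G +
      e * (2 * ℓ ^ 40 * cod i j G - 2 * ℓ ^ 20 * degreeCorr j G))| ≤
      600 * ℓ ^ 44 + 32 * ℓ ^ 31 * |cod i j G| := by
  have hℓ := h.pos
  have he1 : |e| ≤ 1 := by rcases he with rfl | rfl <;> simp
  have hee : e * e = 1 := by rcases he with rfl | rfl <;> simp
  have hn : (Fintype.card V : ℝ) = ℓ ^ 20 := h.card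
  set Y := cod i j G with hY
  set X := ∑ k, sgn G i k with hX
  set Z := ∑ k, sgn G j k with hZ
  have hXb : |X| ≤ 4 * ℓ ^ 11 := h.abs_degree_le hG i
  have hZb : |Z| ≤ 4 * ℓ ^ 11 := h.abs_degree_le hG j
  set α : V → ℝ := fun k => (1 + e * sgn G i k) * (1 + sgn G j k) with hα
  set β : V → ℝ := fun k => (1 - e * sgn G i k) * (1 - sgn G j k) with hβ
  have h1 : (|(1 : ℝ)| ≤ 1) := by simp
  have hαb : ∀ k, |α k| ≤ 4 := fun k => by
    have p1 := one_add_mul_sgn_bounds G he1 i k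
    have p2 := one_add_mul_sgn_bounds G h1 j k
    rw [one_mul] at p2
    rw [abs_of_nonneg (mul_nonneg p1.1 p2.1)]
    have := mul_le_mul p1.2 p2.2 p2.1 (by norm_num)
    linarith
  have hβb : ∀ k, |β k| ≤ 4 := fun k => by
    have p1 := one_sub_mul_sgn_bounds G he1 i k
    have p2 := one_sub_mul_sgn_bounds G h1 j k
    rw [one_mul] at p2
    rw [abs_of_nonneg (mul_nonneg p1.1 p2.1)]
    have := mul_le_mul p1.2 p2.2 p2.1 (by norm_num)
    linarith
  set a := ∑ k, α k with ha
  set b := ∑ k, β k with hb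
  have ha' : a = ℓ ^ 20 + e * X + Z + e * Y := by
    rw [ha, hX, hZ, hY, cod, Finset.mul_sum, Finset.mul_sum, ← hn]
    have : (Fintype.card V : ℝ) = ∑ k : V, (1 : ℝ) := by simp
    rw [this, ← Finset.sum_add_distrib, ← Finset.sum_add_distrib, ← Finset.sum_add_distrib]
    exact Finset.sum_congr rfl fun k _ => by simp only [hα]; ring
  have hb' : b = ℓ ^ 20 - e * X - Z + e * Y := by
    rw [hb, hX, hZ, hY, cod, Finset.mul_sum, Finset.mul_sum, ← hn]
    have : (Fintype.card V : ℝ) = ∑ k : V, (1 : ℝ) := by simp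
    rw [this, ← Finset.sum_sub_distrib, ← Finset.sum_sub_distrib, ← Finset.sum_add_distrib]
    exact Finset.sum_congr rfl fun k _ => by simp only [hβ]; ring
  set u : V → ℝ := fun m => ∑ k, sgn G m k * α k with hu
  set w : V → ℝ := fun m => ∑ k, sgn G m k * β k with hw
  set U := ∑ m, u m with hU
  set W := ∑ m, w m with hW
  have hswap : ∀ γ : V → ℝ, ∑ m, ∑ k, sgn G m k * γ k = ∑ k, γ k * ∑ m, sgn G k m := by
    intro γ
    rw [Finset.sum_comm]
    refine Finset.sum_congr rfl fun k _ => ?_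
    rw [Finset.mul_sum]
    exact Finset.sum_congr rfl fun m _ => by rw [sgn_comm G m k]; ring
  have hUW : W - U = -2 * e * degreeCorr i G - 2 * degreeCorr j G := by
    rw [hW, hU, hu, hw, hswap, hswap, degreeCorr, degreeCorr, Finset.mul_sum, Finset.mul_sum,
      ← Finset.sum_sub_distrib, ← Finset.sum_sub_distrib]
    refine Finset.sum_congr rfl fun k _ => ?_
    simp only [hα, hβ]
    ring
  have hsumb : ∀ γ : V → ℝ, (∀ k, |γ k| ≤ 4) → |∑ m, ∑ k, sgn G m k * γ k| ≤ 16 * ℓ ^ 31 := by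
    intro γ hγ
    rw [hswap]
    refine (Finset.abs_sum_le_sum_abs _ _).trans ?_
    calc ∑ k, |γ k * ∑ m, sgn G k m| ≤ ∑ k : V, 4 * (4 * ℓ ^ 11) := by
          refine Finset.sum_le_sum fun k _ => ?_
          rw [abs_mul]
          exact mul_le_mul (hγ k) (h.abs_degree_le hG k) (abs_nonneg _) (by norm_num)
      _ = 16 * ℓ ^ 31 := by
          rw [Finset.sum_const, Finset.card_univ, nsmul_eq_mul, hn]; ring
  have hUb : |U| ≤ 16 * ℓ ^ 31 := hsumb α hαb
  have hWb : |W| ≤ 16 * ℓ ^ 31 := hsumb β hβb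
  have hsx : ∀ k, e * sgn G i k = 0 ∨ e * sgn G i k = 1 ∨ e * sgn G i k = -1 := fun k => by
    rcases he with rfl | rfl <;> rcases sgn_trichotomy G i k with h | h | h <;> simp [h]
  have hu2 : ∑ m, u m ^ 2 ≤ 576 * ℓ ^ 44 :=
    h.sum_sq_product_le hreg hsx (fun k => sgn_trichotomy G j k)
  have hw2 : ∑ m, w m ^ 2 ≤ 576 * ℓ ^ 44 := by
    have := h.sum_sq_product_le hreg (x := fun k => -(e * sgn G i k)) (y := fun k => -sgn G j k)
      (fun k => by rcases hsx k with h | h | h <;> simp [h])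
      (fun k => by rcases sgn_trichotomy G j k with h | h | h <;> simp [h])
    simpa only [hw, hβ, sub_eq_add_neg] using this
  have hquad : |∑ m, u m * w m| ≤ 576 * ℓ ^ 44 := by
    refine abs_le_of_sq_le_sq ?_ (by positivity)
    refine (Finset.sum_mul_sq_le_sq_mul_sq univ u w).trans ?_
    rw [pow_two]
    exact mul_le_mul hu2 hw2 (Finset.sum_nonneg fun _ _ => sq_nonneg _) (by positivity)
  have hfull : ∑ p : V × V × V, tripleTerm e G i j p.1 p.2.1 p.2.2 =
      ℓ ^ 20 * (a * b) - e * (b * U) + e * (a * W) - ∑ m, u m * w m := by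
    have h3 : ∀ m, ∑ k, ∑ l, tripleTerm e G i j k l m = (a - e * u m) * (b + e * w m) := by
      intro m
      have e1 : a - e * u m = ∑ k, α k * (1 - e * sgn G m k) := by
        rw [ha, hu, Finset.mul_sum, ← Finset.sum_sub_distrib]
        exact Finset.sum_congr rfl fun k _ => by ring
      have e2 : b + e * w m = ∑ k, β k * (1 + e * sgn G m k) := by
        rw [hb, hw, Finset.mul_sum, ← Finset.sum_add_distrib]
        exact Finset.sum_congr rfl fun k _ => by ring
      rw [e1, e2, Finset.sum_mul_sum]
      refine Finset.sum_congr rfl fun k _ => Finset.sum_congr rfl fun l _ => ?_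
      simp only [tripleTerm, hα, hβ]
      ring
    have h4 : ∑ p : V × V × V, tripleTerm e G i j p.1 p.2.1 p.2.2 =
        ∑ m, ∑ k, ∑ l, tripleTerm e G i j k l m := by
      simp only [Fintype.sum_prod_type]
      rw [Finset.sum_congr rfl fun k _ => Finset.sum_comm, Finset.sum_comm]
    rw [h4, Finset.sum_congr rfl fun m _ => h3 m]
    have h5 : ∀ m, (a - e * u m) * (b + e * w m) =
        a * b - e * b * u m + e * a * w m - u m * w m := by
      intro m
      linear_combination (-(u m * w m)) * hee
    rw [Finset.sum_congr rfl fun m _ => h5 m, Finset.sum_sub_distrib, Finset.sum_add_distrib,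
      Finset.sum_sub_distrib, ← Finset.mul_sum univ u, ← Finset.mul_sum univ w, ← hU, ← hW,
      Finset.sum_const, Finset.card_univ, nsmul_eq_mul, hn]
    ring
  have hsplit : ∑ p : V × V × V, tripleTerm e G i j p.1 p.2.1 p.2.2 = tripleCount e i j G +
      ∑ p ∈ univ \ switchTriples i j, tripleTerm e G i j p.1 p.2.1 p.2.2 := by
    rw [add_comm]
    exact (Finset.sum_sdiff (Finset.subset_univ (switchTriples i j))).symm
  have hrest0 : 0 ≤ ∑ p ∈ univ \ switchTriples i j, tripleTerm e G i j p.1 p.2.1 p.2.2 :=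
    Finset.sum_nonneg fun p _ => (tripleTerm_bounds he1 G i j _ _ _).1
  have hrest1 : ∑ p ∈ univ \ switchTriples i j, tripleTerm e G i j p.1 p.2.1 p.2.2 ≤
      576 * ℓ ^ 40 := by
    refine (Finset.sum_le_sum fun p _ => (tripleTerm_bounds he1 G i j _ _ _).2).trans ?_
    rw [Finset.sum_const, nsmul_eq_mul]
    have := card_compl_switchTriples_le i j
    rw [hn] at this
    linarith [show (ℓ ^ 20) ^ 2 = ℓ ^ 40 by ring]
  set R := ∑ p ∈ univ \ switchTriples i j, tripleTerm e G i j p.1 p.2.1 p.2.2 with hR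
  have hmain : tripleCount e i j G - (ℓ ^ 60 + ℓ ^ 20 * Y ^ 2 - 2 * ℓ ^ 20 * degreeCorr i G +
      e * (2 * ℓ ^ 40 * Y - 2 * ℓ ^ 20 * degreeCorr j G)) =
      -(ℓ ^ 20 * ((e * X + Z) * (e * X + Z))) + (X + e * Z + Y) * W - (-X - e * Z + Y) * U -
        ∑ m, u m * w m - R := by
    have h6 : tripleCount e i j G = ℓ ^ 20 * (a * b) - e * (b * U) + e * (a * W) -
      ∑ m, u m * w m - R := by linarith
    rw [h6, ha', hb']
    linear_combination (ℓ ^ 20 * e) * hUW +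
      (ℓ ^ 20 * Y ^ 2 + (X + Y) * W - (-X + Y) * U - 2 * ℓ ^ 20 * degreeCorr i G) * hee
  have heX : |e * X| ≤ 4 * ℓ ^ 11 := by
    rw [abs_mul]; exact (mul_le_of_le_one_left (abs_nonneg _) he1).trans hXb
  have heZ : |e * Z| ≤ 4 * ℓ ^ 11 := by
    rw [abs_mul]; exact (mul_le_of_le_one_left (abs_nonneg _) he1).trans hZb
  have hs1 : |e * X + Z| ≤ 8 * ℓ ^ 11 := (abs_add_le _ _).trans (by linarith)
  have t1 : |ℓ ^ 20 * ((e * X + Z) * (e * X + Z))| ≤ 64 * ℓ ^ 42 := by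
    rw [abs_mul, abs_of_pos (by positivity : (0 : ℝ) < ℓ ^ 20), abs_mul]
    calc _ ≤ ℓ ^ 20 * ((8 * ℓ ^ 11) * (8 * ℓ ^ 11)) := by gcongr
      _ = _ := by ring
  have t2 : |(X + e * Z + Y) * W| ≤ (8 * ℓ ^ 11 + |Y|) * (16 * ℓ ^ 31) := by
    rw [abs_mul]
    have : |X + e * Z + Y| ≤ 8 * ℓ ^ 11 + |Y| :=
      (abs_add_three _ _ _).trans (by linarith)
    gcongr
  have t3 : |(-X - e * Z + Y) * U| ≤ (8 * ℓ ^ 11 + |Y|) * (16 * ℓ ^ 31) := by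
    rw [abs_mul]
    have : |-X - e * Z + Y| ≤ 8 * ℓ ^ 11 + |Y| := by
      have := abs_add_three (-X) (-(e * Z)) Y
      rw [abs_neg, abs_neg, ← sub_eq_add_neg] at this
      linarith
    gcongr
  have p1 := mul_pow_le_pow h.large (c := 576) (by norm_num) (show 40 < 42 by norm_num)
  have p2 := mul_pow_le_pow h.large (c := 400) (by norm_num) (show 42 < 44 by norm_num)
  have q : (8 * ℓ ^ 11 + |Y|) * (16 * ℓ ^ 31) = 128 * ℓ ^ 42 + 16 * ℓ ^ 31 * |Y| := by ring
  have h42 : 0 < ℓ ^ 42 := by positivity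
  rw [q] at t2 t3
  rw [hmain]
  rw [abs_le] at t1 t2 t3 hquad ⊢
  constructor <;> linarith [t1.1, t1.2, t2.1, t2.2, t3.1, t3.2, hquad.1, hquad.2]

end SignedGraph

namespace SignedGraph

variable {V : Type} [Fintype V] [DecidableEq V]

namespace Rich

variable {ℓ : ℝ} {d : V → ℤ}

lemma sum_le (h : Rich ℓ d) {f : SimpleGraph V → ℝ} {A : ℝ} (hA : 0 ≤ A)
    (hreg : ∀ G ∈ realizations d, G ∉ irregular V ((3 * ℓ ^ 12) ^ 2) → f G ≤ A)
    (hall : ∀ G ∈ realizations d, f G ≤ ℓ ^ 200) :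
    ∑ G ∈ realizations d, f G ≤ (A + 1) * (realizations d).card := by
  have hℓ := h.pos
  have hmax : ∀ G, |max (f G) 0| = max (f G) 0 := fun G => abs_of_nonneg (le_max_right _ _)
  refine le_trans ?_ (h.sum_abs_le (f := fun G => max (f G) 0) hA ?_ ?_)
  · exact Finset.sum_le_sum fun G _ => by rw [hmax]; exact le_max_left _ _
  · exact fun G hG hr => by rw [hmax]; exact max_le (hreg G hG hr) hA
  · exact fun G hG => by rw [hmax]; exact max_le (hall G hG) (by positivity)

lemma abs_degreeCorr_le (h : Rich ℓ d) {G : SimpleGraph V} (hG : G ∈ realizations d) (j : V) :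
    |degreeCorr j G| ≤ 4 * ℓ ^ 31 := by
  refine (Finset.abs_sum_le_sum_abs _ _).trans ?_
  calc ∑ k, |sgn G j k * ∑ m, sgn G k m| ≤ ∑ k : V, 1 * (4 * ℓ ^ 11) := by
        refine Finset.sum_le_sum fun k _ => ?_
        rw [abs_mul]
        exact mul_le_mul (abs_sgn_le _ _ _) (h.abs_degree_le hG k) (abs_nonneg _) (by norm_num)
    _ = _ := by rw [Finset.sum_const, Finset.card_univ, nsmul_eq_mul, h.card]; ring

lemma abs_cod_le (h : Rich ℓ d) (i j : V) (G : SimpleGraph V) : |cod i j G| ≤ ℓ ^ 20 := by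
  rw [← h.card]; exact SignedGraph.abs_cod_le i j G

lemma abs_tripleCount_diff_le (h : Rich ℓ d) (i j : V) (G : SimpleGraph V) :
    |tripleCount 1 i j G - tripleCount (-1) i j G| ≤ 64 * ℓ ^ 60 := by
  have h1 := tripleCount_bounds (e := 1) (by simp) i j G
  have h2 := tripleCount_bounds (e := -1) (by simp) i j G
  rw [h.card, show (ℓ ^ 20) ^ 3 = ℓ ^ 60 by ring] at h1 h2
  rw [abs_le]
  constructor <;> linarith [h1.1, h1.2, h2.1, h2.2]

lemma abs_tripleCount_diff_sub_le (h : Rich ℓ d) {G : SimpleGraph V} (hG : G ∈ realizations d)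
    (hreg : G ∉ irregular V ((3 * ℓ ^ 12) ^ 2)) (i j : V) :
    |tripleCount 1 i j G - tripleCount (-1) i j G -
      (4 * ℓ ^ 40 * cod i j G - 4 * ℓ ^ 20 * degreeCorr j G)| ≤
      1200 * ℓ ^ 44 + 64 * ℓ ^ 31 * |cod i j G| := by
  have h1 := h.abs_tripleCount_sub_le (e := 1) (by simp) hG hreg i j
  have h2 := h.abs_tripleCount_sub_le (e := -1) (by simp) hG hreg i j
  rw [abs_le] at h1 h2 ⊢
  constructor <;> linarith [h1.1, h1.2, h2.1, h2.2]

/-- The fourth moment of the signed codegree has the order of magnitude of `n²`. -/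
lemma sum_cod_pow_four_le (h : Rich ℓ d) {i j : V} (hij : i ≠ j) :
    ∑ G ∈ realizations d, cod i j G ^ 4 ≤ 10 ^ 8 * ℓ ^ 44 * (realizations d).card := by
  have hℓ := h.pos
  have hN := h.card_pos
  have hsw := sum_tripleCount hij d (fun t => t ^ 3)
  have key := h.sum_le (f := fun G => ℓ ^ 40 * cod i j G ^ 4 -
      (cod i j G ^ 3 * tripleCount 1 i j G - (cod i j G + 4) ^ 3 * tripleCount (-1) i j G))
      (A := 2 * 10 ^ 7 * ℓ ^ 84) (by positivity) ?_ ?_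
  · rw [Finset.sum_sub_distrib, Finset.sum_sub_distrib, hsw, sub_self, sub_zero,
      ← Finset.mul_sum] at key
    have h84 : (1 : ℝ) ≤ ℓ ^ 84 := one_le_pow₀ h.one_le
    have : ℓ ^ 40 * ∑ G ∈ realizations d, cod i j G ^ 4 ≤
        ℓ ^ 40 * (10 ^ 8 * ℓ ^ 44 * (realizations d).card) := by
      refine key.trans ?_
      have := mul_le_mul_of_nonneg_right
        (show 2 * 10 ^ 7 * ℓ ^ 84 + 1 ≤ 10 ^ 8 * ℓ ^ 84 by linarith) hN.le
      linarith [show ℓ ^ 40 * (10 ^ 8 * ℓ ^ 44 * ((realizations d).card : ℝ)) =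
        10 ^ 8 * ℓ ^ 84 * (realizations d).card by ring]
    exact le_of_mul_le_mul_left this (by positivity)
  · intro G hG hreg
    set Y := cod i j G
    set F := tripleCount 1 i j G
    set F' := tripleCount (-1) i j G
    obtain ⟨hF0, hF1⟩ : 0 ≤ F' ∧ F' ≤ 64 * ℓ ^ 60 := by
      have := tripleCount_bounds (e := -1) (by simp) i j G
      rwa [h.card, ← pow_mul] at this
    have hdiff := h.abs_tripleCount_diff_sub_le hG hreg i j
    have hcorr := h.abs_degreeCorr_le hG j
    obtain ⟨p, hp0, hp⟩ : ∃ p, 0 ≤ p ∧ |Y| = ℓ ^ 11 * p :=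
      ⟨|Y| / ℓ ^ 11, by positivity, by field_simp⟩
    have hp9 : p ≤ ℓ ^ 9 := by
      have := h.abs_cod_le i j G
      rw [show |cod i j G| = ℓ ^ 11 * p from hp, show ℓ ^ 20 = ℓ ^ 11 * ℓ ^ 9 by ring] at this
      exact le_of_mul_le_mul_left this (by positivity)
    have hD : |F - F' - 4 * ℓ ^ 40 * Y| ≤ 100 * ℓ ^ 51 := by
      have e : F - F' - 4 * ℓ ^ 40 * Y = (F - F' - (4 * ℓ ^ 40 * Y - 4 * ℓ ^ 20 * degreeCorr j G)) -
        4 * ℓ ^ 20 * degreeCorr j G := by ring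
      have h1 : |4 * ℓ ^ 20 * degreeCorr j G| ≤ 16 * ℓ ^ 51 := by
        rw [abs_mul, abs_of_pos (by positivity : (0 : ℝ) < 4 * ℓ ^ 20)]
        calc _ ≤ 4 * ℓ ^ 20 * (4 * ℓ ^ 31) := by gcongr
          _ = _ := by ring
      have h2 : 64 * ℓ ^ 31 * |cod i j G| ≤ 64 * ℓ ^ 51 := by
        calc _ ≤ 64 * ℓ ^ 31 * ℓ ^ 20 := by
              gcongr
              exact h.abs_cod_le i j G
          _ = _ := by ring
      have h3 := mul_pow_le_pow h.large (c := 1200) (by norm_num) (show 44 < 51 by norm_num)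
      rw [e]
      have := abs_sub (F - F' - (4 * ℓ ^ 40 * Y - 4 * ℓ ^ 20 * degreeCorr j G))
        (4 * ℓ ^ 20 * degreeCorr j G)
      have h51 : 0 < ℓ ^ 51 := by positivity
      linarith
    have e1 : ℓ ^ 40 * Y ^ 4 - (Y ^ 3 * F - (Y + 4) ^ 3 * F') = -3 * ℓ ^ 40 * Y ^ 4 -
        Y ^ 3 * (F - F' - 4 * ℓ ^ 40 * Y) + (12 * Y ^ 2 + 48 * Y + 64) * F' := by ring
    have b1 : -(Y ^ 3 * (F - F' - 4 * ℓ ^ 40 * Y)) ≤ 100 * ℓ ^ 84 * p ^ 3 := by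
      refine (neg_le_abs _).trans ?_
      rw [abs_mul, abs_pow, hp]
      calc _ ≤ (ℓ ^ 11 * p) ^ 3 * (100 * ℓ ^ 51) := by gcongr
        _ = _ := by ring
    have b2 : (12 * Y ^ 2 + 48 * Y + 64) * F' ≤ ℓ ^ 84 * (p ^ 2 + p + 1) := by
      have h1 : (12 * Y ^ 2 + 48 * Y + 64) * F' ≤ (12 * |Y| ^ 2 + 48 * |Y| + 64) * (64 * ℓ ^ 60) := by
        rw [sq_abs]
        have : 48 * Y ≤ 48 * |Y| := by linarith [le_abs_self Y]
        exact mul_le_mul (by linarith) hF1 hF0 (by positivity)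
      rw [hp] at h1
      have q1 := mul_pow_le_pow h.large (c := 768) (by norm_num) (show 82 < 84 by norm_num)
      have q2 := mul_pow_le_pow h.large (c := 3072) (by norm_num) (show 71 < 84 by norm_num)
      have q3 := mul_pow_le_pow h.large (c := 4096) (by norm_num) (show 60 < 84 by norm_num)
      calc _ ≤ _ := h1
        _ = 768 * ℓ ^ 82 * p ^ 2 + 3072 * ℓ ^ 71 * p + 4096 * ℓ ^ 60 := by ring
        _ ≤ ℓ ^ 84 * p ^ 2 + ℓ ^ 84 * p + ℓ ^ 84 := by gcongr
        _ = _ := by ring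
    have b3 : ℓ ^ 40 * Y ^ 4 = ℓ ^ 84 * p ^ 4 := by
      rw [← Even.pow_abs (by decide : Even 4) Y, hp]; ring
    have b4 : -3 * p ^ 4 + 100 * p ^ 3 + p ^ 2 + p + 1 ≤ 2 * 10 ^ 7 := by
      have c1 : 100 * p ^ 3 ≤ p ^ 4 + 1.1 * 10 ^ 7 := by
        nlinarith [sq_nonneg (p ^ 2 - 50 * p - 1875), sq_nonneg (p - 75), sq_nonneg p]
      have c2 : p ^ 2 ≤ p ^ 4 + 1 := by nlinarith [sq_nonneg (p ^ 2 - 1)]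
      have c3 : p ≤ p ^ 4 + 2 := by nlinarith [sq_nonneg (p - 1)]
      linarith
    rw [e1]
    have : ℓ ^ 84 * (-3 * p ^ 4 + 100 * p ^ 3 + p ^ 2 + p + 1) ≤ ℓ ^ 84 * (2 * 10 ^ 7) := by
      gcongr
    linarith
  · intro G hG
    have hY := h.abs_cod_le i j G
    have hdiff := h.abs_tripleCount_diff_le i j G
    set Y := cod i j G
    set F := tripleCount 1 i j G
    set F' := tripleCount (-1) i j G
    obtain ⟨hF0, hF1⟩ : 0 ≤ F' ∧ F' ≤ 64 * ℓ ^ 60 := by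
      have := tripleCount_bounds (e := -1) (by simp) i j G
      rwa [h.card, ← pow_mul] at this
    have e1 : ℓ ^ 40 * Y ^ 4 - (Y ^ 3 * F - (Y + 4) ^ 3 * F') = ℓ ^ 40 * Y ^ 4 -
        Y ^ 3 * (F - F') + (12 * Y ^ 2 + 48 * Y + 64) * F' := by ring
    have b0 : ℓ ^ 40 * Y ^ 4 ≤ ℓ ^ 120 := by
      rw [← Even.pow_abs (by decide : Even 4) Y]
      calc _ ≤ ℓ ^ 40 * (ℓ ^ 20) ^ 4 := by gcongr
        _ = _ := by ring
    have b1 : -(Y ^ 3 * (F - F')) ≤ 64 * ℓ ^ 120 := by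
      refine (neg_le_abs _).trans ?_
      rw [abs_mul, abs_pow]
      calc _ ≤ (ℓ ^ 20) ^ 3 * (64 * ℓ ^ 60) := by gcongr
        _ = _ := by ring
    have b2 : (12 * Y ^ 2 + 48 * Y + 64) * F' ≤ (12 * (ℓ ^ 20) ^ 2 + 48 * ℓ ^ 20 + 64) *
        (64 * ℓ ^ 60) := by
      rw [← sq_abs Y]
      have : 48 * Y ≤ 48 * ℓ ^ 20 := by linarith [le_abs_self Y]
      refine mul_le_mul ?_ hF1 hF0 (by positivity)
      gcongr
    have q0 := mul_pow_le_pow h.large (c := 100) (by norm_num) (show 120 < 200 by norm_num)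
    have q1 := mul_pow_le_pow h.large (c := 768) (by norm_num) (show 100 < 120 by norm_num)
    have q2 := mul_pow_le_pow h.large (c := 3072) (by norm_num) (show 80 < 120 by norm_num)
    have q3 := mul_pow_le_pow h.large (c := 4096) (by norm_num) (show 60 < 120 by norm_num)
    rw [e1]
    linarith

lemma sum_cod_sq_le (h : Rich ℓ d) {i j : V} (hij : i ≠ j) :
    ∑ G ∈ realizations d, cod i j G ^ 2 ≤ 2 * 10 ^ 8 * ℓ ^ 22 * (realizations d).card := by
  have hℓ := h.pos
  have h4 := h.sum_cod_pow_four_le hij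
  have hN := h.card_pos
  have hle : ∀ G : SimpleGraph V, ℓ ^ 22 * cod i j G ^ 2 ≤ cod i j G ^ 4 + ℓ ^ 44 := fun G => by
    nlinarith [sq_nonneg (cod i j G ^ 2 - ℓ ^ 22), sq_nonneg (cod i j G ^ 2),
      sq_nonneg (ℓ ^ 22)]
  have : ℓ ^ 22 * ∑ G ∈ realizations d, cod i j G ^ 2 ≤
      ℓ ^ 22 * (2 * 10 ^ 8 * ℓ ^ 22 * (realizations d).card) := by
    rw [Finset.mul_sum]
    refine (Finset.sum_le_sum fun G _ => hle G).trans ?_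
    rw [Finset.sum_add_distrib, Finset.sum_const, nsmul_eq_mul]
    have : 0 ≤ ((realizations d).card : ℝ) * ℓ ^ 44 := by positivity
    linarith [show ℓ ^ 22 * (2 * 10 ^ 8 * ℓ ^ 22 * ((realizations d).card : ℝ)) =
      2 * 10 ^ 8 * ℓ ^ 44 * (realizations d).card by ring]
  exact le_of_mul_le_mul_left this (by positivity)

lemma sum_abs_cod_cube_le (h : Rich ℓ d) {i j : V} (hij : i ≠ j) :
    ∑ G ∈ realizations d, |cod i j G| ^ 3 ≤ 3 * 10 ^ 8 * ℓ ^ 33 * (realizations d).card := by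
  have hℓ := h.pos
  have h4 := h.sum_cod_pow_four_le hij
  have h2 := h.sum_cod_sq_le hij
  have hN := h.card_pos
  have hle : ∀ G : SimpleGraph V, ℓ ^ 11 * |cod i j G| ^ 3 ≤
      cod i j G ^ 4 + ℓ ^ 22 * cod i j G ^ 2 := fun G => by
    rw [← Even.pow_abs (by decide : Even 4), ← sq_abs (cod i j G)]
    nlinarith [sq_nonneg (|cod i j G| * (|cod i j G| - ℓ ^ 11)), sq_nonneg (|cod i j G| ^ 2),
      sq_nonneg (ℓ ^ 11 * |cod i j G|)]
  have : ℓ ^ 11 * ∑ G ∈ realizations d, |cod i j G| ^ 3 ≤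
      ℓ ^ 11 * (3 * 10 ^ 8 * ℓ ^ 33 * (realizations d).card) := by
    rw [Finset.mul_sum]
    refine (Finset.sum_le_sum fun G _ => hle G).trans ?_
    rw [Finset.sum_add_distrib, ← Finset.mul_sum]
    have := mul_le_mul_of_nonneg_left h2 (by positivity : 0 ≤ ℓ ^ 22)
    linarith [show ℓ ^ 11 * (3 * 10 ^ 8 * ℓ ^ 33 * ((realizations d).card : ℝ)) =
      10 ^ 8 * ℓ ^ 44 * (realizations d).card +
        ℓ ^ 22 * (2 * 10 ^ 8 * ℓ ^ 22 * (realizations d).card) by ring]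
  exact le_of_mul_le_mul_left this (by positivity)

lemma sum_abs_cod_le (h : Rich ℓ d) {i j : V} (hij : i ≠ j) :
    ∑ G ∈ realizations d, |cod i j G| ≤ 3 * 10 ^ 8 * ℓ ^ 11 * (realizations d).card := by
  have hℓ := h.pos
  have h2 := h.sum_cod_sq_le hij
  have hN := h.card_pos
  have hle : ∀ G : SimpleGraph V, ℓ ^ 11 * |cod i j G| ≤ cod i j G ^ 2 + ℓ ^ 22 := fun G => by
    rw [← sq_abs (cod i j G)]
    nlinarith [sq_nonneg (|cod i j G| - ℓ ^ 11), sq_nonneg (cod i j G), sq_nonneg (ℓ ^ 11)]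
  have : ℓ ^ 11 * ∑ G ∈ realizations d, |cod i j G| ≤
      ℓ ^ 11 * (3 * 10 ^ 8 * ℓ ^ 11 * (realizations d).card) := by
    rw [Finset.mul_sum]
    refine (Finset.sum_le_sum fun G _ => hle G).trans ?_
    rw [Finset.sum_add_distrib, Finset.sum_const, nsmul_eq_mul]
    have : 0 ≤ ((realizations d).card : ℝ) * ℓ ^ 22 := by positivity
    linarith [show ℓ ^ 11 * (3 * 10 ^ 8 * ℓ ^ 11 * ((realizations d).card : ℝ)) =
      3 * 10 ^ 8 * ℓ ^ 22 * (realizations d).card by ring]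
  exact le_of_mul_le_mul_left this (by positivity)

/-- The mean of the degree correlation is small, as edges are nearly fair. -/
lemma abs_sum_degreeCorr_le (h : Rich ℓ d) (j : V) :
    |∑ G ∈ realizations d, degreeCorr j G| ≤ 240 * ℓ ^ 23 * (realizations d).card := by
  have hℓ := h.pos
  have hN := h.card_pos
  have e : ∑ G ∈ realizations d, degreeCorr j G =
      ∑ k, (2 * (d k : ℝ) - ((Fintype.card V : ℝ) - 1)) * ∑ G ∈ realizations d, sgn G j k := by
    unfold degreeCorr
    rw [Finset.sum_comm]
    refine Finset.sum_congr rfl fun k _ => ?_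
    rw [Finset.mul_sum]
    refine Finset.sum_congr rfl fun G hG => ?_
    rw [mem_realizations.1 hG k]
    ring
  have hterm : ∀ k, |(2 * (d k : ℝ) - ((Fintype.card V : ℝ) - 1)) *
      ∑ G ∈ realizations d, sgn G j k| ≤ 240 * ℓ ^ 3 * (realizations d).card := by
    intro k
    by_cases hjk : j = k
    · subst hjk
      simp only [sgn_self, Finset.sum_const_zero, mul_zero, abs_zero]
      positivity
    have h1 := h.abs_sum_sgn_le hjk
    rw [abs_mul]
    calc _ ≤ 4 * ℓ ^ 11 * |∑ G ∈ realizations d, sgn G j k| :=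
          mul_le_mul_of_nonneg_right (h.window k) (abs_nonneg _)
      _ = 4 * ℓ ^ 3 * (|∑ G ∈ realizations d, sgn G j k| * ℓ ^ 8) := by ring
      _ ≤ 4 * ℓ ^ 3 * (60 * (realizations d).card) := by gcongr
      _ = _ := by ring
  rw [e]
  refine (Finset.abs_sum_le_sum_abs _ _).trans ((Finset.sum_le_sum fun k _ => hterm k).trans ?_)
  rw [Finset.sum_const, Finset.card_univ, nsmul_eq_mul, h.card]
  exact le_of_eq (by ring)

/-- The mean of the signed codegree is much smaller than its standard deviation. -/
lemma abs_sum_cod_le (h : Rich ℓ d) {i j : V} (hij : i ≠ j) :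
    |∑ G ∈ realizations d, cod i j G| ≤ 400 * ℓ ^ 4 * (realizations d).card := by
  have hℓ := h.pos
  have hN := h.card_pos
  set N := ((realizations d).card : ℝ)
  set err : SimpleGraph V → ℝ := fun G => tripleCount 1 i j G - tripleCount (-1) i j G -
      (4 * ℓ ^ 40 * cod i j G - 4 * ℓ ^ 20 * degreeCorr j G) with herr
  have hsw := sum_tripleCount hij d (fun _ => 1)
  simp only [one_mul] at hsw
  have e : 4 * ℓ ^ 40 * ∑ G ∈ realizations d, cod i j G =
      4 * ℓ ^ 20 * ∑ G ∈ realizations d, degreeCorr j G - ∑ G ∈ realizations d, err G := by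
    simp only [herr, Finset.sum_sub_distrib, ← Finset.mul_sum, hsw]
    ring
  have herrsum : ∑ G ∈ realizations d, (|err G| - 64 * ℓ ^ 31 * |cod i j G|) ≤
      (1200 * ℓ ^ 44 + 1) * N := by
    refine h.sum_le (by positivity) ?_ ?_
    · intro G hG hreg
      linarith [h.abs_tripleCount_diff_sub_le hG hreg i j]
    · intro G hG
      have h1 := h.abs_tripleCount_diff_le i j G
      have h2 := h.abs_cod_le i j G
      have h3 := h.abs_degreeCorr_le hG j
      have h4 : |4 * ℓ ^ 40 * cod i j G| ≤ 4 * ℓ ^ 60 := by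
        rw [abs_mul, abs_of_pos (by positivity : (0 : ℝ) < 4 * ℓ ^ 40)]
        calc _ ≤ 4 * ℓ ^ 40 * ℓ ^ 20 := by gcongr
          _ = _ := by ring
      have h5 : |4 * ℓ ^ 20 * degreeCorr j G| ≤ 16 * ℓ ^ 51 := by
        rw [abs_mul, abs_of_pos (by positivity : (0 : ℝ) < 4 * ℓ ^ 20)]
        calc _ ≤ 4 * ℓ ^ 20 * (4 * ℓ ^ 31) := by gcongr
          _ = _ := by ring
      have h6 : 0 ≤ 64 * ℓ ^ 31 * |cod i j G| := by positivity
      have q1 := mul_pow_le_pow h.large (c := 16) (by norm_num) (show 51 < 60 by norm_num)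
      have q2 := mul_pow_le_pow h.large (c := 100) (by norm_num) (show 60 < 200 by norm_num)
      have h7 : |err G| ≤ 64 * ℓ ^ 60 + (4 * ℓ ^ 60 + 16 * ℓ ^ 51) :=
        (abs_sub _ _).trans (add_le_add h1 ((abs_sub _ _).trans (add_le_add h4 h5)))
      have h60 : 0 < ℓ ^ 60 := by positivity
      linarith
  rw [Finset.sum_sub_distrib, ← Finset.mul_sum] at herrsum
  have hcod := mul_le_mul_of_nonneg_left (h.sum_abs_cod_le hij)
    (by positivity : 0 ≤ 64 * ℓ ^ 31)
  have hcorr := mul_le_mul_of_nonneg_left (h.abs_sum_degreeCorr_le j)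
    (by positivity : 0 ≤ 4 * ℓ ^ 20)
  have q1 : 1 + 192 * 10 ^ 8 * ℓ ^ 42 + 960 * ℓ ^ 43 ≤ 300 * ℓ ^ 44 := by
    have c1 : (1 : ℝ) ≤ ℓ ^ 44 := one_le_pow₀ h.one_le
    have c2 := mul_pow_le_pow h.large (c := 10 ^ 6) (by norm_num) (show 42 < 43 by norm_num)
    have c3 := mul_pow_le_pow h.large (c := 10 ^ 6) (by norm_num) (show 43 < 44 by norm_num)
    linarith
  have hfin : ℓ ^ 40 * (4 * |∑ G ∈ realizations d, cod i j G|) ≤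
      ℓ ^ 40 * (4 * (400 * ℓ ^ 4 * N)) := by
    calc ℓ ^ 40 * (4 * |∑ G ∈ realizations d, cod i j G|)
        = |4 * ℓ ^ 40 * ∑ G ∈ realizations d, cod i j G| := by
          rw [abs_mul, abs_of_pos (by positivity : (0 : ℝ) < 4 * ℓ ^ 40)]; ring
      _ ≤ 4 * ℓ ^ 20 * |∑ G ∈ realizations d, degreeCorr j G| +
          ∑ G ∈ realizations d, |err G| := by
          rw [e]
          refine (abs_sub _ _).trans (add_le_add (le_of_eq ?_) (Finset.abs_sum_le_sum_abs _ _))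
          rw [abs_mul, abs_of_pos (by positivity : (0 : ℝ) < 4 * ℓ ^ 20)]
      _ ≤ (1200 * ℓ ^ 44 + (1 + 192 * 10 ^ 8 * ℓ ^ 42 + 960 * ℓ ^ 43)) * N := by
          linarith [show 64 * ℓ ^ 31 * (3 * 10 ^ 8 * ℓ ^ 11 * N) = 192 * 10 ^ 8 * ℓ ^ 42 * N by ring,
            show 4 * ℓ ^ 20 * (240 * ℓ ^ 23 * N) = 960 * ℓ ^ 43 * N by ring]
      _ ≤ (1200 * ℓ ^ 44 + 300 * ℓ ^ 44) * N := by gcongr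
      _ ≤ _ := by
          have : 0 ≤ ℓ ^ 44 * N := by positivity
          linarith [show ℓ ^ 40 * (4 * (400 * ℓ ^ 4 * N)) = 1600 * (ℓ ^ 44 * N) by ring]
  linarith [le_of_mul_le_mul_left hfin (by positivity)]

end Rich

end SignedGraph

namespace SignedGraph

lemma abs_log_one_sub_sub_log_one_add {x : ℝ} (hx : |x| ≤ 1 / 2) :
    |Real.log (1 - x) - Real.log (1 + x) + 2 * x| ≤ 4 * |x| ^ 3 := by
  have h1 := Real.abs_log_sub_add_sum_range_le (x := x) (by linarith) 2
  have h2 := Real.abs_log_sub_add_sum_range_le (x := -x) (by rw [abs_neg]; linarith) 2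
  rw [abs_neg, sub_neg_eq_add] at h2
  have h3 : |x| ^ (2 + 1) / (1 - |x|) ≤ 2 * |x| ^ 3 := by
    rw [div_le_iff₀ (by linarith)]
    have := mul_le_mul_of_nonneg_left (show 1 / 2 ≤ 1 - |x| by linarith)
      (by positivity : 0 ≤ 2 * |x| ^ 3)
    rw [show 2 + 1 = 3 by norm_num]
    linarith
  simp only [Finset.sum_range_succ, Finset.sum_range_zero] at h1 h2
  norm_num at h1 h2 h3
  have h1' := h1.trans h3
  have h2' := h2.trans h3
  rw [abs_le] at h1' h2' ⊢
  constructor <;> linarith [h1'.1, h1'.2, h2'.1, h2'.2]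

variable {V : Type} [Fintype V] [DecidableEq V]

lemma cod_toggle_both {i j m : V} (hij : i ≠ j) (hmi : m ≠ i) (hmj : m ≠ j) (G : SimpleGraph V) :
    cod i j (toggle m j (toggle m i G)) = cod i j G := by
  refine Finset.sum_congr rfl fun k _ => ?_
  by_cases hk : k = m
  · subst hk
    rw [sgn_comm _ i k, sgn_comm _ j k, sgn_toggle_same, sgn_toggle_of_ne _ (by grind),
      sgn_toggle_same, sgn_toggle_of_ne _ (by grind), sgn_comm G i k, sgn_comm G j k]
    ring
  · rw [sgn_toggle_of_ne _ (by grind), sgn_toggle_of_ne _ (by grind),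
      sgn_toggle_of_ne _ (by grind), sgn_toggle_of_ne _ (by grind)]

/-- Number of vertices available for moving an edge, in terms of the signed codegree. -/
lemma sum_move_weight {i j : V} (hij : i ≠ j) (G : SimpleGraph V) :
    ∑ m ∈ univ.filter (fun m => m ≠ i ∧ m ≠ j), (1 + sgn G i m) * (1 - sgn G j m) =
      (Fintype.card V : ℝ) - 2 + ∑ m, sgn G i m - ∑ m, sgn G j m - cod i j G := by
  have h1 : ∀ m, (if m ≠ i ∧ m ≠ j then (1 + sgn G i m) * (1 - sgn G j m) else 0) =
      (1 + sgn G i m - sgn G j m - sgn G i m * sgn G j m) -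
        (if m = i then 1 - sgn G j i else 0) - (if m = j then 1 + sgn G i j else 0) := by
    intro m
    by_cases hi : m = i
    · subst hi; simp [hij]
    · by_cases hj : m = j
      · subst hj; simp [hi]
      · simp [hi, hj]; ring
  rw [Finset.sum_filter, Finset.sum_congr rfl fun m _ => h1 m]
  simp only [Finset.sum_sub_distrib, Finset.sum_add_distrib, Finset.sum_ite_eq', mem_univ, if_true,
    Finset.sum_const, Finset.card_univ, nsmul_eq_mul, mul_one, cod, sgn_comm G j i]
  ring

lemma sum_cod_move {i j : V} (hij : i ≠ j) {d d' : V → ℤ}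
    (hd : d' = d - Pi.single i 1 + Pi.single j 1) (w : ℝ → ℝ) :
    ∑ G ∈ realizations d, w (cod i j G) *
        ((Fintype.card V : ℝ) + (2 * ((d i : ℝ) - d j) - 2) - cod i j G) =
      ∑ G ∈ realizations d', w (cod i j G) *
        ((Fintype.card V : ℝ) - (2 * ((d i : ℝ) - d j) - 2) - cod i j G) := by
  have hsum := Finset.sum_congr (rfl : univ.filter (fun m => m ≠ i ∧ m ≠ j) = _) fun m hm =>
    sum_move_edge hij (mem_filter.1 hm).2.1 (mem_filter.1 hm).2.2 hd
      (Φ := fun G => w (cod i j G))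
      (fun G => by rw [cod_toggle_both hij (mem_filter.1 hm).2.1 (mem_filter.1 hm).2.2])
  rw [Finset.sum_comm, Finset.sum_comm (t := realizations d')] at hsum
  have hi : (d' i : ℝ) = d i - 1 := by rw [hd]; simp [hij]
  have hj : (d' j : ℝ) = d j + 1 := by rw [hd]; simp [hij.symm]
  convert hsum using 2
  · rename_i G hG
    rw [← Finset.sum_mul, sum_move_weight hij, mem_realizations.1 hG, mem_realizations.1 hG]
    ring
  · rename_i G hG
    have h2 : ∑ m ∈ univ.filter (fun m => m ≠ i ∧ m ≠ j), (1 - sgn G i m) * (1 + sgn G j m) =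
        (Fintype.card V : ℝ) - 2 + ∑ m, sgn G j m - ∑ m, sgn G i m - cod i j G := by
      have := sum_move_weight hij.symm G
      rw [show cod j i G = cod i j G from Finset.sum_congr rfl fun k _ => mul_comm _ _] at this
      rw [← this]
      refine Finset.sum_congr (by ext m; simp [and_comm]) fun m _ => by ring
    rw [← Finset.sum_mul, h2, mem_realizations.1 hG, mem_realizations.1 hG, hi, hj]
    ring

/-- Moving one unit of degree changes the number of realizations by an explicit factor. -/
lemma Rich.abs_card_move_le {ℓ : ℝ} {i j : V} (hij : i ≠ j) {d d' : V → ℤ}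
    (hd : d' = d - Pi.single i 1 + Pi.single j 1) (h : Rich ℓ d) (h' : Rich ℓ d') :
    |ℓ ^ 20 * (((realizations d).card : ℝ) - (realizations d').card) +
      (2 * ((d i : ℝ) - d j) - 2) * (((realizations d).card : ℝ) + (realizations d').card)| * ℓ ^ 5 ≤
        4000 * (((realizations d).card : ℝ) + (realizations d').card) := by
  have hℓ := h.pos
  have hN := h.card_pos
  have hN' := h'.card_pos
  set N := ((realizations d).card : ℝ)
  set N' := ((realizations d').card : ℝ)
  set δ : ℝ := 2 * ((d i : ℝ) - d j) - 2 with hδ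
  have hδb : |δ| ≤ 9 * ℓ ^ 11 := by
    have h1 := abs_le.1 (h.window i)
    have h2 := abs_le.1 (h.window j)
    have h3 : (1 : ℝ) ≤ ℓ ^ 11 := one_le_pow₀ h.one_le
    have h4 : |(2 * (d i : ℝ) - ((Fintype.card V : ℝ) - 1)) -
        (2 * (d j : ℝ) - ((Fintype.card V : ℝ) - 1))| ≤ 8 * ℓ ^ 11 := by
      rw [abs_le]; constructor <;> linarith [h1.1, h1.2, h2.1, h2.2]
    have h5 : δ = ((2 * (d i : ℝ) - ((Fintype.card V : ℝ) - 1)) -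
        (2 * (d j : ℝ) - ((Fintype.card V : ℝ) - 1))) - 2 := by rw [hδ]; ring
    have h6 : (2 : ℝ) ≤ ℓ ^ 11 := by
      have := mul_pow_le_pow h.large (c := 2) (by norm_num) (show 0 < 11 by norm_num)
      linarith
    rw [h5]
    refine (abs_sub _ _).trans ?_
    rw [abs_of_pos (by norm_num : (0 : ℝ) < 2)]
    linarith
  set A : ℕ → ℝ := fun k => ∑ G ∈ realizations d, cod i j G ^ k with hA
  set B : ℕ → ℝ := fun k => ∑ G ∈ realizations d', cod i j G ^ k with hB
  have hrec : ∀ k, ℓ ^ 20 * (A k - B k) = -(δ * (A k + B k)) + (A (k + 1) - B (k + 1)) := by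
    intro k
    have := sum_cod_move hij hd (fun t => t ^ k)
    rw [h.card, ← hδ] at this
    have e1 : ∑ G ∈ realizations d, cod i j G ^ k * (ℓ ^ 20 + δ - cod i j G) =
        (ℓ ^ 20 + δ) * A k - A (k + 1) := by
      simp only [hA, Finset.mul_sum, ← Finset.sum_sub_distrib]
      exact Finset.sum_congr rfl fun G _ => by ring
    have e2 : ∑ G ∈ realizations d', cod i j G ^ k * (ℓ ^ 20 - δ - cod i j G) =
        (ℓ ^ 20 - δ) * B k - B (k + 1) := by
      simp only [hB, Finset.mul_sum, ← Finset.sum_sub_distrib]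
      exact Finset.sum_congr rfl fun G _ => by ring
    linarith
  have habs3 : ∀ {x : V → ℤ}, Rich ℓ x → |∑ G ∈ realizations x, cod i j G ^ 3| ≤
      3 * 10 ^ 8 * ℓ ^ 33 * (realizations x).card := fun hx => by
    refine (Finset.abs_sum_le_sum_abs _ _).trans ?_
    simp only [abs_pow]
    exact hx.sum_abs_cod_cube_le hij
  have habs2 : ∀ {x : V → ℤ}, Rich ℓ x → |∑ G ∈ realizations x, cod i j G ^ 2| ≤
      2 * 10 ^ 8 * ℓ ^ 22 * (realizations x).card := fun hx => by
    rw [abs_of_nonneg (Finset.sum_nonneg fun G _ => sq_nonneg _)]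
    exact hx.sum_cod_sq_le hij
  have habs1 : ∀ {x : V → ℤ}, Rich ℓ x → |∑ G ∈ realizations x, cod i j G ^ 1| ≤
      400 * ℓ ^ 4 * (realizations x).card := fun hx => by
    simp only [pow_one]
    exact hx.abs_sum_cod_le hij
  have hM : 0 < N + N' := by linarith
  have step : ∀ k {a b : ℝ}, |A k + B k| ≤ a → |A (k + 1) - B (k + 1)| ≤ b →
      ℓ ^ 20 * |A k - B k| ≤ 9 * ℓ ^ 11 * a + b := by
    intro k a b ha hb
    have e : ℓ ^ 20 * |A k - B k| = |ℓ ^ 20 * (A k - B k)| := by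
      rw [abs_mul, abs_of_pos (by positivity : (0 : ℝ) < ℓ ^ 20)]
    rw [e, hrec]
    refine (abs_add_le _ _).trans (add_le_add ?_ hb)
    rw [abs_neg, abs_mul]
    exact mul_le_mul hδb ha (abs_nonneg _) (by positivity)
  have s3 : |A 3 - B 3| ≤ 3 * 10 ^ 8 * ℓ ^ 33 * (N + N') :=
    (abs_sub _ _).trans (by linarith [habs3 h, habs3 h'])
  have s2' : |A 2 + B 2| ≤ 2 * 10 ^ 8 * ℓ ^ 22 * (N + N') :=
    (abs_add_le _ _).trans (by linarith [habs2 h, habs2 h'])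
  have s1' : |A 1 + B 1| ≤ 400 * ℓ ^ 4 * (N + N') :=
    (abs_add_le _ _).trans (by linarith [habs1 h, habs1 h'])
  have s2 : |A 2 - B 2| ≤ 21 * 10 ^ 8 * ℓ ^ 13 * (N + N') := by
    have := step 2 s2' s3
    refine le_of_mul_le_mul_left (this.trans (le_of_eq ?_)) (by positivity : 0 < ℓ ^ 20)
    ring
  have s1 : ℓ ^ 5 * |A 1 - B 1| ≤ 4000 * (N + N') := by
    have := step 1 s1' s2
    refine le_of_mul_le_mul_left (?_ : ℓ ^ 15 * _ ≤ ℓ ^ 15 * _) (by positivity : 0 < ℓ ^ 15)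
    have q : 21 * 10 ^ 8 * ℓ ^ 13 ≤ 400 * ℓ ^ 15 := by
      have q1 := mul_pow_le_pow h.large (c := 10 ^ 6) (by norm_num) (show 13 < 14 by norm_num)
      have q2 := mul_pow_le_pow h.large (c := 10 ^ 6) (by norm_num) (show 14 < 15 by norm_num)
      have : 0 < ℓ ^ 13 := by positivity
      linarith
    have q' := mul_le_mul_of_nonneg_right q hM.le
    linarith [show ℓ ^ 15 * (ℓ ^ 5 * |A 1 - B 1|) = ℓ ^ 20 * |A 1 - B 1| by ring,
      show 9 * ℓ ^ 11 * (400 * ℓ ^ 4 * (N + N')) + 400 * ℓ ^ 15 * (N + N') =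
        ℓ ^ 15 * (4000 * (N + N')) by ring]
  have e0 : A 0 = N := by simp [hA, N]
  have e0' : B 0 = N' := by simp [hB, N']
  have := hrec 0
  rw [e0, e0'] at this
  rw [show ℓ ^ 20 * (N - N') + δ * (N + N') = A 1 - B 1 by rw [this]; ring]
  linarith

/-- Logarithmic form of the effect of moving one unit of degree. -/
lemma Rich.abs_log_card_move_le {ℓ : ℝ} {i j : V} (hij : i ≠ j) {d d' : V → ℤ}
    (hd : d' = d - Pi.single i 1 + Pi.single j 1) (h : Rich ℓ d) (h' : Rich ℓ d') :
    |Real.log (realizations d).card - Real.log (realizations d').card +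
      2 * (2 * ((d i : ℝ) - d j) - 2) / ℓ ^ 20| * ℓ ^ 25 ≤ 10 ^ 4 := by
  have key := h.abs_card_move_le hij hd h'
  have hℓ := h.pos
  have hN := h.card_pos
  have hN' := h'.card_pos
  have hδb : |2 * ((d i : ℝ) - d j) - 2| ≤ 9 * ℓ ^ 11 := by
    have h1 := abs_le.1 (h.window i)
    have h2 := abs_le.1 (h.window j)
    have h6 : (2 : ℝ) ≤ ℓ ^ 11 := by
      have := mul_pow_le_pow h.large (c := 2) (by norm_num) (show 0 < 11 by norm_num)
      linarith
    rw [abs_le]; constructor <;> linarith [h1.1, h1.2, h2.1, h2.2]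
  set N := ((realizations d).card : ℝ)
  set N' := ((realizations d').card : ℝ)
  set δ : ℝ := 2 * ((d i : ℝ) - d j) - 2
  have hM : 0 < N + N' := by linarith
  set x := (N' - N) / (N + N') with hx
  have hxδ : |x - δ / ℓ ^ 20| * ℓ ^ 25 ≤ 4000 := by
    have e : ℓ ^ 20 * (N - N') + δ * (N + N') = -((x - δ / ℓ ^ 20) * (ℓ ^ 20 * (N + N'))) := by
      rw [hx]; field_simp; ring
    rw [e, abs_neg, abs_mul, abs_of_pos (by positivity : 0 < ℓ ^ 20 * (N + N'))] at key
    refine le_of_mul_le_mul_right ?_ hM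
    linarith [show |x - δ / ℓ ^ 20| * ℓ ^ 25 * (N + N') =
      |x - δ / ℓ ^ 20| * (ℓ ^ 20 * (N + N')) * ℓ ^ 5 by ring]
  have hx9 : |x| * ℓ ^ 9 ≤ 10 := by
    have h1 : |x| ≤ |x - δ / ℓ ^ 20| + |δ / ℓ ^ 20| := by
      have := abs_add_le (x - δ / ℓ ^ 20) (δ / ℓ ^ 20)
      rwa [sub_add_cancel] at this
    have h2 : |δ / ℓ ^ 20| * ℓ ^ 9 ≤ 9 := by
      rw [abs_div, abs_of_pos (by positivity : (0 : ℝ) < ℓ ^ 20), div_mul_eq_mul_div,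
        div_le_iff₀ (by positivity)]
      calc |δ| * ℓ ^ 9 ≤ 9 * ℓ ^ 11 * ℓ ^ 9 := by gcongr
        _ = _ := by ring
    have h3 : |x - δ / ℓ ^ 20| * ℓ ^ 9 ≤ 1 := by
      have q := mul_pow_le_pow h.large (c := 4000) (by norm_num) (show 0 < 16 by norm_num)
      refine le_of_mul_le_mul_right ?_ (by positivity : 0 < ℓ ^ 16)
      linarith [show |x - δ / ℓ ^ 20| * ℓ ^ 9 * ℓ ^ 16 = |x - δ / ℓ ^ 20| * ℓ ^ 25 by ring]
    calc |x| * ℓ ^ 9 ≤ (|x - δ / ℓ ^ 20| + |δ / ℓ ^ 20|) * ℓ ^ 9 := by gcongr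
      _ ≤ _ := by linarith
  have hx2 : |x| ≤ 1 / 2 := by
    have q := mul_pow_le_pow h.large (c := 20) (by norm_num) (show 0 < 9 by norm_num)
    rw [pow_zero, mul_one] at q
    nlinarith [abs_nonneg x]
  have hx3 : |x| ^ 3 * ℓ ^ 25 ≤ 100 := by
    have h1 : (|x| * ℓ ^ 9) ^ 3 ≤ 10 ^ 3 := pow_le_pow_left₀ (by positivity) hx9 3
    have q := mul_pow_le_pow h.large (c := 10) (by norm_num) (show 0 < 2 by norm_num)
    rw [pow_zero, mul_one] at q
    refine le_of_mul_le_mul_right ?_ (by positivity : 0 < ℓ ^ 2)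
    linarith [show |x| ^ 3 * ℓ ^ 25 * ℓ ^ 2 = (|x| * ℓ ^ 9) ^ 3 by ring]
  have hlog := abs_log_one_sub_sub_log_one_add hx2
  have e1 : Real.log (1 - x) - Real.log (1 + x) = Real.log N - Real.log N' := by
    have : 1 - x = 2 * N / (N + N') := by rw [hx]; field_simp; ring
    have h2 : 1 + x = 2 * N' / (N + N') := by rw [hx]; field_simp; ring
    rw [this, h2, Real.log_div (by positivity) hM.ne', Real.log_div (by positivity) hM.ne',
      Real.log_mul (by norm_num) hN.ne', Real.log_mul (by norm_num) hN'.ne']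
    ring
  rw [e1] at hlog
  have e2 : Real.log N - Real.log N' + 2 * δ / ℓ ^ 20 =
      (Real.log N - Real.log N' + 2 * x) - 2 * (x - δ / ℓ ^ 20) := by ring
  have h25 : 0 < ℓ ^ 25 := by positivity
  calc _ ≤ (4 * |x| ^ 3 + 2 * |x - δ / ℓ ^ 20|) * ℓ ^ 25 := by
        rw [e2]
        gcongr
        refine (abs_sub _ _).trans (add_le_add hlog (le_of_eq ?_))
        rw [abs_mul, abs_of_pos (by norm_num : (0 : ℝ) < 2)]
    _ ≤ _ := by linarith

end SignedGraph

namespace SignedGraph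

/-- The weighted mean of `f` over a finite set. -/
noncomputable def wmean {α : Type} (P : Finset α) (w f : α → ℝ) : ℝ :=
  (∑ T ∈ P, w T * f T) / ∑ T ∈ P, w T

section WMean

variable {α : Type} {P : Finset α} {w : α → ℝ}

lemma wmean_sub (f g : α → ℝ) : wmean P w (fun T => f T - g T) = wmean P w f - wmean P w g := by
  simp only [wmean, mul_sub, Finset.sum_sub_distrib, sub_div]

lemma wmean_const_mul (c : ℝ) (f : α → ℝ) : wmean P w (fun T => c * f T) = c * wmean P w f := by
  simp only [wmean, mul_left_comm _ c, ← Finset.mul_sum, mul_div_assoc]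

lemma wmean_sum {κ : Type} (s : Finset κ) (f : κ → α → ℝ) :
    wmean P w (fun T => ∑ i ∈ s, f i T) = ∑ i ∈ s, wmean P w (f i) := by
  simp only [wmean, Finset.mul_sum]
  rw [Finset.sum_comm, Finset.sum_div]

lemma wmean_const (hw : 0 < ∑ T ∈ P, w T) (c : ℝ) : wmean P w (fun _ => c) = c := by
  rw [wmean, ← Finset.sum_mul, mul_div_right_comm, div_self hw.ne', one_mul]

lemma abs_wmean_le (hw0 : ∀ T, 0 ≤ w T) (hw : 0 < ∑ T ∈ P, w T) {f : α → ℝ} {c : ℝ}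
    (hf : ∀ T ∈ P, |f T| ≤ c) : |wmean P w f| ≤ c := by
  rw [wmean, abs_div, abs_of_pos hw, div_le_iff₀ hw, Finset.mul_sum]
  refine (Finset.abs_sum_le_sum_abs _ _).trans (Finset.sum_le_sum fun T hT => ?_)
  rw [abs_mul, abs_of_nonneg (hw0 T), mul_comm]
  exact mul_le_mul_of_nonneg_right (hf T hT) (hw0 T)

lemma wmean_congr {f g : α → ℝ} (h : ∀ T ∈ P, f T = g T) : wmean P w f = wmean P w g := by
  unfold wmean
  rw [Finset.sum_congr rfl fun T hT => by rw [h T hT]]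

end WMean

lemma abs_cosh_sub_one_le {a : ℝ} (ha : |a| ≤ 1) : |Real.cosh a - 1| ≤ a ^ 2 := by
  have h1 := abs_le.1 (Real.abs_exp_sub_one_sub_id_le ha)
  have h2 := abs_le.1 (Real.abs_exp_sub_one_sub_id_le (x := -a) (by rwa [abs_neg]))
  rw [neg_sq] at h2
  rw [Real.cosh_eq, abs_le]
  constructor <;> linarith [h1.1, h1.2, h2.1, h2.2]

lemma abs_sinh_sub_self_le {a : ℝ} (ha : |a| ≤ 1) : |Real.sinh a - a| ≤ a ^ 2 := by
  have h1 := abs_le.1 (Real.abs_exp_sub_one_sub_id_le ha)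
  have h2 := abs_le.1 (Real.abs_exp_sub_one_sub_id_le (x := -a) (by rwa [abs_neg]))
  rw [neg_sq] at h2
  rw [Real.sinh_eq, abs_le]
  constructor <;> linarith [h1.1, h1.2, h2.1, h2.2]

lemma abs_tilt_diff_le {κ : Type} {U : Finset κ} {x : κ → ℝ} {ε τ : ℝ}
    (hx : ∀ i ∈ U, |x i| ≤ ε) (hτ : |τ| ≤ 1) {i j : κ}
    (hi : i ∈ U) (hj : j ∈ U) : |τ * (x i - x j)| ≤ 2 * ε := by
  rw [abs_mul]
  have : |x i - x j| ≤ 2 * ε := (abs_sub _ _).trans (by linarith [hx i hi, hx j hj])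
  calc _ ≤ 1 * (2 * ε) := mul_le_mul hτ this (abs_nonneg _) (by norm_num)
    _ = _ := one_mul _

variable {ι : Type} [DecidableEq ι]

/-- The sign indicating membership in `T`. -/
noncomputable def side (T : Finset ι) (i : ι) : ℝ := if i ∈ T then 1 else -1

lemma side_eq_or (T : Finset ι) (i : ι) : side T i = 1 ∨ side T i = -1 := by
  by_cases h : i ∈ T <;> simp [side, h]

lemma side_mul_self (T : Finset ι) (i : ι) : side T i * side T i = 1 := by
  rcases side_eq_or T i with h | h <;> simp [h]

lemma abs_side (T : Finset ι) (i : ι) : |side T i| = 1 := by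
  rcases side_eq_or T i with h | h <;> simp [h]

lemma sum_side {U T : Finset ι} (h : T ⊆ U) : ∑ i ∈ U, side T i = 2 * T.card - U.card := by
  have : ∀ i ∈ U, side T i = 2 * (if i ∈ T then 1 else 0) - 1 := fun i _ => by
    by_cases h : i ∈ T <;> simp [side, h]; norm_num
  rw [Finset.sum_congr rfl this, Finset.sum_sub_distrib, ← Finset.mul_sum, Finset.sum_ite_mem,
    Finset.inter_eq_right.2 h]
  simp

lemma side_map_swap (T : Finset ι) (i j a : ι) :
    side (T.map (Equiv.swap i j).toEmbedding) a = side T (Equiv.swap i j a) := by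
  have : a ∈ T.map (Equiv.swap i j).toEmbedding ↔ Equiv.swap i j a ∈ T := by
    rw [Finset.mem_map_equiv, Equiv.symm_swap]
  simp only [side, this]

/-- The exponential tilt of a set. -/
noncomputable def tilt (U : Finset ι) (x : ι → ℝ) (τ : ℝ) (T : Finset ι) : ℝ :=
  Real.exp (τ * ∑ i ∈ U, side T i * x i)

lemma tilt_map_swap {U : Finset ι} {i j : ι} (hij : i ≠ j) (hi : i ∈ U) (hj : j ∈ U) (x : ι → ℝ)
    (τ : ℝ) (T : Finset ι) : tilt U x τ (T.map (Equiv.swap i j).toEmbedding) =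
      tilt U x τ T * Real.exp (τ * (x i - x j) * (side T j - side T i)) := by
  have hj' : j ∈ U.erase i := Finset.mem_erase.2 ⟨hij.symm, hj⟩
  rw [tilt, tilt, ← Real.exp_add, ← Finset.add_sum_erase _ _ hi, ← Finset.add_sum_erase _ _ hj',
    ← Finset.add_sum_erase U (fun i => side T i * x i) hi,
    ← Finset.add_sum_erase _ (fun i => side T i * x i) hj']
  have : ∑ a ∈ (U.erase i).erase j, side (T.map (Equiv.swap i j).toEmbedding) a * x a =
      ∑ a ∈ (U.erase i).erase j, side T a * x a := by
    refine Finset.sum_congr rfl fun a ha => ?_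
    have h1 := Finset.ne_of_mem_erase ha
    have h2 := Finset.ne_of_mem_erase (Finset.mem_of_mem_erase ha)
    rw [side_map_swap, Equiv.swap_apply_of_ne_of_ne h2 h1]
  rw [this, side_map_swap, side_map_swap, Equiv.swap_apply_left, Equiv.swap_apply_right]
  congr 1
  ring

lemma map_swap_mem_powersetCard {U : Finset ι} {i j : ι} (hi : i ∈ U) (hj : j ∈ U) {k : ℕ}
    {T : Finset ι} (hT : T ∈ powersetCard k U) :
    T.map (Equiv.swap i j).toEmbedding ∈ powersetCard k U := by
  rw [mem_powersetCard] at hT ⊢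
  refine ⟨fun a ha => ?_, by rw [Finset.card_map]; exact hT.2⟩
  rw [Finset.mem_map_equiv, Equiv.symm_swap] at ha
  have := hT.1 ha
  by_cases h1 : a = i
  · rwa [h1]
  by_cases h2 : a = j
  · rwa [h2]
  rwa [Equiv.swap_apply_of_ne_of_ne h1 h2] at this

lemma map_swap_map_swap (i j : ι) (T : Finset ι) :
    (T.map (Equiv.swap i j).toEmbedding).map (Equiv.swap i j).toEmbedding = T := by
  ext a
  rw [Finset.mem_map_equiv, Finset.mem_map_equiv, Equiv.symm_swap, Equiv.swap_apply_self]

lemma sum_tilt_swap {U : Finset ι} {i j : ι} (hij : i ≠ j) (hi : i ∈ U) (hj : j ∈ U) (x : ι → ℝ)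
    (τ : ℝ) (k : ℕ) {f : Finset ι → ℝ} (hf : ∀ T, f (T.map (Equiv.swap i j).toEmbedding) = f T) :
    ∑ T ∈ powersetCard k U, tilt U x τ T *
      (Real.cosh (τ * (x i - x j)) * (f T * (side T i - side T j)) -
        Real.sinh (τ * (x i - x j)) * (f T * (1 - side T i * side T j))) = 0 := by
  set g : Finset ι → ℝ := fun T => tilt U x τ T *
      (Real.cosh (τ * (x i - x j)) * (f T * (side T i - side T j)) -
        Real.sinh (τ * (x i - x j)) * (f T * (1 - side T i * side T j))) with hg
  have hneg : ∀ T, g (T.map (Equiv.swap i j).toEmbedding) = -g T := by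
    intro T
    simp only [hg]
    rw [tilt_map_swap hij hi hj, hf, side_map_swap, side_map_swap, Equiv.swap_apply_left,
      Equiv.swap_apply_right]
    set a := τ * (x i - x j)
    have h1 : Real.exp (-(a * 2)) * Real.exp a = Real.exp (-a) := by
      rw [← Real.exp_add]; congr 1; ring
    have h2 : Real.exp (a * 2) * Real.exp (-a) = Real.exp a := by
      rw [← Real.exp_add]; congr 1; ring
    rw [Real.cosh_eq, Real.sinh_eq]
    rcases side_eq_or T i with hi' | hi' <;> rcases side_eq_or T j with hj' | hj' <;>
      rw [hi', hj']
    · simp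
    · norm_num
      linear_combination (-2 * tilt U x τ T * f T) * h1
    · norm_num
      linear_combination (2 * tilt U x τ T * f T) * h2
    · simp
  have hsum : ∑ T ∈ powersetCard k U, g T =
      ∑ T ∈ powersetCard k U, g (T.map (Equiv.swap i j).toEmbedding) := by
    refine Finset.sum_nbij' (fun T => T.map (Equiv.swap i j).toEmbedding)
      (fun T => T.map (Equiv.swap i j).toEmbedding) (fun T hT => map_swap_mem_powersetCard hi hj hT)
      (fun T hT => map_swap_mem_powersetCard hi hj hT) (fun T _ => map_swap_map_swap i j T)
      (fun T _ => map_swap_map_swap i j T) (fun T _ => by rw [map_swap_map_swap])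
  simp only [hneg, Finset.sum_neg_distrib] at hsum
  linarith

lemma tilt_pos (U : Finset ι) (x : ι → ℝ) (τ : ℝ) (T : Finset ι) : 0 < tilt U x τ T :=
  Real.exp_pos _

lemma sum_tilt_pos {U : Finset ι} {k : ℕ} (hk : k ≤ U.card) (x : ι → ℝ) (τ : ℝ) :
    0 < ∑ T ∈ powersetCard k U, tilt U x τ T :=
  Finset.sum_pos (fun _ _ => tilt_pos _ _ _ _) (powersetCard_nonempty.2 hk)

/-- Exchanging two coordinates determines the tilted mean of their difference. -/
lemma abs_wmean_tilt_swap_le {U : Finset ι} {k : ℕ} (hk : k ≤ U.card) {i j : ι} (hij : i ≠ j)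
    (hi : i ∈ U) (hj : j ∈ U) (x : ι → ℝ) {τ : ℝ} (ha : |τ * (x i - x j)| ≤ 1)
    {f : Finset ι → ℝ} (hf : ∀ T, f (T.map (Equiv.swap i j).toEmbedding) = f T)
    (hf1 : ∀ T, |f T| ≤ 1) :
    |wmean (powersetCard k U) (tilt U x τ) (fun T => f T * (side T i - side T j)) -
      τ * (x i - x j) * wmean (powersetCard k U) (tilt U x τ)
        (fun T => f T * (1 - side T i * side T j))| ≤ 4 * (τ * (x i - x j)) ^ 2 := by
  have hZ := sum_tilt_pos hk x τ
  set P := powersetCard k U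
  set w := tilt U x τ
  set a := τ * (x i - x j)
  set D := wmean P w (fun T => f T * (side T i - side T j)) with hD
  set Q := wmean P w (fun T => f T * (1 - side T i * side T j)) with hQ
  have hw0 : ∀ T, 0 ≤ w T := fun T => (tilt_pos _ _ _ _).le
  have hDb : |D| ≤ 2 := by
    refine abs_wmean_le hw0 hZ fun T _ => ?_
    rw [abs_mul]
    have : |side T i - side T j| ≤ 2 := (abs_sub _ _).trans (by rw [abs_side, abs_side]; norm_num)
    calc _ ≤ 1 * 2 := mul_le_mul (hf1 T) this (abs_nonneg _) (by norm_num)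
      _ = 2 := by norm_num
  have hQb : |Q| ≤ 2 := by
    refine abs_wmean_le hw0 hZ fun T _ => ?_
    rw [abs_mul]
    have : |1 - side T i * side T j| ≤ 2 :=
      (abs_sub _ _).trans (by rw [abs_mul, abs_side, abs_side]; norm_num)
    calc _ ≤ 1 * 2 := mul_le_mul (hf1 T) this (abs_nonneg _) (by norm_num)
      _ = 2 := by norm_num
  have key : Real.cosh a * D - Real.sinh a * Q = 0 := by
    rw [hD, hQ, ← wmean_const_mul, ← wmean_const_mul, ← wmean_sub, wmean,
      sum_tilt_swap hij hi hj x τ k hf, zero_div]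
  have e : D - a * Q = -(D * (Real.cosh a - 1)) + Q * (Real.sinh a - a) := by
    linear_combination key
  have h1 := abs_cosh_sub_one_le ha
  have h2 := abs_sinh_sub_self_le ha
  rw [e]
  refine (abs_add_le _ _).trans ?_
  rw [abs_neg, abs_mul, abs_mul]
  have := mul_le_mul hDb h1 (abs_nonneg _) (by norm_num)
  have := mul_le_mul hQb h2 (abs_nonneg _) (by norm_num)
  linarith

section Balanced

variable {U : Finset ι} {k : ℕ} {x : ι → ℝ} {ε y τ : ℝ}

lemma abs_wmean_side_mul_side_le (hk : k ≤ U.card) (hN : 2 ≤ U.card) (hε1 : ε ≤ 1 / 2)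
    (hx : ∀ i ∈ U, |x i| ≤ ε) (hy : 2 * (k : ℝ) - U.card = U.card * y) (hyε : |y| ≤ ε)
    (hNε : 1 ≤ U.card * ε) (hτ : |τ| ≤ 1) {i l : ι} (hi : i ∈ U) (hl : l ∈ U) (hil : i ≠ l) :
    |wmean (powersetCard k U) (tilt U x τ) (fun T => side T l * side T i)| ≤ 16 * ε := by
  have hN' : (2 : ℝ) ≤ U.card := by exact_mod_cast hN
  have hε : 0 ≤ ε := (abs_nonneg _).trans hyε
  have hZ := sum_tilt_pos hk x τ
  set P := powersetCard k U with hP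
  set w := tilt U x τ
  set N : ℝ := (U.card : ℝ)
  have hw0 : ∀ T, 0 ≤ w T := fun T => (tilt_pos _ _ _ _).le
  have hdiff : ∀ j ∈ U.erase l, |wmean P w (fun T => side T l * side T i) -
      wmean P w (fun T => side T l * side T j)| ≤ 12 * ε := by
    intro j hj
    by_cases hij : i = j
    · subst hij; rw [sub_self, abs_zero]; linarith
    have hjl := Finset.ne_of_mem_erase hj
    have hjU := Finset.mem_of_mem_erase hj
    have ha := abs_tilt_diff_le hx hτ hi hjU
    have h1 := abs_wmean_tilt_swap_le hk hij hi hjU x (τ := τ) (ha.trans (by linarith))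
      (f := fun T => side T l)
      (fun T => by rw [side_map_swap, Equiv.swap_apply_of_ne_of_ne hil.symm hjl.symm])
      (fun T => (abs_side T l).le)
    have hQ : |wmean P w (fun T => side T l * (1 - side T i * side T j))| ≤ 2 := by
      refine abs_wmean_le hw0 hZ fun T _ => ?_
      rw [abs_mul, abs_side, one_mul]
      exact (abs_sub _ _).trans (by rw [abs_mul, abs_side, abs_side]; norm_num)
    rw [← wmean_sub]
    simp only [mul_sub] at h1 hQ ⊢
    set a := τ * x i - τ * x j
    rw [show τ * (x i - x j) = a from mul_sub _ _ _] at ha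
    have h2 : |a * wmean P w (fun T => side T l * 1 - side T l * (side T i * side T j))| ≤
        2 * ε * 2 := by
      rw [abs_mul]
      exact mul_le_mul ha hQ (abs_nonneg _) (by linarith)
    have h3 : a ^ 2 ≤ 2 * ε := by
      rw [← sq_abs]
      nlinarith [abs_nonneg a]
    have h4 := abs_add_le (wmean P w (fun T => side T l * side T i - side T l * side T j) -
      a * wmean P w (fun T => side T l * 1 - side T l * (side T i * side T j)))
      (a * wmean P w (fun T => side T l * 1 - side T l * (side T i * side T j)))
    rw [sub_add_cancel] at h4
    linarith
  have hsum : ∑ j ∈ U.erase l, wmean P w (fun T => side T l * side T j) =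
      N * y * wmean P w (fun T => side T l) - 1 := by
    rw [← wmean_sum, ← wmean_const_mul, ← wmean_const hZ 1, ← wmean_sub]
    refine wmean_congr fun T hT => ?_
    obtain ⟨hTU, hTk⟩ := mem_powersetCard.1 hT
    have := sum_side hTU
    rw [hTk, hy, ← Finset.add_sum_erase _ _ hl] at this
    rw [← Finset.mul_sum, ← this]
    linear_combination (-1 : ℝ) * side_mul_self T l
  have hcard : ((U.erase l).card : ℝ) = N - 1 := by
    rw [Finset.card_erase_of_mem hl, Nat.cast_sub (by omega), Nat.cast_one]
  have htot : |(N - 1) * wmean P w (fun T => side T l * side T i) -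
      (N * y * wmean P w (fun T => side T l) - 1)| ≤ (N - 1) * (12 * ε) := by
    rw [← hsum, ← hcard, ← nsmul_eq_mul, ← Finset.sum_const, ← Finset.sum_sub_distrib,
      ← nsmul_eq_mul, ← Finset.sum_const]
    exact (Finset.abs_sum_le_sum_abs _ _).trans (Finset.sum_le_sum hdiff)
  have hs1 : |wmean P w (fun T => side T l)| ≤ 1 :=
    abs_wmean_le hw0 hZ fun T _ => (abs_side T l).le
  have hys : |y * wmean P w (fun T => side T l)| ≤ ε := by
    rw [abs_mul]
    calc _ ≤ ε * 1 := mul_le_mul hyε hs1 (abs_nonneg _) hε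
      _ = ε := mul_one _
  set q := wmean P w (fun T => side T l * side T i)
  set r := y * wmean P w (fun T => side T l)
  rw [show N * y * wmean P w (fun T => side T l) = N * r from mul_assoc _ _ _] at htot
  rw [abs_le] at htot hys ⊢
  have hN1 : 0 < N - 1 := by linarith
  have b1 : N * r ≤ N * ε := by nlinarith
  have b2 : -(N * ε) ≤ N * r := by nlinarith
  have b3 : N * ε ≤ 2 * ((N - 1) * ε) := by nlinarith
  constructor
  · refine le_of_mul_le_mul_left ?_ hN1
    linarith [htot.1]
  · refine le_of_mul_le_mul_left ?_ hN1
    linarith [htot.2]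

/-- The tilted mean of a single coordinate, to first order. -/
lemma abs_wmean_side_sub_le (hk : k ≤ U.card) (hN : 2 ≤ U.card) (hε1 : ε ≤ 1 / 2)
    (hx : ∀ i ∈ U, |x i| ≤ ε) (hy : 2 * (k : ℝ) - U.card = U.card * y) (hyε : |y| ≤ ε)
    (hNε : 1 ≤ U.card * ε) (hτ : |τ| ≤ 1) {i : ι} (hi : i ∈ U) :
    |U.card * wmean (powersetCard k U) (tilt U x τ) (fun T => side T i) -
      (U.card * y + τ * (U.card * x i - ∑ j ∈ U, x j))| ≤ U.card * (48 * ε ^ 2) := by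
  have hε : 0 ≤ ε := (abs_nonneg _).trans hyε
  have hZ := sum_tilt_pos hk x τ
  have hlen := fun j hj hij =>
    abs_wmean_side_mul_side_le hk hN hε1 hx hy hyε hNε hτ (i := j) (l := i) hj hi hij
  set P := powersetCard k U with hP
  set w := tilt U x τ
  set N : ℝ := (U.card : ℝ)
  have hdiff : ∀ j ∈ U, |wmean P w (fun T => side T i) - wmean P w (fun T => side T j) -
      τ * (x i - x j)| ≤ 48 * ε ^ 2 := by
    intro j hj
    by_cases hij : i = j
    · subst hij
      simp only [sub_self, mul_zero, abs_zero]
      positivity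
    have ha := abs_tilt_diff_le hx hτ hi hj
    have h1 := abs_wmean_tilt_swap_le hk hij hi hj x (τ := τ) (ha.trans (by linarith))
      (f := fun _ => 1) (fun _ => rfl) (fun _ => by simp)
    simp only [one_mul] at h1
    rw [wmean_sub, wmean_sub, wmean_const hZ] at h1
    have h2 := hlen j hj (Ne.symm hij)
    set q := wmean P w (fun T => side T i * side T j)
    set a := τ * (x i - x j)
    have h3 : |a * q| ≤ 2 * ε * (16 * ε) := by
      rw [abs_mul]
      exact mul_le_mul ha h2 (abs_nonneg _) (by linarith)
    have h4 : a ^ 2 ≤ (2 * ε) ^ 2 := by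
      rw [← sq_abs]
      exact pow_le_pow_left₀ (abs_nonneg _) ha 2
    have e : wmean P w (fun T => side T i) - wmean P w (fun T => side T j) - a =
        (wmean P w (fun T => side T i) - wmean P w (fun T => side T j) - a * (1 - q)) - a * q := by
      ring
    rw [e]
    refine (abs_sub _ _).trans ?_
    nlinarith
  have hsum : ∑ j ∈ U, wmean P w (fun T => side T j) = N * y := by
    rw [← wmean_sum, ← wmean_const hZ (N * y)]
    refine wmean_congr fun T hT => ?_
    obtain ⟨hTU, hTk⟩ := mem_powersetCard.1 hT
    rw [sum_side hTU, hTk, hy]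
  have e : N * wmean P w (fun T => side T i) - (N * y + τ * (N * x i - ∑ j ∈ U, x j)) =
      ∑ j ∈ U, (wmean P w (fun T => side T i) - wmean P w (fun T => side T j) -
        τ * (x i - x j)) := by
    simp only [Finset.sum_sub_distrib, ← Finset.mul_sum, hsum, Finset.sum_const, nsmul_eq_mul]
    ring
  rw [e, ← nsmul_eq_mul, ← Finset.sum_const]
  exact (Finset.abs_sum_le_sum_abs _ _).trans (Finset.sum_le_sum hdiff)

lemma hasDerivAt_log_sum_tilt (hk : k ≤ U.card) (x : ι → ℝ) (τ : ℝ) :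
    HasDerivAt (fun τ => Real.log (∑ T ∈ powersetCard k U, tilt U x τ T))
      (∑ i ∈ U, x i * wmean (powersetCard k U) (tilt U x τ) (fun T => side T i)) τ := by
  have h1 : ∀ T ∈ powersetCard k U, HasDerivAt (fun τ => tilt U x τ T)
      (tilt U x τ T * ∑ i ∈ U, x i * side T i) τ := by
    intro T _
    unfold tilt
    have := ((hasDerivAt_id τ).mul_const (∑ i ∈ U, side T i * x i)).exp
    simp only [id, one_mul] at this
    simpa only [mul_comm (x _)] using this
  have h2 := (HasDerivAt.fun_sum h1).log (sum_tilt_pos hk x τ).ne'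
  convert h2 using 1
  rw [Finset.sum_congr rfl fun i _ => (wmean_const_mul (x i) (fun T => side T i)).symm,
    ← wmean_sum]
  simp only [wmean]

/-- The partition function of a nearly balanced random subset, to second order. -/
lemma abs_log_sum_exp_side_sub_le (hk : k ≤ U.card) (hN : 2 ≤ U.card) (hε1 : ε ≤ 1 / 2)
    (hx : ∀ i ∈ U, |x i| ≤ ε) (hy : 2 * (k : ℝ) - U.card = U.card * y) (hyε : |y| ≤ ε)
    (hNε : 1 ≤ U.card * ε) :
    |Real.log (∑ T ∈ powersetCard k U, Real.exp (∑ i ∈ U, side T i * x i)) -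
      Real.log (U.card.choose k) - (y * ∑ i ∈ U, x i +
        (∑ i ∈ U, x i ^ 2 - (∑ i ∈ U, x i) ^ 2 / U.card) / 2)| ≤ 48 * U.card * ε ^ 3 := by
  have hε : 0 ≤ ε := (abs_nonneg _).trans hyε
  have hN' : (0 : ℝ) < U.card := by exact_mod_cast (by omega : 0 < U.card)
  set N : ℝ := (U.card : ℝ) with hNdef
  set X := ∑ i ∈ U, x i with hX
  set q := ∑ i ∈ U, x i ^ 2 - X ^ 2 / N with hq
  set g : ℝ → ℝ := fun τ => Real.log (∑ T ∈ powersetCard k U, tilt U x τ T) -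
    (y * X * τ + q / 2 * τ ^ 2) with hg
  have hder : ∀ τ : ℝ, HasDerivAt g
      (∑ i ∈ U, x i * wmean (powersetCard k U) (tilt U x τ) (fun T => side T i) -
        (y * X + q * τ)) τ := by
    intro τ
    have h2 : HasDerivAt (fun τ : ℝ => y * X * τ + q / 2 * τ ^ 2) (y * X + q * τ) τ := by
      refine (((hasDerivAt_id' τ).const_mul (y * X)).fun_add
        ((hasDerivAt_pow 2 τ).const_mul (q / 2))).congr_deriv ?_
      norm_num
      ring
    exact (hasDerivAt_log_sum_tilt hk x τ).fun_sub h2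
  have hbound : ∀ τ ∈ Set.Ico (0 : ℝ) 1,
      ‖∑ i ∈ U, x i * wmean (powersetCard k U) (tilt U x τ) (fun T => side T i) -
        (y * X + q * τ)‖ ≤ 48 * N * ε ^ 3 := by
    intro τ hτ
    have hτ1 : |τ| ≤ 1 := by rw [abs_of_nonneg hτ.1]; exact hτ.2.le
    have hi := fun i hi =>
      abs_wmean_side_sub_le hk hN hε1 hx hy hyε hNε hτ1 (i := i) hi
    set m : ι → ℝ := fun i => wmean (powersetCard k U) (tilt U x τ) (fun T => side T i)
    have e : ∑ i ∈ U, x i * m i - (y * X + q * τ) =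
        ∑ i ∈ U, x i * ((N * m i - (N * y + τ * (N * x i - X))) / N) := by
      have : ∀ i, x i * ((N * m i - (N * y + τ * (N * x i - X))) / N) =
          x i * m i - y * x i - τ * x i ^ 2 + τ * X / N * x i := by
        intro i; field_simp; ring
      simp only [this, Finset.sum_add_distrib, Finset.sum_sub_distrib, ← Finset.mul_sum, ← hX, hq]
      field_simp
      ring
    rw [Real.norm_eq_abs, e]
    refine (Finset.abs_sum_le_sum_abs _ _).trans ?_
    calc _ ≤ ∑ i ∈ U, ε * (48 * ε ^ 2) := by
          refine Finset.sum_le_sum fun i hiU => ?_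
          rw [abs_mul]
          refine mul_le_mul (hx i hiU) ?_ (abs_nonneg _) hε
          rw [abs_div, abs_of_pos hN', div_le_iff₀ hN']
          linarith [hi i hiU]
      _ = _ := by rw [Finset.sum_const, nsmul_eq_mul, ← hNdef]; ring
  have := norm_image_sub_le_of_norm_deriv_le_segment_01'
    (fun τ _ => (hder τ).hasDerivWithinAt) hbound
  have hg1 : g 1 = Real.log (∑ T ∈ powersetCard k U, Real.exp (∑ i ∈ U, side T i * x i)) -
      (y * X + q / 2) := by simp [hg, tilt]
  have hg0 : g 0 = Real.log (U.card.choose k) := by simp [hg, tilt]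
  rw [hg1, hg0, Real.norm_eq_abs] at this
  refine le_trans (le_of_eq ?_) this
  congr 1
  ring

end Balanced

end SignedGraph

namespace SignedGraph

variable {V : Type} [Fintype V] [DecidableEq V]

/-- The graph obtained from a graph on the vertices other than `v` by joining `v` to `T`. -/
def addVertex (v : V) (T : Finset V) (H : SimpleGraph {w // w ≠ v}) : SimpleGraph V where
  Adj a b := (∃ (ha : a ≠ v) (hb : b ≠ v), H.Adj ⟨a, ha⟩ ⟨b, hb⟩) ∨
    (a ≠ b ∧ ((a = v ∧ b ∈ T) ∨ (b = v ∧ a ∈ T)))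
  symm := ⟨by
    rintro a b (⟨ha, hb, h⟩ | ⟨hab, h⟩)
    · exact Or.inl ⟨hb, ha, h.symm⟩
    · exact Or.inr ⟨hab.symm, h.symm⟩⟩
  loopless := ⟨by
    rintro a (⟨_, _, h⟩ | ⟨h, _⟩)
    · exact H.loopless.irrefl _ h
    · exact h rfl⟩

/-- The degrees left on the other vertices once `v` is joined to `T` and removed. -/
def residual (d : V → ℤ) (v : V) (T : Finset V) (w : {w // w ≠ v}) : ℤ :=
  d w - if (w : V) ∈ T then 1 else 0

lemma card_filter_eq_add_subtype (v : V) (p : V → Prop) :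
    ((univ.filter p).card : ℤ) =
      (if p v then 1 else 0) + ((univ.filter fun b : {w // w ≠ v} => p b).card : ℤ) := by
  rw [Finset.card_filter, Finset.card_filter, Nat.cast_sum, Nat.cast_sum,
    Fintype.sum_eq_add_sum_subtype_ne _ v]
  push_cast
  rfl

lemma card_filter_nbhd_eq {d : V → ℤ} {v : V} {T : Finset V} (hv : v ∉ T)
    (hT : (T.card : ℤ) = d v) :
    ((realizations d).filter fun G => (univ.filter fun w => G.Adj v w) = T).card =
      (realizations (residual d v T)).card := by
  refine Finset.card_nbij' (fun G => G.comap Subtype.val) (addVertex v T) ?_ ?_ ?_ ?_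
  · intro G hG
    obtain ⟨hG, hGT⟩ := Finset.mem_filter.1 hG
    refine mem_realizations_iff_card.2 fun a => ?_
    have := mem_realizations_iff_card.1 hG a
    rw [card_filter_eq_add_subtype v] at this
    have hmem : (a : V) ∈ T ↔ G.Adj a v := by
      rw [← hGT, Finset.mem_filter, G.adj_comm]; simp
    simp only [residual, hmem, SimpleGraph.comap_adj]
    linarith
  · intro H hH
    have hH := mem_realizations_iff_card.1 hH
    have hN : (univ.filter fun w => (addVertex v T H).Adj v w) = T := by
      ext w
      simp only [Finset.mem_filter, Finset.mem_univ, true_and, addVertex]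
      constructor
      · rintro (⟨h, _⟩ | ⟨h1, (h | ⟨h, _⟩)⟩)
        · exact absurd rfl h
        · exact h
        · exact absurd h.symm h1
      · intro h
        exact Or.inr ⟨fun e => hv (e ▸ h), Or.inl h⟩
    refine Finset.mem_filter.2 ⟨mem_realizations_iff_card.2 fun a => ?_, hN⟩
    by_cases ha : a = v
    · subst ha
      rw [← hT, hN]
    · rw [card_filter_eq_add_subtype v]
      have h1 := hH ⟨a, ha⟩
      have h2 : (addVertex v T H).Adj a v ↔ a ∈ T := by
        simp [addVertex, ha]
      have h3 : ∀ b : {w // w ≠ v}, (addVertex v T H).Adj a b ↔ H.Adj ⟨a, ha⟩ b := by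
        intro b
        simp [addVertex, ha, b.2]
      simp only [h2, h3, h1, residual]
      ring
  · intro G hG
    obtain ⟨-, hGT⟩ := Finset.mem_filter.1 hG
    have hmem : ∀ a, a ∈ T ↔ G.Adj v a := by
      intro a
      rw [← hGT, Finset.mem_filter]; simp
    ext a b
    simp only [addVertex, SimpleGraph.comap_adj, hmem]
    constructor
    · rintro (⟨_, _, h⟩ | ⟨_, (⟨rfl, h⟩ | ⟨rfl, h⟩)⟩)
      · exact h
      · exact h
      · exact h.symm
    · intro h
      by_cases ha : a = v
      · subst ha; exact Or.inr ⟨h.ne, Or.inl ⟨rfl, h⟩⟩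
      by_cases hb : b = v
      · subst hb; exact Or.inr ⟨h.ne, Or.inr ⟨rfl, h.symm⟩⟩
      exact Or.inl ⟨ha, hb, h⟩
  · intro H _
    ext a b
    simp [addVertex, a.2, b.2]

/-- Conditioning on the neighbourhood of `v`. -/
lemma card_filter_realizations {d : V → ℤ} {v : V} {k : ℕ} (hk : (k : ℤ) = d v)
    (p : Finset V → Prop) [DecidablePred p] :
    ((realizations d).filter fun G => p (univ.filter fun w => G.Adj v w)).card =
      ∑ T ∈ (powersetCard k (univ.erase v)).filter p, (realizations (residual d v T)).card := by
  rw [Finset.card_eq_sum_card_fiberwise (f := fun G => univ.filter fun w => G.Adj v w)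
    (t := (powersetCard k (univ.erase v)).filter p)]
  · refine Finset.sum_congr rfl fun T hT => ?_
    obtain ⟨hT, hp⟩ := Finset.mem_filter.1 hT
    obtain ⟨hTv, hTk⟩ := mem_powersetCard.1 hT
    rw [← card_filter_nbhd_eq (fun h => Finset.notMem_erase _ _ (hTv h)) (by rw [hTk, hk]),
      Finset.filter_filter]
    congr 1
    refine Finset.filter_congr fun G _ => ⟨fun h => h.2, fun h => ⟨by rw [h]; exact hp, h⟩⟩
  · intro G hG
    obtain ⟨hG, hp⟩ := Finset.mem_filter.1 (Finset.mem_coe.1 hG)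
    refine Finset.mem_coe.2 (Finset.mem_filter.2 ⟨mem_powersetCard.2 ⟨fun w hw => ?_, ?_⟩, hp⟩)
    · exact Finset.mem_erase.2 ⟨((Finset.mem_filter.1 hw).2).ne', Finset.mem_univ _⟩
    · have := mem_realizations_iff_card.1 hG v
      exact_mod_cast this.trans hk.symm

/-- Splitting a set into its parts inside and outside `S`. -/
lemma sum_filter_card_inter (v : V) (S : Finset V) {k t : ℕ} (ht : t ≤ k) (f : Finset V → ℝ) :
    ∑ T ∈ (powersetCard k (univ.erase v)).filter (fun T => (S ∩ T).card = t), f T =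
      ∑ T₁ ∈ powersetCard t (S.erase v), ∑ T₂ ∈ powersetCard (k - t) (Sᶜ.erase v),
        f (T₁ ∪ T₂) := by
  rw [← Finset.sum_product']
  have hinter : ∀ T₁ ⊆ S.erase v, ∀ T₂ ⊆ Sᶜ.erase v, S ∩ (T₁ ∪ T₂) = T₁ := by
    intro T₁ h₁ T₂ h₂
    ext a
    have h₁ := @h₁ a
    have h₂ := @h₂ a
    simp only [Finset.mem_erase, Finset.mem_compl, Finset.mem_inter, Finset.mem_union] at *
    tauto
  have hsdiff : ∀ T₁ ⊆ S.erase v, ∀ T₂ ⊆ Sᶜ.erase v, (T₁ ∪ T₂) \ S = T₂ := by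
    intro T₁ h₁ T₂ h₂
    ext a
    have h₁ := @h₁ a
    have h₂ := @h₂ a
    simp only [Finset.mem_erase, Finset.mem_compl, Finset.mem_sdiff, Finset.mem_union] at *
    tauto
  have hunion : ∀ T : Finset V, S ∩ T ∪ T \ S = T := by
    intro T
    ext a
    simp only [Finset.mem_union, Finset.mem_inter, Finset.mem_sdiff]
    tauto
  refine Finset.sum_nbij' (fun T => (S ∩ T, T \ S)) (fun q => q.1 ∪ q.2) ?_ ?_ ?_ ?_ ?_
  · intro T hT
    obtain ⟨hT, hc⟩ := Finset.mem_filter.1 hT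
    obtain ⟨hTv, hTk⟩ := mem_powersetCard.1 hT
    refine Finset.mem_product.2 ⟨mem_powersetCard.2 ⟨fun a ha => ?_, hc⟩,
      mem_powersetCard.2 ⟨fun a ha => ?_, ?_⟩⟩
    · obtain ⟨h1, h2⟩ := Finset.mem_inter.1 ha
      exact Finset.mem_erase.2 ⟨Finset.ne_of_mem_erase (hTv h2), h1⟩
    · obtain ⟨h1, h2⟩ := Finset.mem_sdiff.1 ha
      exact Finset.mem_erase.2 ⟨Finset.ne_of_mem_erase (hTv h1), Finset.mem_compl.2 h2⟩
    · rw [Finset.card_sdiff, hTk, hc]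
  · intro q hq
    obtain ⟨h1, h2⟩ := Finset.mem_product.1 hq
    obtain ⟨h11, h12⟩ := mem_powersetCard.1 h1
    obtain ⟨h21, h22⟩ := mem_powersetCard.1 h2
    refine Finset.mem_filter.2 ⟨mem_powersetCard.2 ⟨?_, ?_⟩, by rw [hinter _ h11 _ h21, h12]⟩
    · exact Finset.union_subset (h11.trans (Finset.erase_subset_erase _ (Finset.subset_univ _)))
        (h21.trans (Finset.erase_subset_erase _ (Finset.subset_univ _)))
    · rw [← Finset.card_inter_add_card_sdiff _ S, Finset.inter_comm, hinter _ h11 _ h21,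
        hsdiff _ h11 _ h21, h12, h22]
      omega
  · intro T _
    exact hunion T
  · intro q hq
    obtain ⟨h1, h2⟩ := Finset.mem_product.1 hq
    exact Prod.ext (hinter _ (mem_powersetCard.1 h1).1 _ (mem_powersetCard.1 h2).1)
      (hsdiff _ (mem_powersetCard.1 h1).1 _ (mem_powersetCard.1 h2).1)
  · intro T _
    rw [hunion]

end SignedGraph

namespace SignedGraph

/-- Weights comparable on a set up to a factor give comparable conditional probabilities. -/
lemma sum_mul_sum_le_exp_mul {κ : Type} {P A : Finset κ} (hA : A ⊆ P) {f g : κ → ℝ} {c : ℝ}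
    (hf : ∀ T ∈ P, 0 < f T) (hg : ∀ T ∈ P, 0 < g T)
    (h : ∀ T ∈ P, ∀ T' ∈ P,
      (Real.log (f T) - Real.log (g T)) - (Real.log (f T') - Real.log (g T')) ≤ c) :
    (∑ T ∈ A, f T) * ∑ T ∈ P, g T ≤ Real.exp c * ((∑ T ∈ A, g T) * ∑ T ∈ P, f T) := by
  rw [Finset.sum_mul_sum, Finset.sum_mul_sum, Finset.mul_sum]
  refine Finset.sum_le_sum fun T hT => ?_
  rw [Finset.mul_sum]
  refine Finset.sum_le_sum fun T' hT' => ?_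
  have hfT := hf T (hA hT)
  have hgT := hg T (hA hT)
  have hfT' := hf T' hT'
  have hgT' := hg T' hT'
  refine (Real.log_le_log_iff (by positivity) (by positivity)).1 ?_
  rw [Real.log_mul (Real.exp_pos c).ne' (mul_pos hgT hfT').ne', Real.log_exp,
    Real.log_mul hfT.ne' hgT'.ne', Real.log_mul hgT.ne' hfT'.ne']
  linarith [h T (hA hT) T' hT']

section Oscillation

variable {ι : Type} [DecidableEq ι] {U : Finset ι} {k : ℕ}

/-- A function on `k`-subsets which moves little under exchanging one element has small
oscillation. -/
lemma abs_sub_le_card_sdiff_mul {φ : Finset ι → ℝ} {c : ℝ}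
    (h : ∀ T ∈ powersetCard k U, ∀ a ∈ T, ∀ b ∈ U, b ∉ T →
      |φ T - φ (insert b (T.erase a))| ≤ c)
    {T T' : Finset ι} (hT : T ∈ powersetCard k U) (hT' : T' ∈ powersetCard k U) :
    |φ T - φ T'| ≤ (T \ T').card * c := by
  induction hm : (T \ T').card generalizing T with
  | zero =>
    have hsub : T ⊆ T' := Finset.sdiff_eq_empty_iff_subset.1 (Finset.card_eq_zero.1 hm)
    have : T = T' := Finset.eq_of_subset_of_card_le hsub
      (by rw [(mem_powersetCard.1 hT).2, (mem_powersetCard.1 hT').2])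
    simp [this]
  | succ m ih =>
    obtain ⟨hTU, hTk⟩ := mem_powersetCard.1 hT
    obtain ⟨hTU', hTk'⟩ := mem_powersetCard.1 hT'
    obtain ⟨a, ha⟩ := Finset.card_pos.1 (by omega : 0 < (T \ T').card)
    have hcard : (T' \ T).card = (T \ T').card :=
      Finset.card_sdiff_comm (by rw [hTk, hTk'])
    obtain ⟨b, hb⟩ := Finset.card_pos.1 (by omega : 0 < (T' \ T).card)
    obtain ⟨haT, haT'⟩ := Finset.mem_sdiff.1 ha
    obtain ⟨hbT', hbT⟩ := Finset.mem_sdiff.1 hb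
    have hmem : insert b (T.erase a) ∈ powersetCard k U := by
      refine mem_powersetCard.2 ⟨?_, ?_⟩
      · exact Finset.insert_subset (hTU' hbT') ((Finset.erase_subset _ _).trans hTU)
      · rw [Finset.card_insert_of_notMem fun h => hbT (Finset.mem_of_mem_erase h),
          Finset.card_erase_add_one haT, hTk]
    have hsd : insert b (T.erase a) \ T' = (T \ T').erase a := by
      rw [Finset.insert_sdiff_of_mem _ hbT', Finset.erase_sdiff_comm]
    have h1 := ih hmem (by rw [hsd, Finset.card_erase_of_mem ha, hm]; rfl)
    have h2 := h T hT a haT b (hTU' hbT') hbT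
    have := abs_sub_le (φ T) (φ (insert b (T.erase a))) (φ T')
    push_cast
    linarith

end Oscillation

section Exchange

variable {V : Type} [DecidableEq V] {d : V → ℤ} {v : V}

lemma residual_exchange {T : Finset V} {a b : V} (haT : a ∈ T) (hbT : b ∉ T) (ha : a ≠ v)
    (hb : b ≠ v) :
    residual d v (insert b (T.erase a)) =
      residual d v T - Pi.single ⟨b, hb⟩ 1 + Pi.single ⟨a, ha⟩ 1 := by
  have hab : a ≠ b := fun h => hbT (h ▸ haT)
  funext w
  obtain ⟨w, hw⟩ := w
  rw [Pi.add_apply, Pi.sub_apply]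
  by_cases h1 : w = a
  · subst h1
    simp [residual, haT, hab]
  by_cases h2 : w = b
  · subst h2
    simp [residual, hbT, h1]
  simp [residual, h1, h2]

lemma sum_side_exchange {U T : Finset V} {a b : V} (haT : a ∈ T) (hbT : b ∉ T) (ha : a ∈ U)
    (hb : b ∈ U) (x : V → ℝ) :
    ∑ w ∈ U, side T w * x w - ∑ w ∈ U, side (insert b (T.erase a)) w * x w =
      2 * (x a - x b) := by
  have hab : b ≠ a := fun h => hbT (h ▸ haT)
  rw [← Finset.add_sum_erase _ _ ha, ← Finset.add_sum_erase _ _ ha,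
    ← Finset.add_sum_erase _ _ (Finset.mem_erase.2 ⟨hab, hb⟩),
    ← Finset.add_sum_erase _ _ (Finset.mem_erase.2 ⟨hab, hb⟩)]
  have hrest : ∑ w ∈ (U.erase a).erase b, side (insert b (T.erase a)) w * x w =
      ∑ w ∈ (U.erase a).erase b, side T w * x w := by
    refine Finset.sum_congr rfl fun w hw => ?_
    obtain ⟨h1, h2⟩ := Finset.mem_erase.1 hw
    simp [side, h1, Finset.ne_of_mem_erase h2]
  rw [hrest]
  simp [side, haT, hbT, hab.symm]
  ring

end Exchange

variable {V : Type} [Fintype V] [DecidableEq V] {ℓ : ℝ} {d : V → ℤ} {v : V}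

lemma card_subtype_ne (v : V) : (Fintype.card {w // w ≠ v} : ℝ) = (Fintype.card V : ℝ) - 1 := by
  rw [Fintype.card_subtype_compl, Fintype.card_subtype_eq,
    Nat.cast_sub (Fintype.card_pos_iff.2 ⟨v⟩), Nat.cast_one]

lemma sum_residual {T : Finset V} (hv : v ∉ T) :
    ∑ w, residual d v T w = ∑ w, d w - d v - T.card := by
  have h1 := Fintype.sum_eq_add_sum_subtype_ne d v
  have h2 := Fintype.sum_eq_add_sum_subtype_ne (fun w => if w ∈ T then (1 : ℤ) else 0) v
  rw [if_neg hv, Finset.sum_boole, Finset.filter_mem_eq_inter, Finset.univ_inter] at h2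
  simp only [residual, Finset.sum_sub_distrib]
  linarith

/-- The relative excess of the degree of `w`. -/
noncomputable def excess (d : V → ℤ) (w : V) : ℝ :=
  (2 * (d w : ℝ) - ((Fintype.card V : ℝ) - 1)) / ((Fintype.card V : ℝ) - 1)

lemma rich_residual (hℓ : 10 ^ 6 ≤ ℓ) (hn : (Fintype.card V : ℝ) - 1 = ℓ ^ 20)
    (heven : Even (∑ w, d w)) (hw : ∀ a, |2 * (d a : ℝ) - ((Fintype.card V : ℝ) - 1)| ≤ ℓ ^ 11)
    {T : Finset V} (hv : v ∉ T) (hT : (T.card : ℤ) = d v) : Rich ℓ (residual d v T) := by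
  refine rich_of_window hℓ (by rw [card_subtype_ne, hn]) ?_ fun a => ?_
  · rw [sum_residual hv, hT, sub_sub, ← two_mul]
    exact heven.sub (even_two_mul _)
  · rw [card_subtype_ne]
    have h1 : (1 : ℝ) ≤ ℓ ^ 11 := one_le_pow₀ (by linarith)
    have := abs_le.1 (hw a)
    rw [abs_le]
    by_cases ha : (a : V) ∈ T <;> simp only [residual, ha, if_true, if_false] <;> push_cast <;>
      constructor <;> linarith [this.1, this.2]

/-- Up to a small error, conditioning on the neighbourhood of `v` is an exponential tilt. -/
lemma abs_log_card_residual_sub_le (hℓ : 10 ^ 6 ≤ ℓ) (hn : (Fintype.card V : ℝ) - 1 = ℓ ^ 20)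
    (heven : Even (∑ w, d w)) (hw : ∀ a, |2 * (d a : ℝ) - ((Fintype.card V : ℝ) - 1)| ≤ ℓ ^ 11)
    {k : ℕ} (hk : (k : ℤ) = d v) {T T' : Finset V} (hT : T ∈ powersetCard k (univ.erase v))
    (hT' : T' ∈ powersetCard k (univ.erase v)) :
    |(Real.log (realizations (residual d v T)).card -
        ∑ w ∈ univ.erase v, side T w * excess d w) -
      (Real.log (realizations (residual d v T')).card -
        ∑ w ∈ univ.erase v, side T' w * excess d w)| * ℓ ^ 5 ≤ 10 ^ 4 := by
  have h0 : 0 < ℓ := by linarith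
  have hrich : ∀ T ∈ powersetCard k (univ.erase v), Rich ℓ (residual d v T) := by
    intro T hT
    obtain ⟨hTv, hTk⟩ := mem_powersetCard.1 hT
    exact rich_residual hℓ hn heven hw (fun h => Finset.notMem_erase _ _ (hTv h))
      (by rw [hTk, hk])
  have key := abs_sub_le_card_sdiff_mul (c := 10 ^ 4 / ℓ ^ 25) (φ := fun T =>
    Real.log (realizations (residual d v T)).card - ∑ w ∈ univ.erase v, side T w * excess d w)
    ?_ hT hT'
  · have hcard : ((T \ T').card : ℝ) ≤ ℓ ^ 20 := by
      rw [← hn, ← card_subtype_ne v, Fintype.card_subtype_compl, Fintype.card_subtype_eq]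
      refine Nat.cast_le.2 ((Finset.card_le_card (Finset.sdiff_subset.trans
        (mem_powersetCard.1 hT).1)).trans ?_)
      rw [Finset.card_erase_of_mem (Finset.mem_univ _), Finset.card_univ]
    calc _ ≤ ((T \ T').card : ℝ) * (10 ^ 4 / ℓ ^ 25) * ℓ ^ 5 :=
          mul_le_mul_of_nonneg_right key (by positivity)
      _ ≤ ℓ ^ 20 * (10 ^ 4 / ℓ ^ 25) * ℓ ^ 5 := by gcongr
      _ = 10 ^ 4 := by field_simp
  · intro T hT a haT b hbU hbT
    obtain ⟨hTv, hTk⟩ := mem_powersetCard.1 hT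
    have haU := hTv haT
    have ha := Finset.ne_of_mem_erase haU
    have hb := Finset.ne_of_mem_erase hbU
    have hab : b ≠ a := fun h => hbT (h ▸ haT)
    have hmem : insert b (T.erase a) ∈ powersetCard k (univ.erase v) := by
      refine mem_powersetCard.2 ⟨?_, ?_⟩
      · exact Finset.insert_subset hbU ((Finset.erase_subset _ _).trans hTv)
      · rw [Finset.card_insert_of_notMem fun h => hbT (Finset.mem_of_mem_erase h),
          Finset.card_erase_add_one haT, hTk]
    have hmove := Rich.abs_log_card_move_le (i := ⟨b, hb⟩) (j := ⟨a, ha⟩)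
      (fun h => hab (congrArg Subtype.val h)) (residual_exchange haT hbT ha hb) (hrich T hT)
      (hrich _ hmem)
    have hx := sum_side_exchange haT hbT haU hbU (excess d)
    rw [le_div_iff₀ (by positivity)]
    refine le_trans (le_of_eq ?_) hmove
    congr 2
    have e : 2 * (excess d a - excess d b) =
        -(2 * (2 * ((residual d v T ⟨b, hb⟩ : ℝ) - residual d v T ⟨a, ha⟩) - 2) / ℓ ^ 20) := by
      simp only [excess, residual, haT, hbT, if_true, if_false, hn]
      push_cast
      field_simp
      ring
    linear_combination (-1 : ℝ) * hx - e

end SignedGraph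

namespace SignedGraph

/-- The exponent of the partition function, in two normalizations. -/
lemma abs_exponent_sub_le {n N s b B : ℝ} (hN : 1 ≤ N) (hn : n = N + 1) (hb : |b| ≤ B)
    (hs : |s| ≤ N * B) :
    |(b * s / N - s ^ 2 / (2 * N ^ 2)) +
      1 / (2 * n ^ 2) * (b + s) * ((b + s) - 2 * n * b)| * N ≤ 4 * B ^ 2 := by
  have hB : 0 ≤ B := (abs_nonneg b).trans hb
  have hN0 : 0 < N := by linarith
  have hn0 : 0 < n := by linarith
  obtain ⟨r, rfl⟩ : ∃ r, s = N * r := ⟨s / N, by field_simp⟩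
  have hr : |r| ≤ B := by
    rw [abs_mul, abs_of_pos hN0] at hs
    exact le_of_mul_le_mul_left hs hN0
  have e : (b * (N * r) / N - (N * r) ^ 2 / (2 * N ^ 2)) +
      1 / (2 * n ^ 2) * (b + N * r) * ((b + N * r) - 2 * n * b) =
      (b * r * (2 * n + 2 * N) - b ^ 2 * (2 * n - 1) - r ^ 2 * (n + N)) / (2 * n ^ 2) := by
    subst hn
    field_simp
    ring
  have h1 : |b * r * (2 * n + 2 * N)| ≤ B ^ 2 * (4 * n) := by
    rw [abs_mul, abs_mul, abs_of_pos (by linarith : 0 < 2 * n + 2 * N), sq]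
    exact mul_le_mul (mul_le_mul hb hr (abs_nonneg _) hB) (by linarith) (by linarith)
      (mul_nonneg hB hB)
  have h2 : |b ^ 2 * (2 * n - 1)| ≤ B ^ 2 * (2 * n) := by
    rw [abs_mul, abs_pow, abs_of_pos (by linarith : 0 < 2 * n - 1)]
    exact mul_le_mul (pow_le_pow_left₀ (abs_nonneg _) hb 2) (by linarith) (by linarith)
      (sq_nonneg B)
  have h3 : |r ^ 2 * (n + N)| ≤ B ^ 2 * (2 * n) := by
    rw [abs_mul, abs_pow, abs_of_pos (by linarith : 0 < n + N)]
    exact mul_le_mul (pow_le_pow_left₀ (abs_nonneg _) hr 2) (by linarith) (by linarith)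
      (sq_nonneg B)
  have h4 : |b * r * (2 * n + 2 * N) - b ^ 2 * (2 * n - 1) - r ^ 2 * (n + N)| ≤
      B ^ 2 * (8 * n) := by
    refine (abs_sub _ _).trans ?_
    linarith [abs_sub (b * r * (2 * n + 2 * N)) (b ^ 2 * (2 * n - 1))]
  rw [e, abs_div, abs_of_pos (by positivity : 0 < 2 * n ^ 2), div_mul_eq_mul_div,
    div_le_iff₀ (by positivity)]
  calc _ ≤ B ^ 2 * (8 * n) * n := mul_le_mul h4 (by linarith) hN0.le (by positivity)
    _ = _ := by ring

lemma degSeqGraphs_eq_realizations (n : ℕ) (d : Fin n → ℕ) :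
    degSeqGraphs n d = realizations fun w => (d w : ℤ) := by
  ext G
  rw [mem_realizations_iff_card]
  rw [degSeqGraphs, Finset.mem_filter]
  simp only [Finset.mem_univ, true_and, degIn, Nat.cast_inj]

/-- The degrees of a vertex into a set, counted by neighbourhoods. -/
lemma card_filter_degIn (n : ℕ) (d : Fin n → ℕ) (v : Fin n) (S : Finset (Fin n)) (t : ℕ) :
    ((degSeqGraphs n d).filter fun G => degIn G S v = t).card =
      ∑ T ∈ (powersetCard (d v) (univ.erase v)).filter (fun T => (S ∩ T).card = t),
        (realizations (residual (fun w => (d w : ℤ)) v T)).card := by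
  have := card_filter_realizations (d := fun w => (d w : ℤ)) (v := v) (k := d v) rfl
    fun T => (S ∩ T).card = t
  rw [← this, degSeqGraphs_eq_realizations]
  congr 1
  refine Finset.filter_congr fun G _ => ?_
  rw [degIn]
  have : (S.filter fun w => G.Adj v w) = S ∩ univ.filter fun w => G.Adj v w := by
    ext w; simp
  rw [this]

lemma card_degSeqGraphs (n : ℕ) (d : Fin n → ℕ) (v : Fin n) :
    (degSeqGraphs n d).card = ∑ T ∈ powersetCard (d v) (univ.erase v),
      (realizations (residual (fun w => (d w : ℤ)) v T)).card := by
  have := card_filter_realizations (d := fun w => (d w : ℤ)) (v := v) (k := d v) rfl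
    fun _ => True
  rw [Finset.filter_true, Finset.filter_true] at this
  rw [degSeqGraphs_eq_realizations, this]

lemma beta_div_sqrt {n : ℕ} (hn : 2 ≤ n) (d : Fin n → ℕ) (w : Fin n) :
    beta n d w / Real.sqrt ((n : ℝ) - 1) = excess (fun w => (d w : ℤ)) w := by
  have h : (0 : ℝ) ≤ (n : ℝ) - 1 := by
    have : (2 : ℝ) ≤ n := by exact_mod_cast hn
    linarith
  rw [beta, div_div, Real.mul_self_sqrt h, excess, Fintype.card_fin, Int.cast_natCast]

lemma neg_LamT {n : ℕ} (hn : 2 ≤ n) (d : Fin n → ℕ) (v : Fin n) (T : Finset (Fin n)) :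
    -LamT n d v T = ∑ w ∈ univ.erase v, side T w * excess (fun w => (d w : ℤ)) w := by
  rw [LamT, ← Finset.sum_neg_distrib]
  refine Finset.sum_congr rfl fun w _ => ?_
  rw [← beta_div_sqrt hn]
  by_cases h : w ∈ T <;> simp [side, h, neg_div]

lemma card_powersetCard_erase {n : ℕ} (S : Finset (Fin n)) (v : Fin n) (t : ℕ) :
    (powersetCard t (S.erase v)).card = (S.card - (if v ∈ S then 1 else 0)).choose t := by
  rw [Finset.card_powersetCard]
  by_cases h : v ∈ S
  · rw [Finset.card_erase_of_mem h, if_pos h]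
  · rw [Finset.erase_eq_of_notMem h, if_neg h, Nat.sub_zero]

lemma card_powersetCard_compl_erase {n : ℕ} (S : Finset (Fin n)) (v : Fin n) (t : ℕ) :
    (powersetCard t (Sᶜ.erase v)).card =
      (n - S.card - (if v ∉ S then 1 else 0)).choose t := by
  rw [card_powersetCard_erase, Finset.card_compl, Fintype.card_fin]
  simp only [Finset.mem_compl]

section Estimate

variable {n : ℕ} {d : Fin n → ℕ} {ℓ : ℝ}

lemma abs_window_le (hn : (n : ℝ) - 1 = ℓ ^ 20) (hℓ : 10 ^ 6 ≤ ℓ)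
    (hβ : ∀ w, |beta n d w| ≤ ℓ) (w : Fin n) :
    |2 * (d w : ℝ) - ((n : ℝ) - 1)| ≤ ℓ ^ 11 := by
  have h0 : 0 < ℓ := by linarith
  have hs : Real.sqrt ((n : ℝ) - 1) = ℓ ^ 10 := by
    rw [hn, show ℓ ^ 20 = (ℓ ^ 10) ^ 2 by ring, Real.sqrt_sq (by positivity)]
  have := hβ w
  rw [beta, hs, abs_div, abs_of_pos (by positivity : 0 < ℓ ^ 10), div_le_iff₀ (by positivity)]
    at this
  exact this.trans (le_of_eq (by ring))

/-- The partition function of the tilted neighbourhood. -/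
lemma abs_log_sum_exp_neg_LamT_le (hn : (n : ℝ) - 1 = ℓ ^ 20) (hℓ : 10 ^ 6 ≤ ℓ)
    (hβ : ∀ w, |beta n d w| ≤ ℓ) (v : Fin n) (hd : d v ≤ n - 1) :
    |Real.log (∑ T ∈ powersetCard (d v) (univ.erase v), Real.exp (-LamT n d v T)) -
      Real.log ((n - 1).choose (d v)) + (Lam1 n d v - Lam3 n d v)| * ℓ ^ 7 ≤ 49 := by
  have h0 : 0 < ℓ := by linarith
  have hN1 : (1 : ℝ) ≤ ℓ ^ 20 := one_le_pow₀ (by linarith)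
  have hn2 : 2 ≤ n := by
    have : (2 : ℝ) ≤ n := by linarith
    exact_mod_cast this
  have hs : Real.sqrt ((n : ℝ) - 1) = ℓ ^ 10 := by
    rw [hn, show ℓ ^ 20 = (ℓ ^ 10) ^ 2 by ring, Real.sqrt_sq (by positivity)]
  have hcard : (univ.erase v).card = n - 1 := by
    rw [Finset.card_erase_of_mem (Finset.mem_univ _), Finset.card_univ, Fintype.card_fin]
  have hcast : ((n - 1 : ℕ) : ℝ) = ℓ ^ 20 := by rw [Nat.cast_sub (by omega), Nat.cast_one, hn]
  have hcardR : ((univ.erase v).card : ℝ) = ℓ ^ 20 := by rw [hcard, hcast]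
  set x := excess fun w => (d w : ℤ) with hx
  have hxβ : ∀ w, x w = beta n d w / ℓ ^ 10 := fun w => by rw [hx, ← beta_div_sqrt hn2, hs]
  have hxε : ∀ w, |x w| ≤ (1 / ℓ ^ 9 : ℝ) := by
    intro w
    rw [hxβ, abs_div, abs_of_pos (by positivity : 0 < ℓ ^ 10),
      div_le_div_iff₀ (by positivity) (by positivity)]
    calc _ ≤ ℓ * ℓ ^ 9 := mul_le_mul_of_nonneg_right (hβ w) (by positivity)
      _ = _ := by ring
  have hmain := abs_log_sum_exp_side_sub_le (U := univ.erase v) (k := d v) (x := x)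
    (ε := 1 / ℓ ^ 9) (y := x v) (by omega) (by
      have : (2 : ℝ) ≤ ((univ.erase v).card : ℝ) := by
        rw [hcardR]
        exact le_trans (by linarith) (le_self_pow₀ (by linarith : 1 ≤ ℓ) (by norm_num : 20 ≠ 0))
      exact_mod_cast this) (by
      rw [div_le_div_iff₀ (by positivity) (by norm_num)]
      have := le_self_pow₀ (by linarith : 1 ≤ ℓ) (by norm_num : 9 ≠ 0)
      linarith) (fun i _ => hxε i) (by
      rw [hcardR, hx, excess, Fintype.card_fin, hn, Int.cast_natCast]
      field_simp) (hxε v) (by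
      rw [hcardR, mul_one_div, le_div_iff₀ (by positivity), one_mul]
      exact pow_le_pow_right₀ (by linarith) (by norm_num))
  simp only [← neg_LamT hn2 d v, hcard, hcast, hx] at hmain
  rw [← hx] at hmain
  set s := ∑ i ∈ univ.erase v, beta n d i with hsdef
  have hsum : ∑ i, beta n d i = beta n d v + s := (Finset.add_sum_erase _ _ (mem_univ v)).symm
  have hsb : |s| ≤ ℓ ^ 20 * ℓ := by
    rw [← hcardR, ← nsmul_eq_mul, ← Finset.sum_const]
    exact (Finset.abs_sum_le_sum_abs _ _).trans (Finset.sum_le_sum fun i _ => hβ i)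
  have hexp := abs_exponent_sub_le hN1 (n := n) (by linarith) (hβ v) hsb
  have e1 : ∑ i ∈ univ.erase v, x i = s / ℓ ^ 10 := by
    rw [hsdef, Finset.sum_div]
    exact Finset.sum_congr rfl fun i _ => hxβ i
  have e2 : (∑ i ∈ univ.erase v, x i ^ 2) / 2 = Lam3 n d v := by
    rw [Lam3, hn, Finset.sum_div, Finset.mul_sum]
    refine Finset.sum_congr rfl fun i _ => ?_
    rw [hxβ]
    field_simp
  have e3 : Lam1 n d v = 1 / (2 * (n : ℝ) ^ 2) * (beta n d v + s) *
      ((beta n d v + s) - 2 * n * beta n d v) := by rw [Lam1, hsum]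
  rw [← e3] at hexp
  rw [e1, hxβ v, sub_div, e2] at hmain
  set Z := Real.log (∑ T ∈ powersetCard (d v) (univ.erase v), Real.exp (-LamT n d v T)) -
      Real.log ((n - 1).choose (d v))
  set b := beta n d v
  have e4 : b / ℓ ^ 10 * (s / ℓ ^ 10) + (Lam3 n d v - (s / ℓ ^ 10) ^ 2 / ℓ ^ 20 / 2) =
      (b * s / ℓ ^ 20 - s ^ 2 / (2 * (ℓ ^ 20) ^ 2)) + Lam3 n d v := by
    field_simp
    ring
  rw [e4] at hmain
  set W := b * s / ℓ ^ 20 - s ^ 2 / (2 * (ℓ ^ 20) ^ 2)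
  have e5 : Z + (Lam1 n d v - Lam3 n d v) =
      (Z - (W + Lam3 n d v)) + (W + Lam1 n d v) := by ring
  have h1 : |Z - (W + Lam3 n d v)| * ℓ ^ 7 ≤ 48 := by
    calc _ ≤ 48 * ℓ ^ 20 * (1 / ℓ ^ 9) ^ 3 * ℓ ^ 7 :=
          mul_le_mul_of_nonneg_right hmain (by positivity)
      _ = 48 := by field_simp
  have h2 : |W + Lam1 n d v| * ℓ ^ 7 ≤ 1 := by
    refine le_of_mul_le_mul_right ?_ (by positivity : 0 < ℓ ^ 13)
    calc _ = |W + Lam1 n d v| * ℓ ^ 20 := by ring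
      _ ≤ 4 * ℓ ^ 2 := hexp
      _ ≤ 1 * ℓ ^ 13 := by
        rw [one_mul]
        exact mul_pow_le_pow hℓ (by norm_num) (by norm_num)
  rw [e5]
  calc _ ≤ (|Z - (W + Lam3 n d v)| + |W + Lam1 n d v|) * ℓ ^ 7 :=
        mul_le_mul_of_nonneg_right (abs_add_le _ _) (by positivity)
    _ ≤ 49 := by linarith

end Estimate

lemma exists_pow_twenty_eq {x : ℝ} (hx : (10 ^ 6 : ℝ) ^ 20 ≤ x) :
    ∃ ℓ : ℝ, 10 ^ 6 ≤ ℓ ∧ x = ℓ ^ 20 := by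
  have hx0 : 0 ≤ x := le_trans (by positivity) hx
  have h : (x ^ ((20 : ℕ) : ℝ)⁻¹) ^ 20 = x := Real.rpow_inv_natCast_pow hx0 (by norm_num)
  refine ⟨x ^ ((20 : ℕ) : ℝ)⁻¹, ?_, h.symm⟩
  refine le_of_not_gt fun hlt => ?_
  have := pow_lt_pow_left₀ hlt (Real.rpow_nonneg hx0 _) (by norm_num : 20 ≠ 0)
  rw [h] at this
  linarith

lemma log_le_of_sub_one_eq_pow {n ℓ : ℝ} (hℓ : 10 ^ 6 ≤ ℓ) (hn : n - 1 = ℓ ^ 20) :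
    Real.log n ≤ ℓ := by
  have h0 : 0 < ℓ := by linarith
  have h1 : (1 : ℝ) ≤ ℓ ^ 20 := one_le_pow₀ (by linarith)
  have h2 : n ≤ ℓ ^ 21 := by
    have : ℓ ^ 21 = ℓ * ℓ ^ 20 := by ring
    nlinarith
  have h3 : Real.log n ≤ 21 * Real.log ℓ := by
    have := Real.log_le_log (by linarith) h2
    rwa [Real.log_pow] at this
  have h4 : Real.log ℓ = 2 * Real.log (Real.sqrt ℓ) := by rw [Real.log_sqrt h0.le]; ring
  have h5 : Real.log (Real.sqrt ℓ) ≤ Real.sqrt ℓ :=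
    (Real.log_le_sub_one_of_pos (Real.sqrt_pos.2 h0)).trans (by linarith)
  have h6 : (1000 : ℝ) ≤ Real.sqrt ℓ := Real.le_sqrt_of_sq_le (by linarith)
  nlinarith [Real.sq_sqrt h0.le]

lemma one_div_pow_le_rpow {n ℓ : ℝ} (hℓ : 10 ^ 6 ≤ ℓ) (hn : n - 1 = ℓ ^ 20) :
    1 / ℓ ^ 5 ≤ n ^ (-(1 : ℝ) / 6) := by
  have h0 : 0 < ℓ := by linarith
  have h1 : (1 : ℝ) ≤ ℓ ^ 20 := one_le_pow₀ (by linarith)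
  have h2 : n ≤ (ℓ ^ 5) ^ (6 : ℝ) := by
    have e1 : (ℓ ^ 5) ^ (6 : ℝ) = ℓ ^ 30 := by
      rw [show (6 : ℝ) = ((6 : ℕ) : ℝ) by norm_num, Real.rpow_natCast, ← pow_mul]
    have e2 : ℓ ^ 30 = ℓ ^ 10 * ℓ ^ 20 := by ring
    have h3 : (10 ^ 6) ^ 10 ≤ ℓ ^ 10 := pow_le_pow_left₀ (by norm_num) hℓ 10
    rw [e1, e2]
    nlinarith
  have h3 : n ^ ((1 : ℝ) / 6) ≤ ℓ ^ 5 := by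
    have := Real.rpow_le_rpow (by linarith) h2 (by norm_num : (0 : ℝ) ≤ 1 / 6)
    rwa [← Real.rpow_mul (by positivity), show (6 : ℝ) * (1 / 6) = 1 by norm_num,
      Real.rpow_one] at this
  rw [neg_div, Real.rpow_neg (by linarith), ← one_div]
  exact one_div_le_one_div_of_le (Real.rpow_pos_of_pos (by linarith) _) h3

/-- Comparison of a conditional probability with its tilted model. -/
lemma exists_relative_error {ℓ FA FP GA GP C c₁ c₂ Λ : ℝ} (hℓ : 10 ^ 6 ≤ ℓ) (hFA : 0 < FA)
    (hFP : 0 < FP) (hGA : 0 < GA) (hGP : 0 < GP) (hC : 0 < C) (hc : c₁ * c₂ ≠ 0)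
    (hup : FA * GP ≤ Real.exp (10 ^ 4 / ℓ ^ 5) * (GA * FP))
    (hlow : GA * FP ≤ Real.exp (10 ^ 4 / ℓ ^ 5) * (FA * GP))
    (hZ : |Real.log GP - Real.log C + Λ| * ℓ ^ 7 ≤ 49) :
    ∃ θ : ℝ, |θ| ≤ 40000 / ℓ ^ 5 ∧
      FA / FP = (1 + θ) * (c₁ * c₂ / C) * Real.exp Λ * (GA / (c₁ * c₂)) := by
  have h0 : 0 < ℓ := by linarith
  set z := Real.log FA - Real.log FP - (Real.log GA - Real.log C + Λ) with hz
  have hzexp : Real.exp z = FA / FP / (GA / C * Real.exp Λ) := by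
    rw [hz, Real.exp_sub, Real.exp_sub, Real.exp_add, Real.exp_sub, Real.exp_log hFA,
      Real.exp_log hFP, Real.exp_log hGA, Real.exp_log hC]
  have hz5 : |z| ≤ 20000 / ℓ ^ 5 := by
    have h1 := Real.log_le_log (mul_pos hFA hGP) hup
    have h2 := Real.log_le_log (mul_pos hGA hFP) hlow
    rw [Real.log_mul hFA.ne' hGP.ne', Real.log_mul (Real.exp_pos _).ne' (mul_pos hGA hFP).ne',
      Real.log_exp, Real.log_mul hGA.ne' hFP.ne'] at h1
    rw [Real.log_mul hGA.ne' hFP.ne', Real.log_mul (Real.exp_pos _).ne' (mul_pos hFA hGP).ne',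
      Real.log_exp, Real.log_mul hFA.ne' hGP.ne'] at h2
    have h3 : |Real.log GP - Real.log C + Λ| ≤ 10 ^ 4 / ℓ ^ 5 := by
      rw [le_div_iff₀ (by positivity)]
      have : ℓ ^ 5 ≤ ℓ ^ 7 := pow_le_pow_right₀ (by linarith) (by norm_num)
      calc _ ≤ |Real.log GP - Real.log C + Λ| * ℓ ^ 7 :=
            mul_le_mul_of_nonneg_left this (abs_nonneg _)
        _ ≤ 49 := hZ
        _ ≤ _ := by norm_num
    have h4 : (20000 : ℝ) / ℓ ^ 5 = 10 ^ 4 / ℓ ^ 5 + 10 ^ 4 / ℓ ^ 5 := by ring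
    rw [abs_le] at h3 ⊢
    rw [h4, hz]
    constructor <;> linarith [h3.1, h3.2]
  have hz1 : |z| ≤ 1 := by
    refine hz5.trans ?_
    rw [div_le_one (by positivity)]
    have := le_self_pow₀ (by linarith : 1 ≤ ℓ) (by norm_num : 5 ≠ 0)
    linarith
  refine ⟨Real.exp z - 1, ?_, ?_⟩
  · refine (Real.abs_exp_sub_one_le hz1).trans ?_
    have : (40000 : ℝ) / ℓ ^ 5 = 2 * (20000 / ℓ ^ 5) := by ring
    rw [this]
    linarith
  · rw [add_sub_cancel, hzexp]
    have he := Real.exp_pos Λ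
    have hc1 := left_ne_zero_of_mul hc
    have hc2 := right_ne_zero_of_mul hc
    field_simp

section Main

variable {n : ℕ} {d : Fin n → ℕ} {ℓ : ℝ}

lemma exists_degIn_eq (hn : (n : ℝ) - 1 = ℓ ^ 20) (hℓ : 10 ^ 6 ≤ ℓ) (heven : Even (∑ w, d w))
    (hβ : ∀ w, |beta n d w| ≤ ℓ) : ∃ G : SimpleGraph (Fin n), ∀ w, degIn G univ w = d w := by
  have h0 : 0 < ℓ := by linarith
  have hbig : (10 ^ 6) ^ 20 ≤ ℓ ^ 20 := pow_le_pow_left₀ (by norm_num) hℓ 20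
  obtain ⟨m, hm, hmn⟩ := exists_pow_twenty_eq (x := n) (by linarith)
  have hℓm : ℓ ≤ m := by
    refine le_of_pow_le_pow_left₀ (by norm_num : 20 ≠ 0) (by linarith) ?_
    linarith
  have hrich : Rich m fun w => (d w : ℤ) := by
    refine rich_of_window hm (by rw [Fintype.card_fin, hmn]) (by exact_mod_cast heven)
      fun a => ?_
    have h1 := abs_window_le hn hℓ hβ a
    have h2 : ℓ ^ 11 ≤ m ^ 11 := pow_le_pow_left₀ h0.le hℓm 11
    rw [Fintype.card_fin, Int.cast_natCast]
    have : 0 < m ^ 11 := by positivity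
    linarith
  have hpos : 0 < (realizations fun w => (d w : ℤ)).card := by exact_mod_cast hrich.card_pos
  obtain ⟨G, hG⟩ := Finset.card_pos.1 hpos
  rw [← degSeqGraphs_eq_realizations, degSeqGraphs, Finset.mem_filter] at hG
  exact ⟨G, hG.2⟩

lemma exists_degProb_eq (hn : (n : ℝ) - 1 = ℓ ^ 20) (hℓ : 10 ^ 6 ≤ ℓ) (heven : Even (∑ w, d w))
    (hβ : ∀ w, |beta n d w| ≤ ℓ) (v : Fin n) (S : Finset (Fin n)) {t : ℕ} (ht : t ≤ d v) :
    ∃ θ : ℝ, |θ| ≤ 40000 / ℓ ^ 5 ∧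
      degProb n d S v t =
        (1 + θ) *
          (((S.card - (if v ∈ S then 1 else 0)).choose t : ℝ) *
            ((n - S.card - (if v ∉ S then 1 else 0)).choose (d v - t) : ℝ) /
            ((n - 1).choose (d v) : ℝ)) *
          Real.exp (Lam1 n d v - Lam3 n d v) * expLamT n d v S t := by
  have h0 : 0 < ℓ := by linarith
  have hN1 : (1 : ℝ) ≤ ℓ ^ 20 := one_le_pow₀ (by linarith)
  have hn2 : 2 ≤ n := by
    have : (2 : ℝ) ≤ n := by linarith
    exact_mod_cast this
  have hwin := abs_window_le hn hℓ hβ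
  have hd : d v ≤ n - 1 := by
    have h1 := (abs_le.1 (hwin v)).2
    have h2 : ℓ ^ 11 ≤ ℓ ^ 20 := pow_le_pow_right₀ (by linarith) (by norm_num)
    have h3 : (d v : ℝ) ≤ ((n - 1 : ℕ) : ℝ) := by
      rw [Nat.cast_sub (by omega), Nat.cast_one]; linarith
    exact_mod_cast h3
  set P := powersetCard (d v) (univ.erase v) with hP
  set A := P.filter fun T => (S ∩ T).card = t with hA
  set D : Fin n → ℤ := fun w => (d w : ℤ) with hD
  set f : Finset (Fin n) → ℝ := fun T => ((realizations (residual D v T)).card : ℝ) with hf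
  set g : Finset (Fin n) → ℝ := fun T => Real.exp (-LamT n d v T) with hg
  have hAP : A ⊆ P := Finset.filter_subset _ _
  have hDeven : Even (∑ w, D w) := by
    have : ∑ w, D w = ((∑ w, d w : ℕ) : ℤ) := by push_cast; rfl
    rw [this]
    exact_mod_cast heven
  have hDn : (Fintype.card (Fin n) : ℝ) - 1 = ℓ ^ 20 := by rw [Fintype.card_fin, hn]
  have hDw : ∀ a, |2 * (D a : ℝ) - ((Fintype.card (Fin n) : ℝ) - 1)| ≤ ℓ ^ 11 := by
    intro a
    rw [Fintype.card_fin, hD, Int.cast_natCast]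
    exact hwin a
  have hfpos : ∀ T ∈ P, 0 < f T := by
    intro T hT
    obtain ⟨hTv, hTk⟩ := mem_powersetCard.1 hT
    exact (rich_residual hℓ hDn hDeven hDw (fun h => Finset.notMem_erase _ _ (hTv h))
      (by rw [hTk])).card_pos
  have hgpos : ∀ T ∈ P, 0 < g T := fun T _ => Real.exp_pos _
  have hosc : ∀ T ∈ P, ∀ T' ∈ P, |(Real.log (f T) - Real.log (g T)) -
      (Real.log (f T') - Real.log (g T'))| ≤ 10 ^ 4 / ℓ ^ 5 := by
    intro T hT T' hT'
    rw [le_div_iff₀ (by positivity)]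
    simp only [hg, Real.log_exp, neg_LamT hn2]
    exact abs_log_card_residual_sub_le hℓ hDn hDeven hDw rfl hT hT'
  have hup := sum_mul_sum_le_exp_mul hAP hfpos hgpos
    fun T hT T' hT' => (abs_le.1 (hosc T hT T' hT')).2
  have hlow := sum_mul_sum_le_exp_mul hAP hgpos hfpos (c := 10 ^ 4 / ℓ ^ 5)
    fun T hT T' hT' => by linarith [(abs_le.1 (hosc T hT T' hT')).1]
  have hPne : P.Nonempty := by
    refine powersetCard_nonempty.2 ?_
    rw [Finset.card_erase_of_mem (Finset.mem_univ _), Finset.card_univ, Fintype.card_fin]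
    exact hd
  have hZ := abs_log_sum_exp_neg_LamT_le hn hℓ hβ v hd
  have hFP : 0 < ∑ T ∈ P, f T := Finset.sum_pos hfpos hPne
  have hGP : 0 < ∑ T ∈ P, g T := Finset.sum_pos hgpos hPne
  have hC : (0 : ℝ) < (n - 1).choose (d v) := by exact_mod_cast Nat.choose_pos hd
  have hprob : degProb n d S v t = (∑ T ∈ A, f T) / ∑ T ∈ P, f T := by
    rw [degProb, card_filter_degIn, card_degSeqGraphs n d v]
    push_cast
    rfl
  have hE : expLamT n d v S t = (∑ T ∈ A, g T) /
      (((S.card - (if v ∈ S then 1 else 0)).choose t : ℝ) *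
        ((n - S.card - (if v ∉ S then 1 else 0)).choose (d v - t) : ℝ)) := by
    rw [expLamT, hA, hP, sum_filter_card_inter v S ht, card_powersetCard_erase,
      card_powersetCard_compl_erase]
  by_cases hAne : A.Nonempty
  swap
  · have hA0 : A = ∅ := Finset.not_nonempty_iff_eq_empty.1 hAne
    refine ⟨0, by rw [abs_zero]; positivity, ?_⟩
    rw [hprob, hE, hA0, Finset.sum_empty, Finset.sum_empty, zero_div, zero_div, mul_zero]
  have hFA : 0 < ∑ T ∈ A, f T := Finset.sum_pos (fun T hT => hfpos T (hAP hT)) hAne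
  have hGA : 0 < ∑ T ∈ A, g T := Finset.sum_pos (fun T hT => hgpos T (hAP hT)) hAne
  have hc : (((S.card - (if v ∈ S then 1 else 0)).choose t : ℝ) *
      ((n - S.card - (if v ∉ S then 1 else 0)).choose (d v - t) : ℝ)) ≠ 0 := by
    have h1 := sum_filter_card_inter v S ht fun _ => 1
    simp only [Finset.sum_const, nsmul_eq_mul, mul_one] at h1
    rw [card_powersetCard_erase, card_powersetCard_compl_erase] at h1
    rw [← h1]
    exact_mod_cast (Finset.card_pos.2 hAne).ne'
  rw [hprob, hE]
  exact exists_relative_error hℓ hFA hFP hGA hGP hC hc hup hlow hZ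

end Main

end SignedGraph

/-- exact form of the point probabilities for degrees into a fixed set, in a
uniformly random graph with given near-regular degree sequence. -/
theorem statement17 :
    ∃ C : ℝ, 0 < C ∧ ∃ n₀ : ℕ, ∀ n : ℕ, n₀ ≤ n → ∀ d : Fin n → ℕ,
      Even (∑ w, d w) →
      (∀ w, |beta n d w| ≤ Real.log n) →
      (∃ G : SimpleGraph (Fin n), ∀ w, degIn G Finset.univ w = d w) ∧
      ∀ (v : Fin n) (S : Finset (Fin n)),
        (n : ℝ) / (Real.log n) ^ ((1 : ℝ) / 8) ≤ min (S.card : ℝ) ((n : ℝ) - (S.card : ℝ)) →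
        ∀ t : ℕ, t ≤ d v →
        ∃ θ : ℝ, |θ| ≤ C * (n : ℝ) ^ (-(1 : ℝ) / 6) ∧
          degProb n d S v t =
            (1 + θ) *
              (((S.card - (if v ∈ S then 1 else 0)).choose t : ℝ) *
                ((n - S.card - (if v ∉ S then 1 else 0)).choose (d v - t) : ℝ) /
                ((n - 1).choose (d v) : ℝ)) *
              Real.exp (Lam1 n d v - Lam3 n d v) * expLamT n d v S t := by
  refine ⟨40000, by norm_num, 10 ^ 120 + 1, fun n hn₀ d heven hβ => ?_⟩
  obtain ⟨ℓ, hℓ, hn⟩ := SignedGraph.exists_pow_twenty_eq (x := (n : ℝ) - 1) (by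
    have : (10 : ℝ) ^ 120 + 1 ≤ n := by exact_mod_cast hn₀
    rw [← pow_mul]
    exact le_sub_iff_add_le.2 this)
  have hβℓ : ∀ w, |beta n d w| ≤ ℓ := fun w =>
    (hβ w).trans (SignedGraph.log_le_of_sub_one_eq_pow hℓ hn)
  refine ⟨SignedGraph.exists_degIn_eq hn hℓ heven hβℓ, fun v S _ t ht => ?_⟩
  obtain ⟨θ, hθ, h⟩ := SignedGraph.exists_degProb_eq hn hℓ heven hβℓ v S ht
  refine ⟨θ, hθ.trans ?_, h⟩
  rw [div_eq_mul_one_div]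
  exact mul_le_mul_of_nonneg_left (SignedGraph.one_div_pow_le_rpow hℓ hn) (by norm_num)
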